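/- Let 𝔻 = {z ∈ ℂ : |z| < 1} be the open unit disc and let f : 𝔻 → ℂ be a continuous function. If the graph Γ(f) = {(z, f(z)) : z ∈ 𝔻} is a pluripolar subset of ℂ², then f is holomorphic on 𝔻. -/

import Mathlib

open Metric Set Polynomial

noncomputable section

/-- A function `u : ℂ → EReal` is subharmonic on an open set `U` if it is upper
semicontinuous on `U` and satisfies the maximum principle with respect to harmonic
majorants of the form `Re p`, `p` a complex polynomial, on every closed disc in `U`. -/
def SubharmonicOn (u : ℂ → EReal) (U : Set ℂ) : Prop :=
  UpperSemicontinuousOn u U ∧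
    ∀ (c : ℂ) (r : ℝ), 0 < r → closedBall c r ⊆ U →
      ∀ p : Polynomial ℂ,
        (∀ z ∈ sphere c r, u z ≤ (((p.eval z).re : ℝ) : EReal)) →
        ∀ z ∈ closedBall c r, u z ≤ (((p.eval z).re : ℝ) : EReal)

/-- `u : ℂ^N → [-∞, ∞)` is plurisubharmonic if it is upper semicontinuous, takes values
in `[-∞, ∞)`, and its restriction to every complex affine line is subharmonic. -/
def Plurisubharmonic {N : ℕ} (u : (Fin N → ℂ) → EReal) : Prop :=
  UpperSemicontinuous u ∧ (∀ z, u z ≠ ⊤) ∧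
    ∀ a b : Fin N → ℂ, SubharmonicOn (fun t : ℂ => u (a + t • b)) Set.univ

/-- A set `E ⊆ ℂ^N` is pluripolar if there is a plurisubharmonic function on `ℂ^N`,
not identically `-∞`, which is `-∞` on `E`. -/
def Pluripolar {N : ℕ} (E : Set (Fin N → ℂ)) : Prop :=
  ∃ u : (Fin N → ℂ) → EReal,
    Plurisubharmonic u ∧ ¬ (∀ z, u z = ⊥) ∧ ∀ z ∈ E, u z = ⊥

section
open Metric Set Polynomial
noncomputable section

lemma trig_span (F : C(AddCircle (2 * Real.pi), ℂ))
    (hF : F ∈ Submodule.span ℂ (range (@fourier (2 * Real.pi)))) :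
    ∃ P Q : ℂ[X], ∀ x : AddCircle (2 * Real.pi),
      F x = P.eval (AddCircle.toCircle x : ℂ) +
        (starRingEnd ℂ) (Q.eval (AddCircle.toCircle x : ℂ)) := by
  induction hF using Submodule.span_induction with
  | mem F h =>
    obtain ⟨n, rfl⟩ := h
    have key : ∀ k : ℕ, ∀ x : AddCircle (2 * Real.pi),
        fourier (k : ℤ) x = (AddCircle.toCircle x : ℂ) ^ k := by
      intro k x
      induction k with
      | zero => simp
      | succ k ih =>
        push_cast
        rw [fourier_add, ih, fourier_one, pow_succ]
    obtain ⟨k, rfl | rfl⟩ := n.eq_nat_or_neg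
    · refine ⟨X ^ k, 0, fun x => ?_⟩
      rw [key]; simp
    · refine ⟨0, X ^ k, fun x => ?_⟩
      rw [fourier_neg, key]; simp
  | zero => exact ⟨0, 0, fun x => by simp⟩
  | add F G _ _ hF hG =>
    obtain ⟨P, Q, h⟩ := hF
    obtain ⟨P', Q', h'⟩ := hG
    refine ⟨P + P', Q + Q', fun x => ?_⟩
    simp [h, h']; ring
  | smul a F _ hF =>
    obtain ⟨P, Q, h⟩ := hF
    refine ⟨C a * P, C ((starRingEnd ℂ) a) * Q, fun x => ?_⟩
    simp [h]; ring

lemma trig_approx (φ : ℂ → ℝ) (hφ : ContinuousOn φ (sphere 0 1)) (η : ℝ) (hη : 0 < η) :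
    ∃ q : ℂ[X], ∀ z ∈ sphere (0 : ℂ) 1, |(q.eval z).re - φ z| ≤ η := by
  have : Fact (0 < 2 * Real.pi) := ⟨by positivity⟩
  have hc : Continuous (fun x : AddCircle (2 * Real.pi) =>
      ((φ (AddCircle.toCircle x : ℂ) : ℝ) : ℂ)) := by
    refine Complex.continuous_ofReal.comp ?_
    refine hφ.comp_continuous (continuous_induced_dom.comp AddCircle.continuous_toCircle) ?_
    intro x; simpa using Circle.norm_coe _
  set g : C(AddCircle (2 * Real.pi), ℂ) := ⟨_, hc⟩ with hg
  have hmem : g ∈ (Submodule.span ℂ (range (@fourier (2 * Real.pi)))).topologicalClosure := by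
    rw [span_fourier_closure_eq_top]; trivial
  have hmem' : g ∈ closure
    ((Submodule.span ℂ (range (@fourier (2 * Real.pi))) : Set C(AddCircle (2 * Real.pi), ℂ))) :=
    hmem
  obtain ⟨F, hF, hd⟩ := Metric.mem_closure_iff.1 hmem' η hη
  obtain ⟨P, Q, hPQ⟩ := trig_span F hF
  refine ⟨P + Q, fun z hz => ?_⟩
  have hz1 : ‖z‖ = 1 := by simpa using hz
  obtain ⟨x, hx⟩ := (AddCircle.homeomorphCircle (T := 2 * Real.pi) (by positivity)).surjective
    ⟨z, by simpa [Submonoid.unitSphere] using hz⟩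
  rw [AddCircle.homeomorphCircle_apply] at hx
  have hxz : (AddCircle.toCircle x : ℂ) = z := by rw [hx]
  have h1 : ‖g x - F x‖ < η := by
    rw [← dist_eq_norm]
    exact lt_of_le_of_lt (ContinuousMap.dist_apply_le_dist x) hd
  have h2 : g x = (φ z : ℂ) := by rw [hg]; simp [hxz]
  have h3 : ((P + Q).eval z).re = (F x).re := by
    rw [hPQ, hxz]; simp
  rw [h3, abs_sub_comm]
  calc |φ z - (F x).re| = |(g x - F x).re| := by rw [h2]; simp
    _ ≤ ‖g x - F x‖ := Complex.abs_re_le_norm _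
    _ ≤ η := h1.le

lemma trig_approx' (c : ℂ) (r : ℝ) (hr : 0 < r) (φ : ℂ → ℝ) (hφ : ContinuousOn φ (sphere c r))
    (η : ℝ) (hη : 0 < η) :
    ∃ q : ℂ[X], ∀ z ∈ sphere c r, |(q.eval z).re - φ z| ≤ η := by
  obtain ⟨q, hq⟩ := trig_approx (fun t => φ (c + r * t)) (by
    refine hφ.comp (by fun_prop) ?_
    intro t ht
    have : ‖t‖ = 1 := by simpa using ht
    simp [this, abs_of_pos hr]) η hη
  refine ⟨q.comp (C (1 / (r : ℂ)) * (X - C c)), fun z hz => ?_⟩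
  have hr' : (r : ℂ) ≠ 0 := by exact_mod_cast hr.ne'
  have hz' : ‖z - c‖ = r := by simpa [dist_eq_norm] using hz
  have := hq ((z - c) / r) (by simp [hz', abs_of_pos hr, hr.ne'])
  have e : c + r * ((z - c) / r) = z := by field_simp; ring
  rw [e] at this
  convert this using 4
  simp; ring_nf

lemma circleAverage_poly_re (q : ℂ[X]) (c : ℂ) (r : ℝ) :
    Real.circleAverage (fun z => (q.eval z).re) c r = (q.eval c).re := by
  have h1 : CircleIntegrable (fun z => q.eval z) c r :=
    (q.continuous.continuousOn).circleIntegrable'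
  have h := Complex.reCLM.circleAverage_comp_comm h1
  have h2 : Real.circleAverage (fun z => q.eval z) c r = q.eval c :=
    DiffContOnCl.circleAverage q.differentiable.diffContOnCl
  rw [h2] at h
  exact h

/-- one-dimensional submean from polynomial majorants -/
lemma submean_cont (h : ℂ → ℝ) (hp : ∀ q : ℂ[X], (∀ z ∈ sphere (0 : ℂ) 1, h z ≤ (q.eval z).re) →
    h 0 ≤ (q.eval 0).re) (φ : ℂ → ℝ) (hφ : ContinuousOn φ (sphere 0 1))
    (hle : ∀ z ∈ sphere (0 : ℂ) 1, h z ≤ φ z) : h 0 ≤ Real.circleAverage φ 0 1 := by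
  refine le_of_forall_pos_le_add fun ε hε => ?_
  obtain ⟨q, hq⟩ := trig_approx (fun z => φ z + ε / 2) (by fun_prop) (ε / 2) (by positivity)
  have h1 := hp q (fun z hz => by
    have := hle z hz
    have h2 := (abs_le.1 (hq z hz)).1
    linarith)
  rw [← circleAverage_poly_re q 0 1] at h1
  refine h1.trans ?_
  have hcint : CircleIntegrable φ 0 1 := by
    apply ContinuousOn.circleIntegrable'; simpa using hφ
  have : Real.circleAverage (fun z => φ z + ε) 0 1 = Real.circleAverage φ 0 1 + ε := by
    rw [Real.circleAverage_fun_add hcint (circleIntegrable_const _ _ _), Real.circleAverage_const]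
  rw [← this]
  apply Real.circleAverage_mono
  · apply ContinuousOn.circleIntegrable'
    exact (Complex.continuous_re.comp q.continuous).continuousOn
  · exact hcint.add (circleIntegrable_const _ _ _)
  · intro z hz
    have := (abs_le.1 (hq z (by simpa using hz))).2
    linarith

lemma submean_usc (h : ℂ → ℝ) (hu : UpperSemicontinuous h) (B : ℝ) (hB : ∀ z, B ≤ h z)
    (hp : ∀ q : ℂ[X], (∀ z ∈ sphere (0 : ℂ) 1, h z ≤ (q.eval z).re) →
    h 0 ≤ (q.eval 0).re) : h 0 ≤ Real.circleAverage h 0 1 := by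
  have hne : (sphere (0 : ℂ) 1).Nonempty := ⟨1, by simp⟩
  obtain ⟨zm, hzm, hmax⟩ := (hu.upperSemicontinuousOn (sphere (0 : ℂ) 1)).exists_isMaxOn hne
    (isCompact_sphere _ _)
  set M := h zm
  have hM : ∀ z ∈ sphere (0 : ℂ) 1, h z ≤ M := fun z hz => hmax hz
  let S := sphere (0 : ℂ) 1
  have : Nonempty S := ⟨⟨1, by simp [S]⟩⟩
  let φ : ℕ → ℂ → ℝ := fun K z => ⨆ s : S, (h s - K * dist z s)
  have hbdd : ∀ (K : ℕ) (z : ℂ), BddAbove (range fun s : S => (h s - (K : ℝ) * dist z s)) := by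
    intro K z
    refine ⟨M, ?_⟩
    rintro _ ⟨s, rfl⟩
    have := hM s s.2
    have : 0 ≤ (K : ℝ) * dist z s := by positivity
    simp only; linarith
  have hge : ∀ K, ∀ z ∈ sphere (0 : ℂ) 1, h z ≤ φ K z := by
    intro K z hz
    have := le_ciSup (hbdd K z) ⟨z, hz⟩
    simpa using this
  have hleM : ∀ K z, φ K z ≤ M := by
    intro K z
    refine ciSup_le fun s => ?_
    have := hM s s.2
    have : 0 ≤ (K : ℝ) * dist z s := by positivity
    linarith
  have hLip : ∀ K : ℕ, LipschitzWith (K : NNReal) (φ K) := by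
    intro K
    apply LipschitzWith.of_le_add_mul
    intro x y
    refine ciSup_le fun s => ?_
    have h1 := le_ciSup (hbdd K y) s
    have h2 : dist y s ≤ dist x y + dist x s := by
      rw [dist_comm x y]; exact dist_triangle _ _ _
    have h3 : (K : ℝ) * dist y s ≤ K * (dist x y + dist x s) := by gcongr
    have h4 : h s - K * dist y s ≤ φ K y := h1
    push_cast
    linarith
  have htend : ∀ z ∈ sphere (0 : ℂ) 1,
      Filter.Tendsto (fun K => φ K z) Filter.atTop (nhds (h z)) := by
    intro z hz
    rw [Metric.tendsto_atTop]
    intro ε hε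
    have hev := hu z (h z + ε / 2) (by linarith)
    obtain ⟨δ, hδ, hball⟩ := Metric.eventually_nhds_iff.1 hev
    obtain ⟨K0, hK0⟩ := exists_nat_gt ((M - h z) / δ)
    refine ⟨K0, fun K hK => ?_⟩
    have h1 := hge K z hz
    have h2 : φ K z ≤ h z + ε / 2 := by
      refine ciSup_le fun s => ?_
      have hnn : 0 ≤ (K : ℝ) * dist z s := by positivity
      by_cases hd : dist (s : ℂ) z < δ
      · have := hball hd
        linarith
      · push Not at hd
        rw [dist_comm] at hd
        have h3 : (K0 : ℝ) ≤ K := by exact_mod_cast hK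
        have h4 : (M - h z) / δ ≤ K := by linarith
        rw [div_le_iff₀ hδ] at h4
        have h5 : (K : ℝ) * δ ≤ K * dist z s := by gcongr
        have := hM s s.2
        linarith
    rw [Real.dist_eq, abs_lt]
    constructor <;> linarith
  have hcm : ∀ θ, circleMap 0 1 θ ∈ sphere (0 : ℂ) 1 := fun θ =>
    circleMap_mem_sphere 0 (by norm_num) θ
  have hlim : Filter.Tendsto (fun K => Real.circleAverage (φ K) 0 1) Filter.atTop
      (nhds (Real.circleAverage h 0 1)) := by
    unfold Real.circleAverage
    apply Filter.Tendsto.const_smul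
    apply intervalIntegral.tendsto_integral_filter_of_dominated_convergence
      (fun _ => max |B| |M|)
    · refine Filter.Eventually.of_forall fun K => ?_
      exact ((hLip K).continuous.comp (continuous_circleMap 0 1)).aestronglyMeasurable
    · refine Filter.Eventually.of_forall fun K => Filter.Eventually.of_forall fun θ _ => ?_
      have h1 := hge K _ (hcm θ)
      have h2 := hleM K (circleMap 0 1 θ)
      have h3 := hB (circleMap 0 1 θ)
      rw [Real.norm_eq_abs]
      exact abs_le_max_abs_abs (h3.trans h1) h2
    · exact intervalIntegrable_const
    · refine Filter.Eventually.of_forall fun θ _ => htend _ (hcm θ)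
  refine ge_of_tendsto hlim (Filter.Eventually.of_forall fun K => ?_)
  exact submean_cont h hp (φ K) (hLip K).continuous.continuousOn (hge K)

lemma usc_circleIntegrable (h : ℂ → ℝ) (hu : UpperSemicontinuous h) (B : ℝ) (hB : ∀ z, B ≤ h z)
    (c : ℂ) (r : ℝ) : CircleIntegrable h c r := by
  obtain ⟨zm, hzm, hmax⟩ := (hu.upperSemicontinuousOn (sphere c |r|)).exists_isMaxOn
    ⟨c + |r|, by simp⟩ (isCompact_sphere _ _)
  unfold CircleIntegrable
  apply MeasureTheory.IntegrableOn.intervalIntegrable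
  apply MeasureTheory.Measure.integrableOn_of_bounded (M := max |B| |h zm|)
  · exact measure_Icc_lt_top.ne
  · exact (hu.measurable.comp (continuous_circleMap c r).measurable).aestronglyMeasurable
  · refine Filter.Eventually.of_forall fun θ => ?_
    rw [Real.norm_eq_abs]
    refine abs_le_max_abs_abs (hB _) (hmax ?_)
    exact circleMap_mem_sphere' c r θ

end
end

section
open Metric Set Polynomial
noncomputable section

lemma usc_comp {X Y : Type*} [TopologicalSpace X] [TopologicalSpace Y] {w : Y → ℝ}
    (hw : UpperSemicontinuous w) {g : X → Y} (hg : Continuous g) :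
    UpperSemicontinuous (fun x => w (g x)) := by
  intro x c hc
  exact hg.continuousAt.eventually (hw (g x) c hc)

structure Psh (w : ℂ × ℂ → ℝ) (B : ℝ) : Prop where
  usc : UpperSemicontinuous w
  lb : ∀ p, B ≤ w p
  sm : ∀ p x : ℂ × ℂ, w p ≤ Real.circleAverage (fun t : ℂ => w (p + t • x)) 0 1

def cut (u : (Fin 2 → ℂ) → EReal) (N : ℝ) (p : ℂ × ℂ) : ℝ :=
  (max (u ![p.1, p.2]) ((-N : ℝ) : EReal)).toReal

lemma coe_cut {u : (Fin 2 → ℂ) → EReal} (hu : ∀ z, u z ≠ ⊤) (N : ℝ) (p : ℂ × ℂ) :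
    ((cut u N p : ℝ) : EReal) = max (u ![p.1, p.2]) ((-N : ℝ) : EReal) := by
  unfold cut
  rw [EReal.coe_toReal]
  · intro h
    rcases max_choice (u ![p.1, p.2]) ((-N : ℝ) : EReal) with h' | h'
    · exact hu _ (h' ▸ h)
    · rw [h'] at h; exact EReal.coe_ne_top _ h
  · intro h
    have := le_max_right (u ![p.1, p.2]) ((-N : ℝ) : EReal)
    rw [h, le_bot_iff] at this
    exact EReal.coe_ne_bot _ this

lemma cut_usc {u : (Fin 2 → ℂ) → EReal} (hu : Plurisubharmonic u) (N : ℝ) :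
    UpperSemicontinuous (cut u N) := by
  intro p c hc
  have h1 : ((cut u N p : ℝ) : EReal) < c := by exact_mod_cast hc
  rw [coe_cut hu.2.1, max_lt_iff] at h1
  have hcont : Continuous (fun p : ℂ × ℂ => (![p.1, p.2] : Fin 2 → ℂ)) := by
    refine continuous_pi fun i => ?_
    fin_cases i <;> simp <;> fun_prop
  have h2 := hcont.continuousAt.eventually (hu.1 ![p.1, p.2] c h1.1)
  filter_upwards [h2] with q hq
  have : ((cut u N q : ℝ) : EReal) < c := by
    rw [coe_cut hu.2.1, max_lt_iff]; exact ⟨hq, h1.2⟩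
  exact_mod_cast this

lemma cut_ge {u : (Fin 2 → ℂ) → EReal} (hu : ∀ z, u z ≠ ⊤) (N : ℝ) (p : ℂ × ℂ) :
    -N ≤ cut u N p := by
  have : ((-N : ℝ) : EReal) ≤ cut u N p := by rw [coe_cut hu]; exact le_max_right _ _
  exact_mod_cast this

lemma le_cut {u : (Fin 2 → ℂ) → EReal} (hu : ∀ z, u z ≠ ⊤) (N : ℝ) (p : ℂ × ℂ) :
    u ![p.1, p.2] ≤ cut u N p := by
  rw [coe_cut hu]; exact le_max_left _ _

lemma cut_psh {u : (Fin 2 → ℂ) → EReal} (hu : Plurisubharmonic u) (N : ℝ) :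
    Psh (cut u N) (-N) where
  usc := cut_usc hu N
  lb := cut_ge hu.2.1 N
  sm := by
    intro p x
    have hvec : ∀ t : ℂ, (![(p + t • x).1, (p + t • x).2] : Fin 2 → ℂ) =
        ![p.1, p.2] + t • ![x.1, x.2] := by
      intro t; ext i; fin_cases i <;> simp
    have := submean_usc (fun t : ℂ => cut u N (p + t • x))
      (usc_comp (cut_usc hu N) (by fun_prop)) (-N) (fun t => cut_ge hu.2.1 N _) (by
        intro q hq
        have h1 := (hu.2.2 ![p.1, p.2] ![x.1, x.2]).2 0 1 one_pos (subset_univ _) q (by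
          intro z hz
          have h2 : ((cut u N (p + z • x) : ℝ) : EReal) ≤ ((q.eval z).re : ℝ) := by
            exact_mod_cast hq z hz
          have h3 := le_cut hu.2.1 N (p + z • x)
          rw [hvec] at h3
          exact h3.trans h2) 0 (by simp)
        have h4 : -N ≤ (q.eval 0).re := by
          rw [← circleAverage_poly_re q 0 1]
          have : -N = Real.circleAverage (fun _ : ℂ => -N) 0 1 :=
            (Real.circleAverage_const _ _ _).symm
          rw [this]
          apply Real.circleAverage_mono (circleIntegrable_const _ _ _)
          · apply ContinuousOn.circleIntegrable'
            exact (Complex.continuous_re.comp q.continuous).continuousOn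
          · intro z hz
            exact (cut_ge hu.2.1 N (p + z • x)).trans (hq z (by simpa using hz))
        have : ((cut u N (p + (0 : ℂ) • x) : ℝ) : EReal) ≤ ((q.eval 0).re : ℝ) := by
          rw [coe_cut hu.2.1, max_le_iff, hvec]
          exact ⟨h1, by exact_mod_cast h4⟩
        exact_mod_cast this)
    simpa using this

lemma usc_bddAbove {w : ℂ × ℂ → ℝ} (hw : UpperSemicontinuous w) {K : Set (ℂ × ℂ)}
    (hK : IsCompact K) : ∃ M, 0 ≤ M ∧ ∀ p ∈ K, w p ≤ M := by
  by_cases hne : K.Nonempty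
  · obtain ⟨z, hz, hmax⟩ := (hw.upperSemicontinuousOn K).exists_isMaxOn hne hK
    exact ⟨max 0 (w z), le_max_left _ _, fun p hp => (hmax hp).trans (le_max_right _ _)⟩
  · exact ⟨0, le_rfl, fun p hp => (hne ⟨p, hp⟩).elim⟩

lemma cut_le_of_le {u : (Fin 2 → ℂ) → EReal} (hu : ∀ z, u z ≠ ⊤) {N M : ℝ} {p : ℂ × ℂ}
    (hM : -N ≤ M) (h : u ![p.1, p.2] ≤ M) : cut u N p ≤ M := by
  have : ((cut u N p : ℝ) : EReal) ≤ M := by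
    rw [coe_cut hu, max_le_iff]; exact ⟨h, by exact_mod_cast hM⟩
  exact_mod_cast this

lemma bot_of_open {u : (Fin 2 → ℂ) → EReal} (hu : Plurisubharmonic u) (q : ℂ × ℂ) (ρ : ℝ)
    (hρ : 0 < ρ) (hq : ∀ p ∈ ball q ρ, u ![p.1, p.2] = ⊥) : ∀ z, u z = ⊥ := by
  intro z
  have hz : z = ![z 0, z 1] := by ext i; fin_cases i <;> rfl
  rw [hz]
  set p : ℂ × ℂ := (z 0, z 1) with hp
  change u ![p.1, p.2] = ⊥
  by_contra hbot
  -- the circle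
  set x := q - p with hx
  obtain ⟨M, hM0, hM⟩ := usc_bddAbove (cut_usc hu 0)
    ((isCompact_sphere (0 : ℂ) 1).image (f := fun t : ℂ => p + t • x) (by fun_prop))
  obtain ⟨δ, hδ, hδ'⟩ : ∃ δ > 0, ∀ θ : ℝ, |θ| ≤ δ → p + (circleMap 0 1 θ) • x ∈ ball q ρ := by
    have hc : Continuous (fun θ : ℝ => p + (circleMap 0 1 θ) • x) := by fun_prop
    have h0 : p + (circleMap 0 1 0) • x = q := by simp [circleMap, hx]
    have := (hc.continuousAt (x := 0)).preimage_mem_nhds (t := ball q ρ) (by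
      rw [h0]; exact ball_mem_nhds q hρ)
    obtain ⟨δ, hδ, h⟩ := Metric.mem_nhds_iff.1 this
    refine ⟨δ / 2, by positivity, fun θ hθ => h ?_⟩
    rw [mem_ball, Real.dist_eq, sub_zero]; linarith
  set d := min δ 1
  have hd : 0 < d := by positivity
  have hd2 : d ≤ 2 * Real.pi := by
    have := Real.pi_gt_three; have : d ≤ 1 := min_le_right _ _; linarith
  have hmain : ∀ N : ℝ, 0 ≤ N → (u ![p.1, p.2]).toReal ≤
      (2 * Real.pi)⁻¹ * (d * (-N) + (2 * Real.pi - d) * M) := by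
    intro N hN
    have h1 : (u ![p.1, p.2]).toReal ≤ cut u N p := by
      have := le_cut hu.2.1 N p
      rw [← EReal.coe_toReal (hu.2.1 _) hbot] at this
      exact_mod_cast this
    refine h1.trans (((cut_psh hu N).sm p x).trans ?_)
    unfold Real.circleAverage
    rw [smul_eq_mul]
    gcongr
    have hI : ∀ a b, IntervalIntegrable (fun θ => cut u N (p + circleMap 0 1 θ • x))
        MeasureTheory.volume a b := by
      intro a b
      have h2 := usc_circleIntegrable (fun t : ℂ => cut u N (p + t • x))
        (usc_comp (cut_usc hu N) (by fun_prop)) (-N) (fun t => cut_ge hu.2.1 N _) 0 1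
      have hper : Function.Periodic (fun θ => cut u N (p + circleMap 0 1 θ • x)) (2 * Real.pi) := by
        intro θ; simp [periodic_circleMap 0 1 θ]
      exact hper.intervalIntegrable₀ (by positivity) h2 a b
    rw [← intervalIntegral.integral_add_adjacent_intervals (hI 0 d) (hI d (2 * Real.pi))]
    have e1 : ∫ θ in (0 : ℝ)..d, cut u N (p + circleMap 0 1 θ • x) ≤ d * (-N) := by
      have : d * (-N) = ∫ θ in (0 : ℝ)..d, (-N) := by simp
      rw [this]
      apply intervalIntegral.integral_mono_on hd.le (hI _ _) intervalIntegrable_const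
      intro θ hθ
      apply cut_le_of_le hu.2.1 le_rfl
      rw [hq _ (hδ' θ (by rw [abs_of_nonneg hθ.1]; exact hθ.2.trans (min_le_left _ _)))]
      exact bot_le
    have e2 : ∫ θ in d..(2 * Real.pi), cut u N (p + circleMap 0 1 θ • x) ≤
        (2 * Real.pi - d) * M := by
      have : (2 * Real.pi - d) * M = ∫ θ in d..(2 * Real.pi), M := by simp
      rw [this]
      apply intervalIntegral.integral_mono_on hd2 (hI _ _) intervalIntegrable_const
      intro θ hθ
      apply cut_le_of_le hu.2.1 (by linarith)
      refine (le_cut hu.2.1 0 _).trans ?_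
      exact_mod_cast hM _ ⟨_, circleMap_mem_sphere 0 (by norm_num) θ, rfl⟩
    linarith
  set a := (u ![p.1, p.2]).toReal
  have hpi : 0 < 2 * Real.pi := by positivity
  have h := hmain ((|a| * (2 * Real.pi) + (2 * Real.pi - d) * M) / d + 1) (by
    have : 0 ≤ (2 * Real.pi - d) * M := mul_nonneg (by linarith) hM0
    positivity)
  rw [← div_eq_inv_mul, le_div_iff₀ hpi] at h
  have e : d * (-((|a| * (2 * Real.pi) + (2 * Real.pi - d) * M) / d + 1)) =
    -((|a| * (2 * Real.pi) + (2 * Real.pi - d) * M)) - d := by field_simp; ring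
  rw [e] at h
  nlinarith [neg_abs_le a]

end
end

section
open Metric Set Polynomial MeasureTheory
noncomputable section

lemma usc_locInt {h : ℂ × ℂ → ℝ} {B : ℝ} (hu : UpperSemicontinuous h) (hB : ∀ p, B ≤ h p) :
    LocallyIntegrable h := by
  rw [locallyIntegrable_iff]
  intro K hK
  obtain ⟨M, hM0, hM⟩ := usc_bddAbove hu hK
  apply MeasureTheory.Measure.integrableOn_of_bounded (M := max |B| |M|)
  · exact hK.measure_lt_top.ne
  · exact hu.measurable.aestronglyMeasurable
  · refine (ae_restrict_mem hK.measurableSet).mono fun p hp => ?_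
    rw [Real.norm_eq_abs]
    exact abs_le_max_abs_abs (hB _) (hM p hp)

lemma fub_int {h : ℂ × ℂ → ℝ} {B : ℝ} (hu : UpperSemicontinuous h) (hB : ∀ p, B ≤ h p)
    (χ : ℂ × ℂ → ℝ) (hχ : Continuous χ) (hχs : HasCompactSupport χ) (hχ0 : ∀ y, 0 ≤ χ y)
    (G : ℝ × (ℂ × ℂ) → ℂ × ℂ) (hG : Continuous G) :
    Integrable (fun z : ℝ × (ℂ × ℂ) => χ z.2 * h (G z))
      ((volume.restrict (Ioc 0 (2 * Real.pi))).prod volume) := by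
  obtain ⟨M, hM0, hM⟩ := usc_bddAbove hu
    (((isCompact_Icc (a := 0) (b := 2 * Real.pi)).prod hχs).image hG)
  have hI : Integrable (fun z : ℝ × (ℂ × ℂ) => (max |B| |M|) * χ z.2)
      ((volume.restrict (Ioc 0 (2 * Real.pi))).prod volume) := by
    have h1 : Integrable (fun _ : ℝ => max |B| |M|) (volume.restrict (Ioc 0 (2 * Real.pi))) :=
      integrable_const _
    exact h1.mul_prod (hχ.integrable_of_hasCompactSupport hχs)
  refine hI.mono' ?_ ?_
  · exact ((hχ.measurable.comp measurable_snd).mul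
      (hu.measurable.comp hG.measurable)).aestronglyMeasurable
  · have hmem : ∀ᵐ z ∂((volume.restrict (Ioc 0 (2 * Real.pi))).prod
        (volume : Measure (ℂ × ℂ))), z.1 ∈ Ioc 0 (2 * Real.pi) := by
      have := ae_restrict_mem (μ := (volume : Measure ℝ)) (measurableSet_Ioc (a := 0)
        (b := 2 * Real.pi))
      exact Measure.quasiMeasurePreserving_fst.ae this
    refine hmem.mono fun z hz => ?_
    rw [norm_mul, Real.norm_eq_abs, Real.norm_eq_abs, abs_of_nonneg (hχ0 _), mul_comm]
    by_cases h0 : χ z.2 = 0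
    · simp [h0]
    · apply mul_le_mul_of_nonneg_right _ (hχ0 _)
      exact abs_le_max_abs_abs (hB _) (hM _ ⟨z, ⟨Ioc_subset_Icc_self hz,
        subset_tsupport _ h0⟩, rfl⟩)

lemma rot_mp (a : ℂ) (ha : ‖a‖ = 1) :
    MeasurePreserving (fun y : ℂ × ℂ => a • y) := by
  have h1 : MeasurePreserving (fun y : ℂ => a * y) := by
    have := (rotation ⟨a, by simpa [Submonoid.unitSphere] using ha⟩).measurePreserving
    exact this
  exact h1.prod h1

lemma rot_int (F : ℂ × ℂ → ℝ) (a : ℂ) (ha : ‖a‖ = 1) : ∫ y, F (a • y) = ∫ y, F y := by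
  have ha0 : a ≠ 0 := by rintro rfl; simp at ha
  have := (rot_mp a ha).integral_comp (g := F)
    (Homeomorph.smulOfNeZero a ha0).measurableEmbedding
  exact this

theorem smooth_psh {h : ℂ × ℂ → ℝ} {B : ℝ} (hh : Psh h B) (ε : ℝ) (hε : 0 < ε) :
    ∃ w : ℂ × ℂ → ℝ, ContDiff ℝ 2 w ∧ Psh w B ∧ (∀ p, h p ≤ w p) ∧
      ∀ p M, (∀ q, dist q p < ε → h q ≤ M) → w p ≤ M := by
  have : (volume : Measure (ℂ × ℂ)).IsAddHaarMeasure := by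
    rw [Measure.volume_eq_prod]; infer_instance
  set χ : ℂ × ℂ → ℝ := fun y => Real.smoothTransition (ε ^ 2 - (‖y.1‖ ^ 2 + ‖y.2‖ ^ 2)) with hχdef
  have hχsm : ContDiff ℝ 2 χ := by
    apply Real.smoothTransition.contDiff.comp
    exact contDiff_const.sub ((contDiff_fst.norm_sq ℝ).add (contDiff_snd.norm_sq ℝ))
  have hχc : Continuous χ := hχsm.continuous
  have hχ0 : ∀ y, 0 ≤ χ y := fun y => Real.smoothTransition.nonneg _
  have hχz : ∀ y, χ y ≠ 0 → ‖y‖ < ε := by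
    intro y hy
    by_contra hcon
    push Not at hcon
    apply hy
    apply Real.smoothTransition.zero_of_nonpos
    have : ε ≤ ‖y.1‖ ∨ ε ≤ ‖y.2‖ := by rwa [Prod.norm_def, le_max_iff] at hcon
    rcases this with h1 | h1
    · have : ε ^ 2 ≤ ‖y.1‖ ^ 2 := by gcongr
      nlinarith [sq_nonneg ‖y.2‖]
    · have : ε ^ 2 ≤ ‖y.2‖ ^ 2 := by gcongr
      nlinarith [sq_nonneg ‖y.1‖]
  have hχs : HasCompactSupport χ := by
    apply HasCompactSupport.intro (isCompact_closedBall (0 : ℂ × ℂ) ε)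
    intro y hy
    by_contra hcon
    exact hy (by simpa using (hχz y hcon).le)
  have hχi : Integrable χ := hχc.integrable_of_hasCompactSupport hχs
  have hχrot : ∀ a : ℂ, ‖a‖ = 1 → ∀ y, χ (a • y) = χ y := by
    intro a ha y; simp [hχdef, ha]
  set κ := ∫ y, χ y with hκ
  have hκ0 : 0 < κ := by
    apply hχc.integral_pos_of_hasCompactSupport_nonneg_nonzero hχs hχ0 (x := 0)
    simp only [hχdef]
    apply ne_of_gt
    apply Real.smoothTransition.pos_of_pos
    simpa using pow_pos hε 2
  have hloc := usc_locInt hh.usc hh.lb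
  have hIy : ∀ p, Integrable (fun y => χ y * h (p - y)) := by
    intro p
    exact hχs.convolutionExists_left (ContinuousLinearMap.lsmul ℝ ℝ) hχc hloc p
  have hfub : ∀ G : ℝ × (ℂ × ℂ) → ℂ × ℂ, Continuous G →
      ∫ y, χ y * (∫ θ in (0 : ℝ)..(2 * Real.pi), h (G (θ, y))) =
      ∫ θ in (0 : ℝ)..(2 * Real.pi), ∫ y, χ y * h (G (θ, y)) := by
    intro G hG
    have h2 : (0 : ℝ) ≤ 2 * Real.pi := by positivity
    simp only [intervalIntegral.integral_of_le h2]
    rw [integral_integral_swap (f := fun θ y => χ y * h (G (θ, y)))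
      (fub_int hh.usc hh.lb χ hχc hχs hχ0 G hG)]
    congr 1
    ext y
    rw [integral_const_mul]
  have hfubi : ∀ G : ℝ × (ℂ × ℂ) → ℂ × ℂ, Continuous G →
      Integrable (fun y => χ y * (∫ θ in (0 : ℝ)..(2 * Real.pi), h (G (θ, y)))) := by
    intro G hG
    have h2 : (0 : ℝ) ≤ 2 * Real.pi := by positivity
    simp only [intervalIntegral.integral_of_le h2]
    have := (fub_int hh.usc hh.lb χ hχc hχs hχ0 G hG).integral_prod_right
    refine this.congr (Filter.Eventually.of_forall fun y => ?_)
    simp only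
    rw [integral_const_mul]
  set w : ℂ × ℂ → ℝ := fun p => κ⁻¹ * ∫ y, χ y * h (p - y) with hw
  have hwsm : ContDiff ℝ 2 w := by
    apply ContDiff.mul contDiff_const
    exact hχs.contDiff_convolution_left (ContinuousLinearMap.lsmul ℝ ℝ) hχsm hloc
  have hconst : ∀ c : ℝ, c = κ⁻¹ * ∫ y, χ y * c := by
    intro c; rw [integral_mul_const, ← hκ]; field_simp
  refine ⟨w, hwsm, ⟨hwsm.continuous.upperSemicontinuous, ?_, ?_⟩, ?_, ?_⟩
  · intro p
    rw [hconst B]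
    simp only [hw]
    gcongr κ⁻¹ * ?_
    apply integral_mono (hχi.mul_const _) (hIy p)
    intro y
    exact mul_le_mul_of_nonneg_left (hh.lb _) (hχ0 y)
  · -- submean
    intro p x
    simp only [hw]
    have h0 : Real.circleAverage (fun t : ℂ => κ⁻¹ * ∫ y, χ y * h (p + t • x - y)) 0 1 =
        κ⁻¹ * Real.circleAverage (fun t : ℂ => ∫ y, χ y * h (p + t • x - y)) 0 1 :=
      Real.circleAverage_fun_smul (a := κ⁻¹)
    rw [h0]
    unfold Real.circleAverage
    have hG : Continuous (fun z : ℝ × (ℂ × ℂ) => p + circleMap 0 1 z.1 • x - z.2) := by fun_prop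
    rw [← hfub _ hG]
    simp only [smul_eq_mul]
    gcongr
    rw [← integral_const_mul]
    apply integral_mono (hIy p) ((hfubi _ hG).const_mul _)
    intro y
    have h1 := hh.sm (p - y) x
    unfold Real.circleAverage at h1
    simp only [smul_eq_mul] at h1
    have h2 : ∀ θ, p - y + circleMap 0 1 θ • x = p + circleMap 0 1 θ • x - y := by
      intro θ; abel
    simp only [h2] at h1
    calc χ y * h (p - y) ≤ χ y * _ := mul_le_mul_of_nonneg_left h1 (hχ0 y)
      _ = _ := by ring
  · -- w ≥ h
    intro p
    have hG : Continuous (fun z : ℝ × (ℂ × ℂ) => p + circleMap 0 1 z.1 • z.2) := by fun_prop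
    have h1 : ∀ θ : ℝ, ∫ y, χ y * h (p + circleMap 0 1 θ • y) = ∫ y, χ y * h (p - y) := by
      intro θ
      have hn : ‖-circleMap 0 1 θ‖ = 1 := by simp
      rw [← rot_int (fun y => χ y * h (p - y)) (-circleMap 0 1 θ) hn]
      congr 1
      ext y
      rw [hχrot _ hn]
      simp
    have h2 := hfub _ hG
    simp only [h1] at h2
    rw [intervalIntegral.integral_const, sub_zero, smul_eq_mul] at h2
    have h3 : ∫ y, χ y * (2 * Real.pi * h p) ≤
        ∫ y, χ y * (∫ θ in (0 : ℝ)..(2 * Real.pi), h (p + circleMap 0 1 θ • y)) := by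
      apply integral_mono (hχi.mul_const _) (hfubi _ hG)
      intro y
      simp only
      apply mul_le_mul_of_nonneg_left _ (hχ0 y)
      have h4 := hh.sm p y
      unfold Real.circleAverage at h4
      rw [smul_eq_mul, ← div_eq_inv_mul, le_div_iff₀ (by positivity)] at h4
      linarith
    rw [h2, integral_mul_const] at h3
    have h5 : κ * h p ≤ ∫ y, χ y * h (p - y) := by
      have hpi : 0 < 2 * Real.pi := by positivity
      have : 2 * Real.pi * (κ * h p) ≤ 2 * Real.pi * ∫ y, χ y * h (p - y) := by
        calc _ = κ * (2 * Real.pi * h p) := by ring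
          _ ≤ _ := h3
      exact le_of_mul_le_mul_left this hpi
    simp only [hw]
    rw [← div_eq_inv_mul, le_div_iff₀ hκ0]
    linarith
  · intro p M hM
    rw [hconst M]
    simp only [hw]
    gcongr κ⁻¹ * ?_
    apply integral_mono (hIy p) (hχi.mul_const _)
    intro y
    by_cases h0 : χ y = 0
    · simp [h0]
    · apply mul_le_mul_of_nonneg_left _ (hχ0 y)
      apply hM
      have := hχz y h0
      simpa [dist_eq_norm] using this

end
end

section
open Metric Set Polynomial
noncomputable section

lemma taylor2 (w : ℂ × ℂ → ℝ) (hw : ContDiff ℝ 2 w) (p : ℂ × ℂ) :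
    ∃ ℓ : (ℂ × ℂ) →L[ℝ] ℝ, ∃ B : (ℂ × ℂ) →L[ℝ] (ℂ × ℂ) →L[ℝ] ℝ, (∀ x y, B x y = B y x) ∧
      ∀ η > 0, ∃ δ > 0, ∀ y : ℂ × ℂ, ‖y‖ < δ →
        |w (p + y) - w p - ℓ y - 1 / 2 * B y y| ≤ η * ‖y‖ ^ 2 := by
  have hd : Differentiable ℝ w := hw.differentiable (by norm_num)
  have hd2 : Differentiable ℝ (fderiv ℝ w) :=
    (hw.fderiv_right (m := 1) (by norm_num)).differentiable (by norm_num)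
  set ℓ := fderiv ℝ w p
  set B := fderiv ℝ (fderiv ℝ w) p with hB
  have hsym : ∀ x y, B x y = B y x := by
    intro x y
    exact (hw.contDiffAt.isSymmSndFDerivAt (by simp)) x y
  refine ⟨ℓ, B, hsym, fun η hη => ?_⟩
  have h1 := (hd2 p).hasFDerivAt
  rw [hasFDerivAt_iff_isLittleO_nhds_zero] at h1
  obtain ⟨δ, hδ, hb⟩ := Metric.eventually_nhds_iff.1 (h1.bound hη)
  refine ⟨δ, hδ, fun y hy => ?_⟩
  let φ : ℂ × ℂ → ℝ := fun y => w (p + y) - w p - ℓ y - 1 / 2 * B y y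
  have hφ : ∀ x, HasFDerivAt φ (fderiv ℝ w (p + x) - ℓ - B x) x := by
    intro x
    have e1 : HasFDerivAt (fun y => w (p + y)) (fderiv ℝ w (p + x)) x := by
      have := (hd (p + x)).hasFDerivAt
      exact (hasFDerivAt_comp_add_left p).2 this
    have e2 : HasFDerivAt (fun y => B y y) (B x + B.flip x) x := by
      have := B.hasFDerivAt (x := x) |>.clm_apply (hasFDerivAt_id x)
      convert! this using 1
    have e3 := ((e1.sub_const (w p)).sub ℓ.hasFDerivAt).sub (e2.const_mul (1 / 2))
    convert! e3 using 1
    ext v <;> simp [hsym] <;> ring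
  have hmv := Convex.norm_image_sub_le_of_norm_hasFDerivWithin_le (f := φ) (C := η * ‖y‖)
    (s := closedBall 0 ‖y‖) (f' := fun x => fderiv ℝ w (p + x) - ℓ - B x) (x := 0) (y := y)
    (fun x _ => (hφ x).hasFDerivWithinAt) (fun x hx => by
      have hx' : ‖x‖ ≤ ‖y‖ := by simpa using hx
      have := hb (y := x) (by rw [dist_zero_right]; linarith)
      refine this.trans ?_
      gcongr) (convex_closedBall _ _) (by simp) (by simp)
  have e0 : φ 0 = 0 := by simp [φ]
  rw [e0, sub_zero, sub_zero, Real.norm_eq_abs] at hmv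
  calc _ ≤ _ := hmv
    _ = _ := by ring

lemma levi_nonneg (w : ℂ × ℂ → ℝ) {B0 : ℝ} (hw : Psh w B0) (p : ℂ × ℂ)
    (ℓ : (ℂ × ℂ) →L[ℝ] ℝ) (B : (ℂ × ℂ) →L[ℝ] (ℂ × ℂ) →L[ℝ] ℝ) (hs : ∀ x y, B x y = B y x)
    (hT : ∀ η > 0, ∃ δ > 0, ∀ y : ℂ × ℂ, ‖y‖ < δ →
        |w (p + y) - w p - ℓ y - 1 / 2 * B y y| ≤ η * ‖y‖ ^ 2) (y : ℂ × ℂ) :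
    0 ≤ B y y + B (Complex.I • y) (Complex.I • y) := by
  refine le_of_forall_pos_le_add fun ε hε => ?_
  set η := ε / (4 * (‖y‖ ^ 2 + 1)) with hη
  obtain ⟨δ, hδ, hb⟩ := hT η (by positivity)
  set s := δ / (2 * (‖y‖ + 1)) with hsdef
  have hs0 : 0 < s := by positivity
  have hsy : s * ‖y‖ < δ := by
    rw [hsdef, div_mul_eq_mul_div, div_lt_iff₀ (by positivity)]
    nlinarith [norm_nonneg y]
  have h1 := hw.sm p (s • y)
  unfold Real.circleAverage at h1
  rw [smul_eq_mul, ← div_eq_inv_mul, le_div_iff₀ (by positivity)] at h1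
  set a := ℓ y
  set b := ℓ (Complex.I • y)
  set E := B y y
  set F := B (Complex.I • y) (Complex.I • y)
  set C := B y (Complex.I • y)
  set K := w p + η * (s ^ 2 * ‖y‖ ^ 2)
  have hpt : ∀ θ : ℝ, w (p + circleMap 0 1 θ • (s • y)) ≤ K + s * a * Real.cos θ +
      s * b * Real.sin θ + s ^ 2 * E / 2 * Real.cos θ ^ 2 +
      s ^ 2 * C * (Real.sin θ * Real.cos θ) + s ^ 2 * F / 2 * Real.sin θ ^ 2 := by
    intro θ
    have hn : ‖circleMap 0 1 θ • (s • y)‖ = s * ‖y‖ := by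
      rw [norm_smul, norm_smul]; simp [abs_of_pos hs0]
    have h2 := hb (circleMap 0 1 θ • (s • y)) (by rw [hn]; exact hsy)
    rw [hn] at h2
    have hdec : circleMap 0 1 θ • (s • y) = (s * Real.cos θ) • y +
        (s * Real.sin θ) • (Complex.I • y) := by
      have : circleMap 0 1 θ = (Real.cos θ : ℂ) + (Real.sin θ : ℂ) * Complex.I := by
        simp [circleMap, Complex.exp_mul_I]
      rw [this]
      ext <;> simp <;> ring
    have h3 := (abs_le.1 h2).2
    have hC : B (Complex.I • y) y = C := hs _ _
    have e1 : ℓ (circleMap 0 1 θ • (s • y)) = (s * Real.cos θ) * a + (s * Real.sin θ) * b := by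
      rw [hdec, map_add, map_smul, map_smul]; rfl
    have e2 : B (circleMap 0 1 θ • (s • y)) (circleMap 0 1 θ • (s • y)) =
        (s * Real.cos θ) ^ 2 * E + 2 * (s * Real.cos θ) * (s * Real.sin θ) * C +
        (s * Real.sin θ) ^ 2 * F := by
      rw [hdec]
      simp only [map_add, map_smul, add_apply, smul_apply, smul_eq_mul, hC]
      simp only [E, C, F]
      ring
    rw [e1, e2] at h3
    simp only [K]
    nlinarith [h3]
  have hi : ∫ θ in (0 : ℝ)..(2 * Real.pi), (K + s * a * Real.cos θ +
      s * b * Real.sin θ + s ^ 2 * E / 2 * Real.cos θ ^ 2 +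
      s ^ 2 * C * (Real.sin θ * Real.cos θ) + s ^ 2 * F / 2 * Real.sin θ ^ 2) =
      2 * Real.pi * K + s ^ 2 * E / 2 * Real.pi + s ^ 2 * F / 2 * Real.pi := by
    have i1 : ∀ f : ℝ → ℝ, Continuous f → IntervalIntegrable f MeasureTheory.volume 0
      (2 * Real.pi) := fun f hf => hf.intervalIntegrable _ _
    rw [intervalIntegral.integral_add (i1 _ (by fun_prop)) (i1 _ (by fun_prop)),
      intervalIntegral.integral_add (i1 _ (by fun_prop)) (i1 _ (by fun_prop)),
      intervalIntegral.integral_add (i1 _ (by fun_prop)) (i1 _ (by fun_prop)),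
      intervalIntegral.integral_add (i1 _ (by fun_prop)) (i1 _ (by fun_prop)),
      intervalIntegral.integral_add (i1 _ (by fun_prop)) (i1 _ (by fun_prop))]
    simp only [intervalIntegral.integral_const_mul, integral_cos_sq, integral_sin_sq,
      integral_sin_mul_cos₁, integral_cos, integral_sin, intervalIntegral.integral_const]
    simp
  have h4 : ∫ θ in (0 : ℝ)..(2 * Real.pi), w (p + circleMap 0 1 θ • (s • y)) ≤
      2 * Real.pi * K + s ^ 2 * E / 2 * Real.pi + s ^ 2 * F / 2 * Real.pi := by
    rw [← hi]
    apply intervalIntegral.integral_mono (by positivity)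
    · exact usc_circleIntegrable (fun t : ℂ => w (p + t • (s • y)))
        (usc_comp hw.usc (by fun_prop)) B0 (fun t => hw.lb _) 0 1
    · exact Continuous.intervalIntegrable (by fun_prop) _ _
    · exact hpt
  have h5 := h1.trans h4
  simp only [K] at h5
  have h6 : 0 ≤ (s ^ 2 * Real.pi) * (2 * η * ‖y‖ ^ 2 + (E + F) / 2) := by nlinarith [h5]
  have h7 : 0 ≤ 2 * η * ‖y‖ ^ 2 + (E + F) / 2 := by
    by_contra hcon
    push Not at hcon
    have : 0 < s ^ 2 * Real.pi := by positivity
    nlinarith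
  have h8 : 4 * η * ‖y‖ ^ 2 ≤ ε := by
    rw [hη]
    have : 4 * (ε / (4 * (‖y‖ ^ 2 + 1))) * ‖y‖ ^ 2 = ε * (‖y‖ ^ 2 / (‖y‖ ^ 2 + 1)) := by
      field_simp
    rw [this]
    have : ‖y‖ ^ 2 / (‖y‖ ^ 2 + 1) ≤ 1 := by
      rw [div_le_one (by positivity)]; linarith
    nlinarith
  linarith

def LTay {E : Type*} [NormedAddCommGroup E] [NormedSpace ℂ E] (w : E → ℝ) (p : E) : Prop :=
  ∃ g : E → ℂ, AnalyticAt ℂ g p ∧ g p = 0 ∧ ∀ η > 0, ∀ᶠ x in nhds p,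
    w p + (g x).re - η * ‖x - p‖ ^ 2 ≤ w x

lemma LTay_of_psh (w : ℂ × ℂ → ℝ) (hw2 : ContDiff ℝ 2 w) {B0 : ℝ} (hw : Psh w B0) (p : ℂ × ℂ) :
    LTay w p := by
  obtain ⟨ℓ, B, hs, hT⟩ := taylor2 w hw2 p
  have hL := levi_nonneg w hw p ℓ B hs hT
  set e1 : ℂ × ℂ := (1, 0) with he1
  set f1 : ℂ × ℂ := (Complex.I, 0) with hf1
  set e2 : ℂ × ℂ := (0, 1) with he2
  set f2 : ℂ × ℂ := (0, Complex.I) with hf2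
  let α : ℂ := ⟨ℓ e1, -ℓ f1⟩
  let β : ℂ := ⟨ℓ e2, -ℓ f2⟩
  let a : ℂ := ⟨(B e1 e1 - B f1 f1) / 4, -B e1 f1 / 2⟩
  let q : ℂ := ⟨(B e2 e2 - B f2 f2) / 4, -B e2 f2 / 2⟩
  let b : ℂ := ⟨(B e1 e2 - B f1 f2) / 4, -(B e1 f2 + B f1 e2) / 4⟩
  let Q : ℂ × ℂ → ℂ := fun y => α * y.1 + β * y.2 + a * y.1 ^ 2 + 2 * b * y.1 * y.2 + q * y.2 ^ 2
  have hdec : ∀ y : ℂ × ℂ, y = y.1.re • e1 + y.1.im • f1 + y.2.re • e2 + y.2.im • f2 := by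
    intro y
    ext <;> simp [he1, hf1, he2, hf2]
  have hdecI : ∀ y : ℂ × ℂ, Complex.I • y =
      (-y.1.im) • e1 + y.1.re • f1 + (-y.2.im) • e2 + y.2.re • f2 := by
    intro y
    refine Prod.ext ?_ ?_ <;> apply Complex.ext <;> simp [he1, hf1, he2, hf2]
  have hQ : ∀ y, (Q y).re = ℓ y + 1 / 4 * (B y y - B (Complex.I • y) (Complex.I • y)) := by
    intro y
    rw [hdecI y]
    have eℓ := congrArg (fun v => ℓ v) (hdec y)
    have eB := congrArg (fun v => B v v) (hdec y)
    rw [show ℓ y = _ from eℓ, show B y y = _ from eB]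
    simp only [map_add, map_smul, add_apply, smul_apply, smul_eq_mul]
    rw [hs f1 e1, hs e2 e1, hs e2 f1, hs f2 e1, hs f2 f1, hs f2 e2]
    simp [Q, α, β, a, b, q, pow_two]
    ring
  refine ⟨fun x => Q (x - p), ?_, by simp [Q], fun η hη => ?_⟩
  · have : AnalyticAt ℂ (fun x : ℂ × ℂ => x.1) p := analyticAt_fst
    have : AnalyticAt ℂ (fun x : ℂ × ℂ => x.2) p := analyticAt_snd
    simp only [Q, Prod.fst_sub, Prod.snd_sub]
    fun_prop
  · obtain ⟨δ, hδ, hb⟩ := hT η hη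
    filter_upwards [ball_mem_nhds p hδ] with x hx
    have h1 := hb (x - p) (by simpa [dist_eq_norm] using hx)
    rw [hQ]
    have h2 := (abs_le.1 h1).1
    have h3 := hL (x - p)
    rw [add_sub_cancel] at h2
    linarith

end
end

section
open Metric Set Polynomial
noncomputable section

lemma LTay_comp {E F : Type*} [NormedAddCommGroup E] [NormedSpace ℂ E]
    [NormedAddCommGroup F] [NormedSpace ℂ F] {w : F → ℝ} {Θ : E → F} {p : E}
    (hΘ : AnalyticAt ℂ Θ p) (hw : LTay w (Θ p)) : LTay (fun x => w (Θ x)) p := by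
  obtain ⟨g, hg, hg0, h⟩ := hw
  refine ⟨fun x => g (Θ x), hg.comp hΘ, hg0, fun η hη => ?_⟩
  obtain ⟨K, hK, hO⟩ := (hΘ.differentiableAt.isBigO_sub).exists_pos
  have h1 := hΘ.continuousAt.eventually (h (η / K ^ 2) (by positivity))
  filter_upwards [h1, hO.bound] with x hx hx2
  have h3 : ‖Θ x - Θ p‖ ^ 2 ≤ K ^ 2 * ‖x - p‖ ^ 2 := by
    calc _ ≤ (K * ‖x - p‖) ^ 2 := by gcongr
      _ = _ := by ring
  have h4 : η / K ^ 2 * ‖Θ x - Θ p‖ ^ 2 ≤ η * ‖x - p‖ ^ 2 := by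
    calc _ ≤ η / K ^ 2 * (K ^ 2 * ‖x - p‖ ^ 2) := by gcongr
      _ = _ := by field_simp
  linarith

lemma LTay_add {E : Type*} [NormedAddCommGroup E] [NormedSpace ℂ E] {w v : E → ℝ} {p : E}
    (hw : LTay w p) (hv : LTay v p) : LTay (fun x => w x + v x) p := by
  obtain ⟨g, hg, hg0, h⟩ := hw
  obtain ⟨g', hg', hg0', h'⟩ := hv
  refine ⟨fun x => g x + g' x, hg.add hg', by simp [hg0, hg0'], fun η hη => ?_⟩
  filter_upwards [h (η / 2) (by positivity), h' (η / 2) (by positivity)] with x h1 h2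
  rw [Complex.add_re]
  linarith

lemma LTay_re {E : Type*} [NormedAddCommGroup E] [NormedSpace ℂ E] {F : E → ℂ} {p : E}
    (hF : AnalyticAt ℂ F p) : LTay (fun x => (F x).re) p := by
  refine ⟨fun x => F x - F p, hF.sub analyticAt_const, by simp, fun η hη => ?_⟩
  filter_upwards with x
  have : 0 ≤ η * ‖x - p‖ ^ 2 := by positivity
  simp only [Complex.sub_re]
  linarith

lemma LTay_normSq {E : Type*} [NormedAddCommGroup E] [NormedSpace ℂ E] {F : E → ℂ} {p : E}
    (hF : AnalyticAt ℂ F p) : LTay (fun x => ‖F x‖ ^ 2) p := by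
  refine ⟨fun x => 2 * (starRingEnd ℂ) (F p) * (F x - F p),
    analyticAt_const.mul (hF.sub analyticAt_const), by simp, fun η hη => ?_⟩
  filter_upwards with x
  have : 0 ≤ η * ‖x - p‖ ^ 2 := by positivity
  have h2 : ‖F p‖ ^ 2 + (2 * (starRingEnd ℂ) (F p) * (F x - F p)).re ≤ ‖F x‖ ^ 2 := by
    have h3 := sq_nonneg ‖F x - F p‖
    rw [← Complex.normSq_eq_norm_sq] at *
    rw [← Complex.normSq_eq_norm_sq]
    rw [Complex.normSq_apply] at *
    rw [Complex.normSq_apply]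
    simp at *
    nlinarith
  linarith

lemma nomax1 {γ : ℂ → ℂ} {z0 : ℂ} (hγ : AnalyticAt ℂ γ z0) (h0 : γ z0 = 0) {c : ℝ} (hc : 0 < c) :
    ¬ ∀ᶠ z in nhds z0, (γ z).re ≤ - c * ‖z - z0‖ ^ 2 := by
  intro h
  have hmax : IsLocalMax (norm ∘ fun z => Complex.exp (γ z)) z0 := by
    filter_upwards [h] with z hz
    simp only [Function.comp, Complex.norm_exp, h0, Complex.zero_re, Real.exp_zero]
    rw [Real.exp_le_one_iff]
    nlinarith [sq_nonneg ‖z - z0‖]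
  have hd : ∀ᶠ z in nhds z0, DifferentiableAt ℂ (fun z => Complex.exp (γ z)) z := by
    filter_upwards [hγ.eventually_analyticAt] with z hz
    exact hz.differentiableAt.cexp
  have h1 := Complex.eventually_eq_of_isLocalMax_norm hd hmax
  have h2 : ∀ᶠ z in nhds z0, z = z0 := by
    filter_upwards [h, h1] with z hz hz1
    have : ‖Complex.exp (γ z)‖ = 1 := by rw [hz1, h0]; simp
    rw [Complex.norm_exp, Real.exp_eq_one_iff] at this
    rw [this] at hz
    have h3 : ‖z - z0‖ ^ 2 ≤ 0 := by nlinarith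
    have h4 : ‖z - z0‖ = 0 := by nlinarith [norm_nonneg (z - z0)]
    exact sub_eq_zero.1 (norm_eq_zero.1 h4)
  obtain ⟨ε, hε, hb⟩ := Metric.eventually_nhds_iff.1 h2
  have := hb (y := z0 + (ε / 2 : ℝ)) (by
    rw [dist_eq_norm]; simp; rw [abs_of_pos hε]; linarith)
  simp [hε.ne'] at this

/-- A function with lower Taylor polynomials plus a strictly convex term has no local max. -/
lemma LTay_nomax {g : ℂ → ℝ} {z0 : ℂ} (hg : LTay g z0) {δ : ℝ} (hδ : 0 < δ) :
    ¬ IsLocalMax (fun z => g z + δ * ‖z‖ ^ 2) z0 := by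
  intro hmax
  obtain ⟨γ, hγ, h0, h⟩ := hg
  refine nomax1 (γ := fun z => γ z + 2 * δ * (starRingEnd ℂ) z0 * (z - z0)) (z0 := z0)
    (c := δ / 2) (by fun_prop) (by simp [h0]) (by positivity) ?_
  filter_upwards [hmax, h (δ / 2) (by positivity)] with z h1 h2
  have e : ‖z‖ ^ 2 = ‖z0‖ ^ 2 + (2 * (starRingEnd ℂ) z0 * (z - z0)).re + ‖z - z0‖ ^ 2 := by
    simp only [← Complex.normSq_eq_norm_sq, Complex.normSq_apply]
    simp
    ring
  have e2 : (2 * δ * (starRingEnd ℂ) z0 * (z - z0)).re =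
      δ * (2 * (starRingEnd ℂ) z0 * (z - z0)).re := by
    rw [← Complex.re_ofReal_mul]; congr 1; ring
  rw [Complex.add_re, e2]
  rw [e] at h1
  nlinarith

def quadP (α β a b q : ℂ) (y : ℂ × ℂ) : ℂ :=
  α * y.1 + β * y.2 + a * y.1 ^ 2 + 2 * b * y.1 * y.2 + q * y.2 ^ 2

def StrictL (σ : ℂ × ℂ → ℝ) : Prop :=
  ∀ p : ℂ × ℂ, ∃ α β a b q : ℂ, ∃ c : ℝ, 0 < c ∧ ∀ᶠ y in nhds (0 : ℂ × ℂ),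
    σ p + (quadP α β a b q y).re + c * (‖y.1‖ ^ 2 + ‖y.2‖ ^ 2) ≤ σ (p + y)

lemma analytic_quad {g : ℂ × ℂ → ℂ} {p : ℂ × ℂ} (hg : AnalyticAt ℂ g p) (h0 : g p = 0) :
    ∃ α β a b q : ℂ, ∀ η > 0, ∀ᶠ y in nhds (0 : ℂ × ℂ),
      ‖g (p + y) - quadP α β a b q y‖ ≤ η * ‖y‖ ^ 2 := by
  obtain ⟨P, hP⟩ := hg
  have hO := hP.isBigO_sub_partialSum_pow 3
  set e1 : ℂ × ℂ := (1, 0) with he1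
  set e2 : ℂ × ℂ := (0, 1) with he2
  set B := P 2
  refine ⟨P 1 ![e1], P 1 ![e2], B ![e1, e1], (B ![e1, e2] + B ![e2, e1]) / 2, B ![e2, e2],
    fun η hη => ?_⟩
  have hps : ∀ y : ℂ × ℂ, P.partialSum 3 y = quadP (P 1 ![e1]) (P 1 ![e2]) (B ![e1, e1])
      ((B ![e1, e2] + B ![e2, e1]) / 2) (B ![e2, e2]) y := by
    intro y
    have hy : y = y.1 • e1 + y.2 • e2 := by ext <;> simp [he1, he2]
    have c0 : P 0 (fun _ => y) = 0 := by
      have := hP.coeff_zero (fun _ => y)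
      rw [this, h0]
    have v1 : (fun _ : Fin 1 => y) = ![y] := by ext i <;> fin_cases i <;> rfl
    have v2 : (fun _ : Fin 2 => y) = ![y, y] := by ext i <;> fin_cases i <;> rfl
    have up1 : ∀ x : ℂ × ℂ, Function.update ![(0 : ℂ × ℂ)] 0 x = ![x] := by
      intro x; ext i <;> fin_cases i <;> simp
    have up0 : ∀ t x y : ℂ × ℂ, Function.update ![y, t] 0 x = ![x, t] := by
      intro t x y; ext i <;> fin_cases i <;> simp
    have a1 : ∀ x z : ℂ × ℂ, P 1 ![x + z] = P 1 ![x] + P 1 ![z] := by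
      intro x z
      have := (P 1).map_update_add ![0] 0 x z
      simpa only [up1] using this
    have s1 : ∀ (c : ℂ) (x : ℂ × ℂ), P 1 ![c • x] = c * P 1 ![x] := by
      intro c x
      have := (P 1).map_update_smul ![0] 0 c x
      simpa only [up1, smul_eq_mul] using this
    have a2 : ∀ x z t : ℂ × ℂ, B ![x + z, t] = B ![x, t] + B ![z, t] := by
      intro x z t
      have := B.map_update_add ![0, t] 0 x z
      simpa only [up0] using this
    have s2 : ∀ (c : ℂ) (x t : ℂ × ℂ), B ![c • x, t] = c * B ![x, t] := by
      intro c x t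
      have := B.map_update_smul ![0, t] 0 c x
      simpa only [up0, smul_eq_mul] using this
    have up : ∀ t x y : ℂ × ℂ, Function.update ![t, y] 1 x = ![t, x] := by
      intro t x y; ext i <;> fin_cases i <;> simp
    have a3 : ∀ x z t : ℂ × ℂ, B ![t, x + z] = B ![t, x] + B ![t, z] := by
      intro x z t
      have := B.map_update_add ![t, 0] 1 x z
      simpa only [up] using this
    have s3 : ∀ (c : ℂ) (x t : ℂ × ℂ), B ![t, c • x] = c * B ![t, x] := by
      intro c x t
      have := B.map_update_smul ![t, 0] 1 c x
      simpa only [up, smul_eq_mul] using this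
    rw [FormalMultilinearSeries.partialSum]
    simp only [Finset.sum_range_succ, Finset.sum_range_zero, zero_add]
    rw [c0, v1, show (P 2) (fun _ => y) = B ![y, y] by rw [← v2]]
    have f1 : P 1 ![y] = y.1 * P 1 ![e1] + y.2 * P 1 ![e2] := by
      conv_lhs => rw [hy]
      rw [a1, s1, s1]
    have f2 : B ![y, y] = y.1 * (y.1 * B ![e1, e1] + y.2 * B ![e1, e2]) +
        y.2 * (y.1 * B ![e2, e1] + y.2 * B ![e2, e2]) := by
      conv_lhs => rw [hy]
      rw [a2, s2, s2, a3, a3, s3, s3, s3, s3]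
    rw [f1, f2, quadP]
    ring
  simp only [hps] at hO
  have hlo : (fun y : ℂ × ℂ => ‖y‖ ^ 3) =o[nhds 0] (fun y => ‖y‖ ^ 2) := by
    exact (Asymptotics.isLittleO_pow_pow (by norm_num : 2 < 3)).comp_tendsto
      (tendsto_norm_zero)
  have := (hO.trans_isLittleO hlo).bound hη
  filter_upwards [this] with y hy
  simpa using hy

lemma strict_of_LTay {v : ℂ × ℂ → ℝ} (hv : ∀ p, LTay v p) :
    StrictL (fun x => v x + (‖x.1‖ ^ 2 + ‖x.2‖ ^ 2)) := by
  intro p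
  obtain ⟨g, hg, h0, h⟩ := hv p
  obtain ⟨α, β, a, b, q, hq⟩ := analytic_quad hg h0
  refine ⟨α + 2 * (starRingEnd ℂ) p.1, β + 2 * (starRingEnd ℂ) p.2, a, b, q, 1 / 2, by norm_num, ?_⟩
  have ht : Filter.Tendsto (fun y : ℂ × ℂ => p + y) (nhds 0) (nhds p) := by
    have : Continuous (fun y : ℂ × ℂ => p + y) := by fun_prop
    simpa using this.tendsto 0
  filter_upwards [hq (1 / 4) (by norm_num), ht.eventually (h (1 / 4) (by norm_num))] with y h1 h2
  have e : ∀ z0 z : ℂ, ‖z0 + z‖ ^ 2 = ‖z0‖ ^ 2 + (2 * (starRingEnd ℂ) z0 * z).re + ‖z‖ ^ 2 := by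
    intro z0 z
    simp only [← Complex.normSq_eq_norm_sq, Complex.normSq_apply]
    simp
    ring
  have hn : ‖y‖ ^ 2 ≤ ‖y.1‖ ^ 2 + ‖y.2‖ ^ 2 := by
    rw [Prod.norm_def]
    rcases max_choice ‖y.1‖ ‖y.2‖ with h' | h' <;> rw [h'] <;>
      nlinarith [sq_nonneg ‖y.1‖, sq_nonneg ‖y.2‖]
  have h3 := (abs_le.1 ((Complex.abs_re_le_norm _).trans h1)).1
  rw [Complex.sub_re] at h3
  have e3 : quadP (α + 2 * (starRingEnd ℂ) p.1) (β + 2 * (starRingEnd ℂ) p.2) a b q y =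
      quadP α β a b q y + 2 * (starRingEnd ℂ) p.1 * y.1 + 2 * (starRingEnd ℂ) p.2 * y.2 := by
    simp only [quadP]; ring
  rw [e3, Complex.add_re, Complex.add_re, Prod.fst_add, Prod.snd_add, e, e]
  rw [add_sub_cancel_left] at h2
  linarith

end
end

section
open Metric Set Polynomial
noncomputable section

/-- second derivative test, reversed. -/
lemma secder_nonneg (h h' : ℝ → ℝ) (h2 : ℝ) (hd : ∀ x, HasDerivAt h (h' x) x)
    (hd2 : HasDerivAt h' h2 0) (hm : IsLocalMin h 0) : h' 0 = 0 ∧ 0 ≤ h2 := by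
  have e1 : deriv h = h' := funext fun x => (hd x).deriv
  have e0 : h' 0 = 0 := hm.hasDerivAt_eq_zero (hd 0)
  refine ⟨e0, ?_⟩
  by_contra hneg
  push Not at hneg
  have hM : IsLocalMax h 0 := isLocalMax_of_deriv_deriv_neg (by rw [e1, hd2.deriv]; exact hneg)
    (by rw [e1]; exact e0) (hd 0).continuousAt
  have hc : h =ᶠ[nhds 0] fun _ => h 0 := by
    filter_upwards [hm, hM] with x hx hy using le_antisymm hy hx
  have := hc.deriv.deriv_eq
  rw [e1, hd2.deriv] at this
  simp at this
  linarith

/-- Horizontal segments in the second variable. -/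
lemma box_preconn (F : ℂ × ℂ → ℝ) (t ρ δ : ℝ) (hρ : 0 < ρ) (hδ : 0 < δ)
    (hconv : ∀ z : ℂ, ∀ y : ℝ, ‖z‖ < ρ → |y| < ρ →
      ConvexOn ℝ (Icc (-δ) δ) (fun x : ℝ => F (z, ⟨x, y⟩)))
    (hR : ∀ z : ℂ, ∀ y : ℝ, ‖z‖ < ρ → |y| < ρ → t < F (z, ⟨δ, y⟩))
    (hL : (∀ z : ℂ, ∀ y : ℝ, ‖z‖ < ρ → |y| < ρ → F (z, ⟨-δ, y⟩) ≤ t) ∨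
      ((∀ z : ℂ, ∀ y : ℝ, ‖z‖ < ρ → |y| < ρ → t < F (z, ⟨-δ, y⟩)) ∧
        ∃ z : ℂ, ∃ y : ℝ, ‖z‖ < ρ ∧ |y| < ρ ∧ ∀ x ∈ Icc (-δ) δ, t < F (z, ⟨x, y⟩))) :
    IsPreconnected {p : ℂ × ℂ | ‖p.1‖ < ρ ∧ |p.2.im| < ρ ∧ p.2.re ∈ Icc (-δ) δ ∧ t < F p} := by
  set Y := {p : ℂ × ℂ | ‖p.1‖ < ρ ∧ |p.2.im| < ρ ∧ p.2.re ∈ Icc (-δ) δ ∧ t < F p} with hY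
  have hseg : ∀ z : ℂ, ∀ y a b : ℝ, IsPreconnected ((fun x : ℝ => ((z, ⟨x, y⟩) : ℂ × ℂ)) '' Icc a b) := by
    intro z y a b
    refine isPreconnected_Icc.image _ (Continuous.continuousOn ?_)
    refine Continuous.prodMk continuous_const ?_
    have : (fun x : ℝ => (⟨x, y⟩ : ℂ)) = fun x : ℝ => (x : ℂ) + y * Complex.I := by
      funext x; apply Complex.ext <;> simp
    rw [this]; fun_prop
  have hedge : ∀ s : ℝ, IsPreconnected ((fun q : ℂ × ℝ => ((q.1, ⟨s, q.2⟩) : ℂ × ℂ)) ''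
      (ball 0 ρ ×ˢ ball 0 ρ)) := by
    intro s
    refine ((convex_ball (0:ℂ) ρ).prod (convex_ball (0:ℝ) ρ)).isPreconnected.image _
      (Continuous.continuousOn ?_)
    refine Continuous.prodMk continuous_fst ?_
    have : (fun x : ℂ × ℝ => (⟨s, x.2⟩ : ℂ)) = fun x : ℂ × ℝ => (s : ℂ) + x.2 * Complex.I := by
      funext x; apply Complex.ext <;> simp
    rw [this]; fun_prop
  set ER := (fun q : ℂ × ℝ => ((q.1, ⟨δ, q.2⟩) : ℂ × ℂ)) '' (ball 0 ρ ×ˢ ball 0 ρ) with hER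
  set EL := (fun q : ℂ × ℝ => ((q.1, ⟨-δ, q.2⟩) : ℂ × ℂ)) '' (ball 0 ρ ×ˢ ball 0 ρ) with hEL
  have mER : ∀ z : ℂ, ∀ y : ℝ, ‖z‖ < ρ → |y| < ρ → ((z, ⟨δ, y⟩) : ℂ × ℂ) ∈ ER := by
    intro z y hz hy
    exact ⟨(z, y), ⟨by simpa using hz, by simpa using hy⟩, rfl⟩
  have mEL : ∀ z : ℂ, ∀ y : ℝ, ‖z‖ < ρ → |y| < ρ → ((z, ⟨-δ, y⟩) : ℂ × ℂ) ∈ EL := by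
    intro z y hz hy
    exact ⟨(z, y), ⟨by simpa using hz, by simpa using hy⟩, rfl⟩
  have ERY : ER ⊆ Y := by
    rintro _ ⟨⟨z, y⟩, ⟨hz, hy⟩, rfl⟩
    simp only [mem_ball, dist_zero_right, Real.norm_eq_abs] at hz hy
    exact ⟨hz, hy, ⟨by simp; linarith, le_rfl⟩, hR z y hz hy⟩
  have h00 : ((0, ⟨δ, 0⟩) : ℂ × ℂ) ∈ ER := mER 0 0 (by simpa) (by simpa)
  refine isPreconnected_of_forall ((0, ⟨δ, 0⟩) : ℂ × ℂ) ?_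
  rintro ⟨z, ⟨x, y⟩⟩ ⟨hz, hy, ⟨hx1, hx2⟩, hF⟩
  simp only at hz hy hx1 hx2 hF
  have hcv := hconv z y hz hy
  have key : ∀ x1 x2, -δ ≤ x1 → x1 ≤ x → x ≤ x2 → x2 ≤ δ →
      F (z, ⟨x1, y⟩) ≤ t → F (z, ⟨x2, y⟩) ≤ t → False := by
    intro x1 x2 a1 a2 a3 a4 b1 b2
    have := hcv.le_max_of_mem_Icc (x := x1) (y := x2) (z := x) ⟨a1, by linarith⟩
      ⟨by linarith, a4⟩ ⟨a2, a3⟩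
    have h3 := max_le b1 b2
    linarith
  by_cases hright : ∀ x' ∈ Icc x δ, t < F (z, ⟨x', y⟩)
  · refine ⟨ER ∪ (fun x : ℝ => ((z, ⟨x, y⟩) : ℂ × ℂ)) '' Icc x δ, ?_, Or.inl h00,
      Or.inr ⟨x, ⟨le_rfl, hx2⟩, rfl⟩, ?_⟩
    · refine union_subset ERY ?_
      rintro _ ⟨x', hx', rfl⟩
      exact ⟨hz, hy, ⟨hx1.trans hx'.1, hx'.2⟩, hright x' hx'⟩
    · exact (hedge δ).union (z, ⟨δ, y⟩) (mER z y hz hy) ⟨δ, ⟨hx2, le_rfl⟩, rfl⟩ (hseg z y x δ)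
  push Not at hright
  obtain ⟨x2, hx2', hF2⟩ := hright
  rcases hL with hL | ⟨hL, zs, ys, hzs, hys, hfull⟩
  · exact (key (-δ) x2 le_rfl hx1 hx2'.1 hx2'.2 (hL z y hz hy) hF2).elim
  · have hleft : ∀ x' ∈ Icc (-δ) x, t < F (z, ⟨x', y⟩) := by
      intro x' hx'
      by_contra hcon
      exact key x' x2 hx'.1 hx'.2 hx2'.1 hx2'.2 (not_lt.1 hcon) hF2
    have ELY : EL ⊆ Y := by
      rintro _ ⟨⟨z, y⟩, ⟨hz, hy⟩, rfl⟩
      simp only [mem_ball, dist_zero_right, Real.norm_eq_abs] at hz hy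
      exact ⟨hz, hy, ⟨le_rfl, by simp; linarith⟩, hL z y hz hy⟩
    refine ⟨(ER ∪ (fun x : ℝ => ((zs, ⟨x, ys⟩) : ℂ × ℂ)) '' Icc (-δ) δ) ∪
      (EL ∪ (fun x : ℝ => ((z, ⟨x, y⟩) : ℂ × ℂ)) '' Icc (-δ) x), ?_, Or.inl (Or.inl h00),
      Or.inr (Or.inr ⟨x, ⟨hx1, le_rfl⟩, rfl⟩), ?_⟩
    · refine union_subset (union_subset ERY ?_) (union_subset ELY ?_)
      · rintro _ ⟨x', hx', rfl⟩
        exact ⟨hzs, hys, hx', hfull x' hx'⟩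
      · rintro _ ⟨x', hx', rfl⟩
        exact ⟨hz, hy, ⟨hx'.1, hx'.2.trans hx2⟩, hleft x' hx'⟩
    · refine IsPreconnected.union (zs, ⟨-δ, ys⟩) (Or.inr ⟨-δ, ⟨le_rfl, by linarith⟩, rfl⟩)
        (Or.inl (mEL zs ys hzs hys)) ?_ ?_
      · exact (hedge δ).union (zs, ⟨δ, ys⟩) (mER zs ys hzs hys) ⟨δ, ⟨by linarith, le_rfl⟩, rfl⟩
          (hseg zs ys _ _)
      · exact (hedge (-δ)).union (z, ⟨-δ, y⟩) (mEL z y hz hy) ⟨-δ, ⟨le_rfl, hx1⟩, rfl⟩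
          (hseg z y _ _)
end
end

section
open Metric Set Polynomial
noncomputable section

lemma mk_eq (x y : ℝ) : (⟨x, y⟩ : ℂ) = (x : ℂ) + y * Complex.I := by
  apply Complex.ext <;> simp

lemma edge_ev (F : ℂ × ℂ → ℝ) (hF : Continuous F) (s : ℝ) (S : Set ℝ) (hS : IsOpen S)
    (h : F (0, ⟨s, 0⟩) ∈ S) :
    ∃ ρ > 0, ∀ z : ℂ, ∀ y : ℝ, ‖z‖ < ρ → |y| < ρ → F (z, ⟨s, y⟩) ∈ S := by
  have hc : Continuous (fun q : ℂ × ℝ => F (q.1, ⟨s, q.2⟩)) := by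
    refine hF.comp (Continuous.prodMk continuous_fst ?_)
    have : (fun x : ℂ × ℝ => (⟨s, x.2⟩ : ℂ)) = fun x : ℂ × ℝ => (s : ℂ) + x.2 * Complex.I := by
      funext x; exact mk_eq _ _
    rw [this]; fun_prop
  have := hc.continuousAt (x := (0, 0)) |>.eventually (hS.mem_nhds h)
  obtain ⟨ρ, hρ, hb⟩ := Metric.eventually_nhds_iff.1 this
  refine ⟨ρ, hρ, fun z y hz hy => hb (y := (z, y)) ?_⟩
  rw [Prod.dist_eq]
  simp [hz, hy]

lemma full_seg (α β a b : ℂ) (q c : ℝ) (hq : 0 < q) (hc : 0 < c) (hβ : β.re = 0) (ρ : ℝ)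
    (hρ : 0 < ρ) : ∃ z : ℂ, ∃ y : ℝ, ‖z‖ < ρ ∧ |y| < ρ ∧ ∀ x : ℝ,
      0 < (quadP α β a b q (z, ⟨x, y⟩)).re + c * (‖z‖ ^ 2 + ‖(⟨x, y⟩ : ℂ)‖ ^ 2) := by
  by_cases hβi : β.im = 0
  · obtain ⟨u, hu1, hu2, hu3⟩ : ∃ u : ℂ, ‖u‖ = 1 ∧ 0 ≤ (α * u).re ∧
        0 ≤ ((a - b ^ 2 / q) * u ^ 2).re := by
      have h1 : ∃ u : ℂ, ‖u‖ = 1 ∧ 0 ≤ ((a - b ^ 2 / q) * u ^ 2).re := by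
        by_cases h : 0 ≤ (a - b ^ 2 / q).re
        · exact ⟨1, by simp, by simpa using h⟩
        · refine ⟨Complex.I, by simp, ?_⟩
          rw [Complex.I_sq, mul_neg_one, Complex.neg_re]; linarith
      obtain ⟨u, h1, h2⟩ := h1
      by_cases h : 0 ≤ (α * u).re
      · exact ⟨u, h1, h, h2⟩
      · refine ⟨-u, by simpa using h1, ?_, by simpa using h2⟩
        rw [mul_neg, Complex.neg_re]; linarith
    obtain ⟨τ, hτ, hτ1, hτ2⟩ : ∃ τ : ℝ, 0 < τ ∧ τ < ρ ∧ τ * (‖b‖ / q) < ρ := by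
      refine ⟨ρ / (2 * (1 + ‖b‖ / q)), by positivity, ?_, ?_⟩
      · rw [div_lt_iff₀ (by positivity)]
        have : 0 ≤ ‖b‖ / q := by positivity
        nlinarith
      · rw [div_mul_eq_mul_div, div_lt_iff₀ (by positivity)]
        have : 0 ≤ ‖b‖ / q := by positivity
        nlinarith
    set z : ℂ := τ * u with hz
    have hzn : ‖z‖ = τ := by rw [hz, norm_mul, hu1, Complex.norm_real]; simp [hτ.le]
    refine ⟨z, -(b * z).im / q, by rw [hzn]; exact hτ1, ?_, fun x => ?_⟩
    · rw [abs_div, abs_neg, abs_of_pos hq]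
      have := Complex.abs_im_le_norm (b * z)
      rw [norm_mul, hzn] at this
      calc |(b * z).im| / q ≤ ‖b‖ * τ / q := by gcongr
        _ = τ * (‖b‖ / q) := by ring
        _ < ρ := hτ2
    · have e1 : 0 ≤ (α * z).re := by
        have : α * z = τ * (α * u) := by rw [hz]; ring
        rw [this, Complex.re_ofReal_mul]; positivity
      have e2 : 0 ≤ (a * z ^ 2).re - ((b * z) ^ 2).re / q := by
        have : 0 ≤ ((a - b ^ 2 / q) * z ^ 2).re := by
          have : (a - b ^ 2 / q) * z ^ 2 = ((τ ^ 2 : ℝ) : ℂ) * ((a - b ^ 2 / q) * u ^ 2) := by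
            rw [hz]; push_cast; ring
          rw [this, Complex.re_ofReal_mul]; positivity
        have e : (a - b ^ 2 / q) * z ^ 2 = a * z ^ 2 - (b * z) ^ 2 / q := by ring
        rw [e, Complex.sub_re, Complex.div_ofReal_re] at this
        exact this
      have e3 : 0 < c * (‖z‖ ^ 2 + ‖(⟨x, -(b * z).im / q⟩ : ℂ)‖ ^ 2) := by
        have : 0 < ‖z‖ := by rw [hzn]; exact hτ
        positivity
      set B := b * z with hB
      set y := -B.im / q with hy
      have e4 : (quadP α β a b q (z, ⟨x, y⟩)).re = (α * z).re + (a * z ^ 2).re +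
          2 * (B.re * x - B.im * y) + q * (x ^ 2 - y ^ 2) := by
        have : quadP α β a b q (z, ⟨x, y⟩) = α * z + a * z ^ 2 + β * ⟨x, y⟩ + 2 * (B * ⟨x, y⟩) +
          q * (⟨x, y⟩ : ℂ) ^ 2 := by simp only [quadP, hB]; ring
        rw [this]
        simp [hβ, hβi, pow_two, Complex.mul_re]
      have e5 : (B ^ 2).re = B.re ^ 2 - B.im ^ 2 := by simp [pow_two, Complex.mul_re]
      have hyq : q * y = -B.im := by rw [hy]; field_simp
      have e6 : 2 * (B.re * x - B.im * y) + q * (x ^ 2 - y ^ 2) + (B ^ 2).re / q =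
          (q * x + B.re) ^ 2 / q := by
        rw [e5, hy]; field_simp; ring
      have e7 : 0 ≤ (q * x + B.re) ^ 2 / q := by positivity
      rw [e4]; linarith
  · set τ : ℝ := min (ρ / 2) (|β.im| / (2 * q)) with hτ
    have hβp : 0 < |β.im| := abs_pos.2 hβi
    have hτ0 : 0 < τ := by rw [hτ]; positivity
    have hτ1 : τ ≤ ρ / 2 := min_le_left _ _
    have hτ2 : q * τ ≤ |β.im| / 2 := by
      calc q * τ ≤ q * (|β.im| / (2 * q)) := by gcongr; exact min_le_right _ _
        _ = _ := by field_simp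
    obtain ⟨y, hy1, hy2⟩ : ∃ y : ℝ, |y| = τ ∧ β.im * y = -|β.im| * τ := by
      rcases lt_or_gt_of_ne hβi with h | h
      · exact ⟨τ, abs_of_pos hτ0, by rw [abs_of_neg h]; ring⟩
      · exact ⟨-τ, by rw [abs_neg, abs_of_pos hτ0], by rw [abs_of_pos h]; ring⟩
    refine ⟨0, y, by simpa, by rw [hy1]; linarith, fun x => ?_⟩
    have e : (quadP α β a b q (0, ⟨x, y⟩)).re = |β.im| * τ + q * (x ^ 2 - y ^ 2) := by
      simp [quadP, hβ, pow_two, Complex.mul_re]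
      linarith
    have hy3 : y ^ 2 = τ ^ 2 := by rw [← sq_abs, hy1]
    rw [e, hy3]
    have : 0 ≤ c * (‖(0:ℂ)‖ ^ 2 + ‖(⟨x, y⟩ : ℂ)‖ ^ 2) := by positivity
    have h2 : 0 ≤ q * x ^ 2 := by positivity
    nlinarith [mul_pos hβp hτ0]
end
end

section
open Metric Set Polynomial
noncomputable section

lemma horiz_conv (F : ℂ × ℂ → ℝ) (hF : ContDiff ℝ 2 F) (β' m : ℝ) (hm : 0 < m)
    (hlow : ∀ᶠ x : ℝ in nhds 0, F 0 + β' * x + m * x ^ 2 ≤ F (0, ⟨x, 0⟩)) :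
    (∃ r0 > 0, ∀ δ, 0 < δ → δ ≤ r0 → ∀ z : ℂ, ∀ y : ℝ, ‖z‖ < r0 → |y| < r0 →
      ConvexOn ℝ (Icc (-δ) δ) (fun x : ℝ => F (z, ⟨x, y⟩))) ∧
    HasDerivAt (fun x : ℝ => F (0, ⟨x, 0⟩)) β' 0 := by
  set v : ℂ × ℂ := (0, 1) with hv
  set G : ℂ × ℂ → ℝ := fun p => fderiv ℝ F p v with hG
  have hGc : ContDiff ℝ 1 G := (hF.fderiv_right (m := 1) (by norm_num)).clm_apply contDiff_const
  set D2 : ℂ × ℂ → ℝ := fun p => fderiv ℝ G p v with hD2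
  have hD2c : Continuous D2 := (hGc.continuous_fderiv (by norm_num)).clm_apply continuous_const
  have hline : ∀ z : ℂ, ∀ x y : ℝ, HasDerivAt (fun x : ℝ => ((z, ⟨x, y⟩) : ℂ × ℂ)) v x := by
    intro z x y
    refine HasDerivAt.prodMk (hasDerivAt_const _ _) ?_
    have : (fun x : ℝ => (⟨x, y⟩ : ℂ)) = fun x : ℝ => (x : ℂ) + y * Complex.I := by
      funext x; exact mk_eq _ _
    rw [this]
    exact (Complex.ofRealCLM.hasDerivAt (x := x)).add_const _ |>.congr_deriv (by simp)
  have hd1 : ∀ z : ℂ, ∀ x y : ℝ, HasDerivAt (fun x : ℝ => F (z, ⟨x, y⟩)) (G (z, ⟨x, y⟩)) x := by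
    intro z x y
    exact ((hF.differentiable (by norm_num)).differentiableAt.hasFDerivAt).comp_hasDerivAt x
      (hline z x y)
  have hd2 : ∀ z : ℂ, ∀ x y : ℝ, HasDerivAt (fun x : ℝ => G (z, ⟨x, y⟩)) (D2 (z, ⟨x, y⟩)) x := by
    intro z x y
    exact ((hGc.differentiable (by norm_num)).differentiableAt.hasFDerivAt).comp_hasDerivAt x
      (hline z x y)
  have h0 : ((0, ⟨0, 0⟩) : ℂ × ℂ) = 0 := rfl
  have key := secder_nonneg (fun x => F (0, ⟨x, 0⟩) - (F 0 + β' * x + m * x ^ 2))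
    (fun x => G (0, ⟨x, 0⟩) - (β' + m * (2 * x))) (D2 (0, ⟨0, 0⟩) - m * 2)
    (fun x => by
      refine (hd1 0 x 0).sub ?_
      have h1 : HasDerivAt (fun x : ℝ => F 0 + β' * x + m * x ^ 2) (0 + β' * 1 + m * (2 * x)) x := by
        refine HasDerivAt.add (HasDerivAt.add (hasDerivAt_const _ _) ((hasDerivAt_id x).const_mul β')) ?_
        have := (hasDerivAt_pow 2 x).const_mul m
        simpa using this
      exact h1.congr_deriv (by ring))
    (by
      refine (hd2 0 0 0).sub ?_
      have h1 := (((hasDerivAt_id (0:ℝ)).const_mul 2).const_mul m).const_add β'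
      exact h1.congr_deriv (by ring))
    (by
      filter_upwards [hlow] with x hx
      rw [h0]; simp only [mul_zero, add_zero]
      norm_num
      linarith)
  obtain ⟨k1, k2⟩ := key
  constructor
  · have hpos : 0 < D2 0 := by rw [h0] at k2; linarith
    have hev := hD2c.continuousAt.eventually (lt_mem_nhds hpos)
    obtain ⟨r, hr, hb⟩ := Metric.eventually_nhds_iff.1 hev
    refine ⟨r / 2, by positivity, fun δ hδ hδr z y hz hy => ?_⟩
    refine convexOn_of_hasDerivWithinAt2_nonneg (convex_Icc _ _)
      (f' := fun x => G (z, ⟨x, y⟩)) (f'' := fun x => D2 (z, ⟨x, y⟩)) ?_ ?_ ?_ ?_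
    · exact fun x _ => (hd1 z x y).continuousAt.continuousWithinAt
    · exact fun x _ => (hd1 z x y).hasDerivWithinAt
    · exact fun x _ => (hd2 z x y).hasDerivWithinAt
    · intro x hx
      rw [interior_Icc] at hx
      refine (hb ?_).le
      rw [Prod.dist_eq]
      refine max_lt ?_ ?_
      · simp; linarith
      · simp only [Prod.snd_zero, dist_zero_right]
        have h3 := Complex.norm_le_abs_re_add_abs_im (⟨x, y⟩ : ℂ)
        simp only at h3
        have h4 : |x| < r / 2 := by
          have := abs_lt.2 (show -δ < x ∧ x < δ from hx); linarith
        linarith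
  · have := hd1 0 0 0
    rw [show G (0, ⟨0, 0⟩) = β' by linarith] at this
    exact this

lemma conn' (F : ℂ × ℂ → ℝ) (hF : ContDiff ℝ 2 F) (α β a b : ℂ) (q c : ℝ) (hq : 0 < q)
    (hc : 0 < c) (hβ : 0 ≤ β.re)
    (hlow : ∀ᶠ y in nhds (0 : ℂ × ℂ),
      F 0 + (quadP α β a b q y).re + c * (‖y.1‖ ^ 2 + ‖y.2‖ ^ 2) ≤ F y)
    (ε : ℝ) (hε : 0 < ε) :
    ∃ N ∈ nhds (0 : ℂ × ℂ), ∃ Y : Set (ℂ × ℂ), IsPreconnected Y ∧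
      (∀ y ∈ N, F 0 < F y → y ∈ Y) ∧ ∀ y ∈ Y, F 0 < F y ∧ y ∈ ball 0 ε := by
  obtain ⟨ε1, hε1, hb⟩ := Metric.eventually_nhds_iff.1 hlow
  have hlow' : ∀ x : ℝ, |x| < ε1 → F 0 + β.re * x + (q + c) * x ^ 2 ≤ F (0, ⟨x, 0⟩) := by
    intro x hx
    have hx' : (⟨x, 0⟩ : ℂ) = (x : ℂ) := rfl
    have := hb (y := (0, ⟨x, 0⟩)) (by
      rw [hx', Prod.dist_eq]; simp [hx, hε1])
    rw [hx'] at this ⊢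
    simp [quadP, pow_two] at this
    nlinarith
  obtain ⟨⟨r0, hr0, hconv⟩, hder⟩ := horiz_conv F hF β.re (q + c) (by positivity) (by
    filter_upwards [Metric.ball_mem_nhds (0:ℝ) hε1] with x hx
    exact hlow' x (by simpa using hx))
  -- choose δ
  set δ0 := min r0 (min (ε1 / 2) (ε / 2)) / 2 with hδ0
  have hδ0p : 0 < δ0 := by rw [hδ0]; positivity
  have hm1 : min r0 (min (ε1 / 2) (ε / 2)) ≤ r0 := min_le_left _ _
  have hm2 : min r0 (min (ε1 / 2) (ε / 2)) ≤ ε1 / 2 := (min_le_right _ _).trans (min_le_left _ _)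
  have hm3 : min r0 (min (ε1 / 2) (ε / 2)) ≤ ε / 2 := (min_le_right _ _).trans (min_le_right _ _)
  obtain ⟨δ, hδ, hδδ, hleft⟩ : ∃ δ, 0 < δ ∧ δ ≤ δ0 ∧
      (0 < β.re → F (0, ⟨-δ, 0⟩) < F 0) := by
    rcases hβ.eq_or_lt with h | h
    · exact ⟨δ0, hδ0p, le_rfl, fun h' => by linarith⟩
    · have h1 : ∀ᶠ x : ℝ in nhdsWithin 0 (Iio 0), F (0, ⟨x, 0⟩) < F 0 := by
        have := (hasDerivWithinAt_iff_tendsto_slope' (by simp)).1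
          (hder.hasDerivWithinAt (s := Iio 0))
        filter_upwards [this.eventually (lt_mem_nhds h), self_mem_nhdsWithin] with x hx hx0
        rw [slope_def_field, sub_zero] at hx
        have hx0' : x < 0 := hx0
        have h5 := (div_pos_iff.1 hx)
        rcases h5 with h5 | h5
        · linarith [h5.2]
        · have := h5.1
          have h0 : ((0, ⟨0, 0⟩) : ℂ × ℂ) = 0 := rfl
          rw [h0] at this; linarith
      have h2 : ∀ᶠ x : ℝ in nhdsWithin 0 (Iio 0), x ∈ Ioo (-δ0) 0 :=
        Ioo_mem_nhdsLT (by linarith)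
      obtain ⟨x, hx1, hx2⟩ := (h1.and h2).exists
      exact ⟨-x, by linarith [hx2.2], by linarith [hx2.1], fun _ => by simpa using hx1⟩
  have hFc := hF.continuous
  have hRpos : F 0 < F (0, ⟨δ, 0⟩) := by
    have := hlow' δ (by rw [abs_of_pos hδ]; linarith)
    have : 0 < (q + c) * δ ^ 2 := by positivity
    nlinarith
  obtain ⟨ρ1, hρ1, hR⟩ := edge_ev F hFc δ (Ioi (F 0)) isOpen_Ioi hRpos
  obtain ⟨ρ2, hρ2, hL⟩ : ∃ ρ2 > 0, (0 < β.re → ∀ z : ℂ, ∀ y : ℝ, ‖z‖ < ρ2 → |y| < ρ2 →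
      F (z, ⟨-δ, y⟩) < F 0) ∧ (β.re = 0 → ∀ z : ℂ, ∀ y : ℝ, ‖z‖ < ρ2 → |y| < ρ2 →
      F 0 < F (z, ⟨-δ, y⟩)) := by
    rcases hβ.eq_or_lt with h | h
    · obtain ⟨ρ, hρ, hh⟩ := edge_ev F hFc (-δ) (Ioi (F 0)) isOpen_Ioi (by
        have := hlow' (-δ) (by rw [abs_neg, abs_of_pos hδ]; linarith)
        have h6 : 0 < (q + c) * δ ^ 2 := by positivity
        rw [← h] at this
        simp only [mem_Ioi]
        rw [neg_sq] at this
        linarith)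
      exact ⟨ρ, hρ, fun h' => by linarith, fun _ => hh⟩
    · obtain ⟨ρ, hρ, hh⟩ := edge_ev F hFc (-δ) (Iio (F 0)) isOpen_Iio (hleft h)
      exact ⟨ρ, hρ, fun _ => hh, fun h' => by linarith⟩
  set ρ := min (min ρ1 ρ2) δ with hρ
  have hρp : 0 < ρ := by rw [hρ]; positivity
  have hρa : ρ ≤ ρ1 := (min_le_left _ _).trans (min_le_left _ _)
  have hρb : ρ ≤ ρ2 := (min_le_left _ _).trans (min_le_right _ _)
  have hρc : ρ ≤ δ := min_le_right _ _
  have hnorm : ∀ z : ℂ, ∀ x y : ℝ, ‖z‖ < ρ → |y| < ρ → |x| ≤ δ → ∀ e, 2 * δ ≤ e →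
      dist ((z, ⟨x, y⟩) : ℂ × ℂ) 0 < e := by
    intro z x y hz hy hx e he
    rw [Prod.dist_eq]
    refine max_lt ?_ ?_
    · simp; linarith
    · simp only [Prod.snd_zero, dist_zero_right]
      have h3 := Complex.norm_le_abs_re_add_abs_im (⟨x, y⟩ : ℂ)
      simp only at h3
      linarith
  have hpre := box_preconn F (F 0) ρ δ hρp hδ
    (fun z y hz hy => hconv δ hδ (by linarith) z y (by linarith) (by linarith))
    (fun z y hz hy => hR z y (by linarith) (by linarith))
    (by
      rcases hβ.eq_or_lt with h | h
      · right
        refine ⟨fun z y hz hy => hL.2 h.symm z y (by linarith) (by linarith), ?_⟩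
        obtain ⟨z, y, hz, hy, hx⟩ := full_seg α β a b q c hq hc h.symm ρ hρp
        refine ⟨z, y, hz, hy, fun x hxI => ?_⟩
        have h1 := hb (y := (z, ⟨x, y⟩)) (hnorm z x y hz hy (abs_le.2 hxI) _ (by linarith))
        have h2 := hx x
        simp only at h1
        linarith
      · left
        exact fun z y hz hy => (hL.1 h z y (by linarith) (by linarith)).le)
  refine ⟨ball 0 ρ, ball_mem_nhds _ hρp, _, hpre, ?_, ?_⟩
  · rintro ⟨z, ζ⟩ hy hF0
    rw [mem_ball, Prod.dist_eq, max_lt_iff] at hy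
    simp only [Prod.fst_zero, Prod.snd_zero, dist_zero_right] at hy
    have h1 := Complex.abs_im_le_norm ζ
    have h2 := abs_le.1 (Complex.abs_re_le_norm ζ)
    refine ⟨hy.1, by simp only; linarith [hy.2], ⟨by simp only; linarith [hy.2], by simp only; linarith [hy.2]⟩, hF0⟩
  · rintro ⟨z, ⟨x, y⟩⟩ ⟨hz, hy, hx, hF0⟩
    exact ⟨hF0, hnorm z x y hz hy (abs_le.2 hx) _ (by linarith)⟩

/-- Superlevel sets of strictly psh functions are locally connected at the boundary. -/
lemma conn (σ : ℂ × ℂ → ℝ) (hσ : ContDiff ℝ 2 σ) (hs : StrictL σ) (p : ℂ × ℂ) (ε : ℝ)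
    (hε : 0 < ε) :
    ∃ N ∈ nhds p, ∃ Y : Set (ℂ × ℂ), IsPreconnected Y ∧
      (∀ y ∈ N, σ p < σ y → y ∈ Y) ∧ ∀ y ∈ Y, σ p < σ y ∧ y ∈ ball p ε := by
  obtain ⟨α, β, a, b, q, c, hc, hlow⟩ := hs p
  obtain ⟨e, he1, he2, he3⟩ : ∃ e : ℂ, ‖e‖ = 1 ∧ q * e ^ 2 = ‖q‖ ∧ 0 ≤ (β * e).re := by
    have h1 : ∃ e : ℂ, ‖e‖ = 1 ∧ q * e ^ 2 = ‖q‖ := by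
      refine ⟨Complex.exp ((-(q.arg / 2) : ℝ) * Complex.I), Complex.norm_exp_ofReal_mul_I _, ?_⟩
      rw [← Complex.exp_nat_mul]
      nth_rw 1 [← Complex.norm_mul_exp_arg_mul_I q]
      rw [mul_assoc, ← Complex.exp_add]
      have : (q.arg : ℂ) * Complex.I + ((2 : ℕ) : ℂ) * (((-(q.arg / 2) : ℝ) : ℂ) * Complex.I) = 0 := by
        push_cast; ring
      rw [this]; simp
    obtain ⟨e, h1, h2⟩ := h1
    by_cases h : 0 ≤ (β * e).re
    · exact ⟨e, h1, h2, h⟩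
    · refine ⟨-e, by simpa using h1, by simpa using h2, ?_⟩
      rw [mul_neg, Complex.neg_re]; linarith
  have he0 : e ≠ 0 := by rintro rfl; simp at he1
  set T : ℂ × ℂ → ℂ × ℂ := fun y => p + (y.1, e * y.2) with hT
  set S : ℂ × ℂ → ℂ × ℂ := fun y => ((y - p).1, e⁻¹ * (y - p).2) with hS
  have hTS : ∀ y, T (S y) = y := by
    intro y; simp only [hT, hS]; ext <;> simp [mul_inv_cancel_left₀ he0]
  have hT0 : T 0 = p := by simp [hT]
  have hTc : Continuous T := by simp only [hT]; fun_prop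
  have hSc : Continuous S := by simp only [hS]; fun_prop
  have hS0 : S p = 0 := by simp [hS]
  have hTd : ContDiff ℝ 2 T := by
    simp only [hT]; fun_prop
  have hdist : ∀ y, dist (T y) p = dist y 0 := by
    intro y
    simp only [hT]
    rw [dist_eq_norm, add_sub_cancel_left, dist_zero_right, Prod.norm_def, Prod.norm_def]
    simp [he1]
  have hF : ContDiff ℝ 2 (fun y => σ (T y)) := hσ.comp hTd
  obtain ⟨N, hN, Y, hY, h1, h2⟩ := conn' (fun y => σ (T y)) hF α (β * e) a (b * e)
    (‖q‖ + c / 2) (c / 2) (by positivity) (by positivity) he3 (by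
      have hcont : Filter.Tendsto (fun y : ℂ × ℂ => ((y.1, e * y.2) : ℂ × ℂ)) (nhds 0) (nhds 0) := by
        have : Continuous (fun y : ℂ × ℂ => ((y.1, e * y.2) : ℂ × ℂ)) := by fun_prop
        have h7 := this.tendsto 0
        simp only [Prod.fst_zero, Prod.snd_zero, mul_zero] at h7
        exact h7
      filter_upwards [hcont.eventually hlow] with y hy
      simp only [hT0]
      refine le_trans ?_ hy
      simp only [norm_mul, he1, one_mul]
      have e1 : quadP α (β * e) a (b * e) ((‖q‖ + c / 2 : ℝ) : ℂ) y =
          quadP α β a b q (y.1, e * y.2) + ((c / 2 : ℝ) : ℂ) * y.2 ^ 2 := by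
        simp only [quadP]; push_cast; rw [← he2]; ring
      rw [e1, Complex.add_re, Complex.re_ofReal_mul]
      have h3 : (y.2 ^ 2).re ≤ ‖y.2‖ ^ 2 := by
        rw [← norm_pow]; exact Complex.re_le_norm _
      have h4 : 0 ≤ c * ‖y.1‖ ^ 2 := by positivity
      nlinarith) ε hε
  simp only [hT0] at h1 h2
  refine ⟨S ⁻¹' N, hSc.continuousAt.preimage_mem_nhds (by rwa [hS0]), T '' Y,
    hY.image _ hTc.continuousOn, fun y hy hlt => ?_, ?_⟩
  · exact ⟨S y, h1 (S y) hy (by rwa [hTS]), hTS y⟩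
  · rintro _ ⟨y, hy, rfl⟩
    refine ⟨(h2 y hy).1, ?_⟩
    rw [mem_ball, hdist]; exact (h2 y hy).2
end
end

section
open Metric Set Polynomial
noncomputable section

lemma exp_one_norm {w : ℂ} (h : Complex.exp w = 1) (h0 : w ≠ 0) : 1 ≤ ‖w‖ := by
  obtain ⟨n, rfl⟩ := Complex.exp_eq_one_iff.1 h
  have hn : n ≠ 0 := by rintro rfl; simp at h0
  rw [norm_mul, norm_mul, norm_mul]
  have h1 : (1:ℝ) ≤ ‖(n : ℂ)‖ := by
    rw [Complex.norm_intCast]; exact_mod_cast Int.one_le_abs hn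
  have h2 : ‖((Real.pi : ℝ) : ℂ)‖ = Real.pi := by
    rw [Complex.norm_real, Real.norm_of_nonneg Real.pi_pos.le]
  rw [h2]; simp
  have := Real.pi_gt_three
  simp at h1
  nlinarith

lemma exp_const {X : Type*} [TopologicalSpace X] {Y : Set X} (hY : IsPreconnected Y) {χ : X → ℂ}
    (hχ : ContinuousOn χ Y) {k : ℂ} (h : ∀ y ∈ Y, Complex.exp (χ y) = k) {y1 y2 : X}
    (h1 : y1 ∈ Y) (h2 : y2 ∈ Y) : χ y1 = χ y2 := by
  by_contra hne
  have hk : k ≠ 0 := by rw [← h y1 h1]; exact Complex.exp_ne_zero _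
  have hd : ∀ y ∈ Y, χ y = χ y1 ∨ 1 ≤ ‖χ y - χ y1‖ := by
    intro y hy
    by_cases hh : χ y = χ y1
    · exact Or.inl hh
    · exact Or.inr (exp_one_norm (by rw [Complex.exp_sub, h y hy, h y1 h1, div_self hk])
        (sub_ne_zero.2 hh))
  have hc : ContinuousOn (fun y => ‖χ y - χ y1‖) Y := (hχ.sub continuousOn_const).norm
  have hi := hY.image _ hc
  have h3 := hi.Icc_subset (mem_image_of_mem _ h1) (mem_image_of_mem _ h2)
  have h4 : (1:ℝ)/2 ∈ Icc ‖χ y1 - χ y1‖ ‖χ y2 - χ y1‖ := by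
    rcases hd y2 h2 with h | h
    · exact (hne h.symm).elim
    · constructor
      · simp
      · linarith
  obtain ⟨y, hy, hy2⟩ := h3 h4
  simp only at hy2
  rcases hd y hy with h | h
  · rw [h] at hy2; norm_num at hy2
  · linarith

lemma nomax (σ : ℂ × ℂ → ℝ) (hs : StrictL σ) (z ζ : ℂ) : ¬ IsLocalMax (fun η => σ (z, η)) ζ := by
  intro hm
  obtain ⟨α, β, a, b, q, c, hc, hlow⟩ := hs (z, ζ)
  refine nomax1 (γ := fun η => β * (η - ζ) + q * (η - ζ) ^ 2) (z0 := ζ) (c := c) (by fun_prop)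
    (by simp) hc ?_
  have ht : Filter.Tendsto (fun η : ℂ => ((0, η - ζ) : ℂ × ℂ)) (nhds ζ) (nhds 0) := by
    have : Continuous (fun η : ℂ => ((0, η - ζ) : ℂ × ℂ)) := by fun_prop
    have h7 := this.tendsto ζ
    simp only [sub_self] at h7
    exact h7
  filter_upwards [hm, ht.eventually hlow] with η h1 h2
  simp [quadP] at h1 h2 ⊢
  linarith

lemma exists_near_gt (σ : ℂ × ℂ → ℝ) (hs : StrictL σ) (z ζ : ℂ) (N : Set (ℂ × ℂ))
    (hN : N ∈ nhds (z, ζ)) : ∃ η, (z, η) ∈ N ∧ σ (z, ζ) < σ (z, η) := by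
  by_contra hcon
  push Not at hcon
  refine nomax σ hs z ζ ?_
  have hc : ContinuousAt (fun η : ℂ => ((z, η) : ℂ × ℂ)) ζ := by fun_prop
  filter_upwards [hc.preimage_mem_nhds hN] with η hη
  exact hcon η hη

lemma fib (g : ℂ → ℝ) (hg : Continuous g) (hnm : ∀ ζ, ¬ IsLocalMax g ζ) (R t : ℝ) (χ : ℂ → ℂ)
    (hχ : ContinuousOn χ {ζ | ‖ζ‖ ≤ R ∧ t ≤ g ζ})
    (h1 : ∀ ζ, ‖ζ‖ ≤ R → t ≤ g ζ → Complex.exp (χ ζ) = 1)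
    (h0 : ∀ ζ, ‖ζ‖ = R → t ≤ g ζ → χ ζ = 0) :
    ∀ ζ, ‖ζ‖ ≤ R → t ≤ g ζ → χ ζ = 0 := by
  set Fb := {ζ : ℂ | ‖ζ‖ ≤ R ∧ t ≤ g ζ} with hFb
  have hFc : IsCompact Fb := by
    have : Fb = closedBall 0 R ∩ {ζ | t ≤ g ζ} := by ext; simp [hFb]
    rw [this]
    exact (isCompact_closedBall _ _).inter_right (isClosed_le continuous_const hg)
  set S := Fb ∩ (fun ζ => ‖χ ζ‖) ⁻¹' Ici 1 with hS
  have hSc : IsCompact S := hFc.of_isClosed_subset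
    (hχ.norm.preimage_isClosed_of_isClosed hFc.isClosed isClosed_Ici) inter_subset_left
  by_contra hcon
  push Not at hcon
  obtain ⟨ζ, a1, a2, a3⟩ := hcon
  have hne : S.Nonempty := ⟨ζ, ⟨a1, a2⟩, exp_one_norm (h1 ζ a1 a2) a3⟩
  obtain ⟨m, hmS, hmax⟩ := hSc.exists_isMaxOn hne hg.continuousOn
  have hχm : χ m ≠ 0 := by
    intro h; have : (1:ℝ) ≤ ‖χ m‖ := hmS.2
    rw [h] at this; norm_num at this
  have hmR : ‖m‖ < R := lt_of_le_of_ne hmS.1.1 (fun h => hχm (h0 m h hmS.1.2))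
  refine hnm m ?_
  have e1 := (hχ m hmS.1).eventually (isOpen_ne.mem_nhds hχm)
  rw [eventually_nhdsWithin_iff] at e1
  have e2 : ∀ᶠ ζ : ℂ in nhds m, ‖ζ‖ < R := continuous_norm.continuousAt.eventually (gt_mem_nhds hmR)
  filter_upwards [e1, e2] with ζ b1 b2
  by_contra hlt
  push Not at hlt
  have hF : ζ ∈ Fb := ⟨b2.le, hmS.1.2.trans hlt.le⟩
  have : ζ ∈ S := ⟨hF, exp_one_norm (h1 ζ hF.1 hF.2) (b1 hF)⟩
  exact absurd (hmax this) (not_le.2 hlt)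

structure Cfg (σ : ℂ × ℂ → ℝ) (L L2 : ℂ → ℂ) (c0 : ℂ) (r0 R0 R tm : ℝ) : Prop where
  hσ : ContDiff ℝ 2 σ
  hs : StrictL σ
  hL : Continuous L
  hL2 : Continuous L2
  heq : ∀ z, z ∉ ball c0 r0 → L z = L2 z
  n1 : ∀ z ∈ closedBall c0 r0, σ (z, L z) < 0
  n2 : ∀ z ∈ closedBall c0 r0, σ (z, L2 z) < 0
  R0p : 0 < R0
  RR : 2 * R0 ≤ R
  b1 : ∀ z, ‖L z‖ ≤ R0
  b2 : ∀ z, ‖L2 z‖ ≤ R0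
  tm0 : 0 ≤ tm
  t1 : ∀ z ∈ closedBall c0 r0, ∀ ζ : ℂ, ‖ζ‖ ≤ R0 → σ (z, ζ) < tm
  t2 : ∀ z ∈ closedBall c0 r0, ∀ ζ : ℂ, ‖ζ‖ = R → tm < σ (z, ζ)

def KK (σ : ℂ × ℂ → ℝ) (R t : ℝ) : Set (ℂ × ℂ) := {p | ‖p.2‖ ≤ R ∧ t ≤ σ p}

def ell (L L2 : ℂ → ℂ) (p : ℂ × ℂ) : ℂ :=
  Complex.log (1 - L p.1 / p.2) - Complex.log (1 - L2 p.1 / p.2)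

def PP (σ : ℂ × ℂ → ℝ) (L L2 : ℂ → ℂ) (c0 : ℂ) (r0 R t : ℝ) (ψ : ℂ × ℂ → ℂ) : Prop :=
  ContinuousOn ψ (KK σ R t) ∧
  (∀ p ∈ KK σ R t, Complex.exp (ψ p) * (p.2 - L2 p.1) = p.2 - L p.1) ∧
  (∀ p ∈ KK σ R t, p.1 ∉ ball c0 r0 → ψ p = 0) ∧
  (∀ p ∈ KK σ R t, ‖p.2‖ = R → ψ p = ell L L2 p)

section
variable {σ : ℂ × ℂ → ℝ} {L L2 : ℂ → ℂ} {c0 : ℂ} {r0 R0 R tm : ℝ}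

lemma KK_closed (hσ : Continuous σ) (R t : ℝ) : IsClosed (KK σ R t) :=
  (isClosed_le (continuous_snd.norm) continuous_const).inter
    (isClosed_le continuous_const hσ)

lemma KK_mono {t t' : ℝ} (h : t ≤ t') : KK σ R t' ⊆ KK σ R t := fun _ hp => ⟨hp.1, h.trans hp.2⟩

lemma PP_mono {t t' : ℝ} (h : t ≤ t') {ψ : ℂ × ℂ → ℂ} (hp : PP σ L L2 c0 r0 R t ψ) :
    PP σ L L2 c0 r0 R t' ψ :=
  ⟨hp.1.mono (KK_mono h), fun p q => hp.2.1 p (KK_mono h q),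
    fun p q => hp.2.2.1 p (KK_mono h q), fun p q => hp.2.2.2 p (KK_mono h q)⟩

lemma ell_out (H : Cfg σ L L2 c0 r0 R0 R tm) (p : ℂ × ℂ) (hp : p.1 ∉ ball c0 r0) :
    ell L L2 p = 0 := by
  rw [ell, H.heq _ hp, sub_self]

lemma ne1 (H : Cfg σ L L2 c0 r0 R0 R tm) {p : ℂ × ℂ} (hp : p.1 ∈ closedBall c0 r0)
    (h0 : 0 ≤ σ p) : p.2 - L p.1 ≠ 0 := by
  intro h
  have := H.n1 p.1 hp
  rw [← sub_eq_zero.1 h] at this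
  exact absurd h0 (not_le.2 this)

lemma ne2 (H : Cfg σ L L2 c0 r0 R0 R tm) {p : ℂ × ℂ} (hp : p.1 ∈ closedBall c0 r0)
    (h0 : 0 ≤ σ p) : p.2 - L2 p.1 ≠ 0 := by
  intro h
  have := H.n2 p.1 hp
  rw [← sub_eq_zero.1 h] at this
  exact absurd h0 (not_le.2 this)

lemma PP_uniq (H : Cfg σ L L2 c0 r0 R0 R tm) {t1 t2 t : ℝ} {ψ1 ψ2 : ℂ × ℂ → ℂ}
    (h1 : PP σ L L2 c0 r0 R t1 ψ1) (h2 : PP σ L L2 c0 r0 R t2 ψ2) (h1t : t1 ≤ t) (h2t : t2 ≤ t)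
    (ht : 0 ≤ t) {p : ℂ × ℂ} (hp : p ∈ KK σ R t) : ψ1 p = ψ2 p := by
  have h1' := PP_mono h1t h1
  have h2' := PP_mono h2t h2
  by_cases hz : p.1 ∈ ball c0 r0
  · have hz' := ball_subset_closedBall hz
    have hc : ContinuousOn (fun ζ => ψ1 (p.1, ζ) - ψ2 (p.1, ζ)) {ζ | ‖ζ‖ ≤ R ∧ t ≤ σ (p.1, ζ)} := by
      have hm : MapsTo (fun ζ : ℂ => (p.1, ζ)) {ζ | ‖ζ‖ ≤ R ∧ t ≤ σ (p.1, ζ)} (KK σ R t) :=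
        fun ζ hζ => hζ
      exact (h1'.1.comp (by fun_prop) hm).sub (h2'.1.comp (by fun_prop) hm)
    have := fib (fun ζ => σ (p.1, ζ)) (H.hσ.continuous.comp (by fun_prop))
      (fun ζ => nomax σ H.hs _ _) R t (fun ζ => ψ1 (p.1, ζ) - ψ2 (p.1, ζ)) hc ?_ ?_ p.2 hp.1 hp.2
    · exact sub_eq_zero.1 this
    · intro ζ a b
      have e1 := h1'.2.1 (p.1, ζ) ⟨a, b⟩
      have e2 := h2'.2.1 (p.1, ζ) ⟨a, b⟩
      have n2 := ne2 H (p := (p.1, ζ)) hz' (ht.trans b)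
      have := mul_right_cancel₀ n2 (e1.trans e2.symm)
      rw [Complex.exp_sub, this, div_self (Complex.exp_ne_zero _)]
    · intro ζ a b
      rw [h1'.2.2.2 (p.1, ζ) ⟨a.le, b⟩ a, h2'.2.2.2 (p.1, ζ) ⟨a.le, b⟩ a, sub_self]
  · rw [h1'.2.2.1 p hp hz, h2'.2.2.1 p hp hz]

lemma paste (K : Set (ℂ × ℂ)) (hK : IsClosed K) (χ : ℂ × ℂ → ℂ) (c0 : ℂ) (r0 : ℝ)
    (hχ : ContinuousOn χ (K ∩ {p | p.1 ∈ closedBall c0 r0}))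
    (h0 : ∀ p ∈ K, p.1 ∈ sphere c0 r0 → χ p = 0) :
    ContinuousOn (fun p => open Classical in if p.1 ∈ ball c0 r0 then χ p else 0) K := by
  have e : K = (K ∩ {p | p.1 ∈ closedBall c0 r0}) ∪ (K ∩ {p | p.1 ∉ ball c0 r0}) := by
    ext p
    simp only [mem_union, mem_inter_iff, mem_ofPred_eq]
    constructor
    · intro h
      by_cases h2 : p.1 ∈ ball c0 r0
      · exact Or.inl ⟨h, ball_subset_closedBall h2⟩
      · exact Or.inr ⟨h, h2⟩
    · rintro (h | h) <;> exact h.1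
  rw [e]
  refine ContinuousOn.union_of_isClosed ?_ ?_ (hK.inter (isClosed_closedBall.preimage continuous_fst))
    (hK.inter (isOpen_ball.isClosed_compl.preimage continuous_fst))
  · refine hχ.congr fun p hp => ?_
    split_ifs with h
    · rfl
    · refine (h0 p hp.1 ?_).symm
      have h1 : dist p.1 c0 ≤ r0 := hp.2
      rw [mem_ball, not_lt] at h
      exact le_antisymm h1 h
  · refine (continuousOn_const (c := (0:ℂ))).congr fun p hp => ?_
    exact if_neg hp.2

lemma ell_fac (H : Cfg σ L L2 c0 r0 R0 R tm) (p : ℂ × ℂ) (hp : R0 < ‖p.2‖) :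
    1 - L p.1 / p.2 ∈ Complex.slitPlane ∧ 1 - L2 p.1 / p.2 ∈ Complex.slitPlane := by
  have h : ∀ a : ℂ, ‖a‖ ≤ R0 → 1 - a / p.2 ∈ Complex.slitPlane := by
    intro a ha
    have hp0 : 0 < ‖p.2‖ := H.R0p.trans hp
    have : ‖a / p.2‖ < 1 := by rw [norm_div, div_lt_one hp0]; linarith
    left
    have h2 := (Complex.re_le_norm (a / p.2))
    rw [Complex.sub_re, Complex.one_re]; linarith
  exact ⟨h _ (H.b1 _), h _ (H.b2 _)⟩

lemma PP_start (H : Cfg σ L L2 c0 r0 R0 R tm) : ∃ ψ, PP σ L L2 c0 r0 R tm ψ := by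
  have hbig : ∀ p ∈ KK σ R tm, p.1 ∈ closedBall c0 r0 → R0 < ‖p.2‖ := by
    intro p hp hz
    by_contra h
    exact absurd hp.2 (not_le.2 (H.t1 p.1 hz p.2 (not_lt.1 h)))
  refine ⟨_, paste (KK σ R tm) (KK_closed H.hσ.continuous _ _) (ell L L2) c0 r0 ?_ ?_, ?_, ?_, ?_⟩
  · intro p hp
    have h1 := hbig p hp.1 hp.2
    have h2 := ell_fac H p h1
    have hp0 : p.2 ≠ 0 := norm_pos_iff.1 (H.R0p.trans h1)
    have c1 : ContinuousAt (fun p : ℂ × ℂ => 1 - L p.1 / p.2) p :=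
      continuousAt_const.sub (ContinuousAt.div (H.hL.continuousAt.comp continuousAt_fst)
        continuousAt_snd hp0)
    have c2 : ContinuousAt (fun p : ℂ × ℂ => 1 - L2 p.1 / p.2) p :=
      continuousAt_const.sub (ContinuousAt.div (H.hL2.continuousAt.comp continuousAt_fst)
        continuousAt_snd hp0)
    exact ((c1.clog h2.1).sub (c2.clog h2.2)).continuousWithinAt
  · intro p hp hs
    exact ell_out H p (by rw [mem_ball, mem_sphere.1 hs]; exact lt_irrefl _)
  · intro p hp
    split_ifs with h
    · have h1 := hbig p hp (ball_subset_closedBall h)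
      have h2 := ell_fac H p h1
      have hp0 : p.2 ≠ 0 := norm_pos_iff.1 (H.R0p.trans h1)
      rw [ell, Complex.exp_sub, Complex.exp_log (Complex.slitPlane_ne_zero h2.1),
        Complex.exp_log (Complex.slitPlane_ne_zero h2.2)]
      have h3 := Complex.slitPlane_ne_zero h2.2
      rw [div_mul_eq_mul_div, div_eq_iff h3]
      field_simp
    · rw [Complex.exp_zero, one_mul, H.heq _ h]
  · intro p hp h
    exact if_neg h
  · intro p hp h
    split_ifs with h'
    · rfl
    · exact (ell_out H p h').symm
end
end
end

section
open Metric Set Polynomial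
noncomputable section
section
variable {σ : ℂ × ℂ → ℝ} {L L2 : ℂ → ℂ} {c0 : ℂ} {r0 R0 R tm : ℝ}

lemma PP_open (H : Cfg σ L L2 c0 r0 R0 R tm) {t : ℝ} (ht : 0 < t) (htm : t ≤ tm) {ψ : ℂ × ℂ → ℂ}
    (hψ : PP σ L L2 c0 r0 R t ψ) : ∃ t', 0 ≤ t' ∧ t' < t ∧ ∃ ψ', PP σ L L2 c0 r0 R t' ψ' := by
  have hσc := H.hσ.continuous
  obtain ⟨ψh, hψh⟩ := ContinuousMap.exists_restrict_eq (KK_closed hσc R t)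
    ⟨(KK σ R t).domRestrict ψ, continuousOn_iff_continuous_domRestrict.1 hψ.1⟩
  have hext : ∀ p ∈ KK σ R t, ψh p = ψ p := by
    intro p hp
    have := congrArg (fun f => f ⟨p, hp⟩) hψh
    exact this
  set Kc : Set (ℂ × ℂ) := KK σ R 0 ∩ {p | p.1 ∈ closedBall c0 r0} with hKc
  have hKcomp : IsCompact Kc := by
    refine ((isCompact_closedBall c0 r0).prod (isCompact_closedBall (0:ℂ) R)).of_isClosed_subset
      ((KK_closed hσc R 0).inter (isClosed_closedBall.preimage continuous_fst)) ?_
    rintro p ⟨hp, hz⟩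
    exact ⟨hz, by simpa using hp.1⟩
  set Q : ℂ × ℂ → ℂ := fun p => Complex.exp (ψh p) * (p.2 - L2 p.1) / (p.2 - L p.1) with hQ
  have hLc := H.hL
  have hL2c := H.hL2
  have hQc : ContinuousOn Q Kc := by
    refine ContinuousOn.div ?_ ?_ ?_
    · exact Continuous.continuousOn (by fun_prop)
    · exact Continuous.continuousOn (by fun_prop)
    · intro p hp; exact ne1 H hp.2 hp.1.2
  have hQ1 : ∀ p ∈ KK σ R t, p.1 ∈ closedBall c0 r0 → Q p = 1 := by
    intro p hp hz
    simp only [hQ]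
    rw [hext p hp, hψ.2.1 p hp, div_self (ne1 H hz (ht.le.trans hp.2))]
  set Bad := Kc ∩ (fun p => (Q p).re) ⁻¹' Iic 0 with hBad
  have hBc : IsCompact Bad := hKcomp.of_isClosed_subset
    ((Complex.continuous_re.comp_continuousOn hQc).preimage_isClosed_of_isClosed hKcomp.isClosed
      isClosed_Iic) inter_subset_left
  have hBt : ∀ p ∈ Bad, σ p < t := by
    intro p hp
    by_contra h
    have := hQ1 p ⟨hp.1.1.1, not_lt.1 h⟩ hp.1.2
    have h2 : (Q p).re ≤ 0 := hp.2
    rw [this] at h2; norm_num at h2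
  obtain ⟨t', ht0, htt, hgood⟩ : ∃ t', 0 ≤ t' ∧ t' < t ∧ ∀ p ∈ Bad, σ p < t' := by
    by_cases hne : Bad.Nonempty
    · obtain ⟨m, hm, hmax⟩ := hBc.exists_isMaxOn hne hσc.continuousOn
      have h1 := hBt m hm
      have h2 : 0 ≤ σ m := hm.1.1.2
      exact ⟨(σ m + t) / 2, by linarith, by linarith, fun p hp => by
        have : σ p ≤ σ m := hmax hp
        linarith⟩
    · exact ⟨0, le_rfl, ht, fun p hp => (hne ⟨p, hp⟩).elim⟩
  have hQpos : ∀ p ∈ KK σ R t', p.1 ∈ closedBall c0 r0 → 0 < (Q p).re := by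
    intro p hp hz
    by_contra h
    exact absurd (hgood p ⟨⟨KK_mono ht0 hp, hz⟩, not_lt.1 h⟩) (not_lt.2 hp.2)
  refine ⟨t', ht0, htt, ?_⟩
  set χ : ℂ × ℂ → ℂ := fun p => ψh p - Complex.log (Q p) with hχ
  have hχc : ContinuousOn χ (KK σ R t' ∩ {p | p.1 ∈ closedBall c0 r0}) := by
    refine ψh.continuous.continuousOn.sub (ContinuousOn.clog ?_ ?_)
    · exact hQc.mono fun p hp => ⟨KK_mono ht0 hp.1, hp.2⟩
    · exact fun p hp => Or.inl (hQpos p hp.1 hp.2)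
  have hχe : ∀ p ∈ KK σ R t', p.1 ∈ closedBall c0 r0 →
      Complex.exp (χ p) * (p.2 - L2 p.1) = p.2 - L p.1 := by
    intro p hp hz
    have n1 := ne1 H hz (ht0.trans hp.2)
    have n2 := ne2 H hz (ht0.trans hp.2)
    have hQ0 : Q p ≠ 0 := by intro h; have := hQpos p hp hz; rw [h] at this; simp at this
    simp only [hχ]
    rw [Complex.exp_sub, Complex.exp_log hQ0]
    simp only [hQ]
    field_simp [Complex.exp_ne_zero]
  have hχR : ∀ p ∈ KK σ R t', p.1 ∈ closedBall c0 r0 → ‖p.2‖ = R → χ p = ell L L2 p := by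
    intro p hp hz hR
    have hpt : p ∈ KK σ R t := ⟨hR.le, htm.trans (H.t2 p.1 hz p.2 hR).le⟩
    simp only [hχ]
    rw [hQ1 p hpt hz, Complex.log_one, sub_zero, hext p hpt, hψ.2.2.2 p hpt hR]
  refine ⟨_, paste (KK σ R t') (KK_closed hσc _ _) χ c0 r0 hχc ?_, ?_, ?_, ?_⟩
  · intro p hp hs
    have hz : p.1 ∈ closedBall c0 r0 := sphere_subset_closedBall hs
    have hnb : p.1 ∉ ball c0 r0 := by rw [mem_ball, mem_sphere.1 hs]; exact lt_irrefl _
    refine fib (fun ζ => σ (p.1, ζ)) (hσc.comp (by fun_prop))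
      (fun ζ => nomax σ H.hs _ _) R t' (fun ζ => χ (p.1, ζ)) ?_ ?_ ?_ p.2 hp.1 hp.2
    · have hm : MapsTo (fun ζ : ℂ => (p.1, ζ)) {ζ | ‖ζ‖ ≤ R ∧ t' ≤ σ (p.1, ζ)}
        (KK σ R t' ∩ {p | p.1 ∈ closedBall c0 r0}) := fun ζ hζ => ⟨hζ, hz⟩
      exact hχc.comp (by fun_prop) hm
    · intro ζ a b
      have e := hχe (p.1, ζ) ⟨a, b⟩ hz
      have n2 := ne2 H (p := (p.1, ζ)) hz (ht0.trans b)
      simp only [H.heq _ hnb] at e n2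
      exact mul_right_cancel₀ n2 (by rw [e, one_mul])
    · intro ζ a b
      rw [hχR (p.1, ζ) ⟨a.le, b⟩ hz a]
      exact ell_out H _ hnb
  · intro p hp
    split_ifs with h
    · exact hχe p hp (ball_subset_closedBall h)
    · rw [Complex.exp_zero, one_mul, H.heq _ h]
  · intro p hp h
    exact if_neg h
  · intro p hp h
    split_ifs with h'
    · exact hχR p hp (ball_subset_closedBall h') h
    · exact (ell_out H p h').symm

lemma PP_closed (H : Cfg σ L L2 c0 r0 R0 R tm) {t : ℝ} (ht : 0 ≤ t) (htm : t ≤ tm)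
    (hP : ∀ s, t < s → ∃ ψ, PP σ L L2 c0 r0 R s ψ) : ∃ ψ', PP σ L L2 c0 r0 R t ψ' := by
  classical
  have hσc := H.hσ.continuous
  choose! Ψ hΨ using hP
  set f : ℂ × ℂ → ℂ := fun p => if p.1 ∈ ball c0 r0 then Ψ ((t + σ p) / 2) p else 0 with hf
  set A : Set (ℂ × ℂ) := {p | ‖p.2‖ ≤ R ∧ (t < σ p ∨ p.1 ∉ closedBall c0 r0)} with hA
  -- f agrees with Ψ s
  have hfs : ∀ s, t < s → ∀ p ∈ KK σ R s, f p = Ψ s p := by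
    intro s hs p hp
    simp only [hf]
    split_ifs with h
    · have h1 : t < σ p := hs.trans_le hp.2
      exact PP_uniq H (hΨ ((t + σ p) / 2) (by linarith)) (hΨ s hs) (t := σ p) (by linarith) hp.2
        (by linarith) ⟨hp.1, le_rfl⟩
    · exact ((hΨ s hs).2.2.1 p hp h).symm
  have hfout : ∀ p, p.1 ∉ ball c0 r0 → f p = 0 := fun p hp => if_neg hp
  have hfexp : ∀ p, ‖p.2‖ ≤ R → t < σ p → Complex.exp (f p) * (p.2 - L2 p.1) = p.2 - L p.1 := by
    intro p hp hs
    rw [hfs (σ p) hs p ⟨hp, le_rfl⟩]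
    exact (hΨ _ hs).2.1 p ⟨hp, le_rfl⟩
  have hfexp' : ∀ p ∈ A, Complex.exp (f p) * (p.2 - L2 p.1) = p.2 - L p.1 := by
    rintro p ⟨hp, hs | hs⟩
    · exact hfexp p hp hs
    · have : p.1 ∉ ball c0 r0 := fun h => hs (ball_subset_closedBall h)
      rw [hfout p this, Complex.exp_zero, one_mul, H.heq _ this]
  have hfc : ContinuousOn f A := by
    rintro p ⟨hp, hs⟩
    by_cases hz : p.1 ∈ closedBall c0 r0
    · have hs' : t < σ p := hs.resolve_right (not_not_intro hz)
      set s := (t + σ p) / 2 with hsd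
      have h1 := (hΨ s (by rw [hsd]; linarith)).1 p ⟨hp, by rw [hsd]; linarith⟩
      have h2 : {q | s < σ q} ∈ nhds p := (isOpen_lt continuous_const hσc).mem_nhds (by
        show s < σ p; rw [hsd]; linarith)
      have h3 : ContinuousWithinAt f (KK σ R s) p := by
        refine h1.congr (fun q hq => hfs s (by rw [hsd]; linarith) q hq) ?_
        exact hfs s (by rw [hsd]; linarith) p ⟨hp, by rw [hsd]; linarith⟩
      refine (continuousWithinAt_inter h2).1 (h3.mono ?_)
      rintro q ⟨hq, hq2⟩
      exact ⟨hq.1, le_of_lt hq2⟩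
    · have h2 : {q : ℂ × ℂ | q.1 ∉ closedBall c0 r0} ∈ nhds p :=
        ((isClosed_closedBall.isOpen_compl).preimage continuous_fst).mem_nhds hz
      have : f =ᶠ[nhds p] fun _ => 0 := by
        filter_upwards [h2] with q hq
        exact hfout q (fun h => hq (ball_subset_closedBall h))
      exact (continuousAt_const.congr this.symm).continuousWithinAt
  have hRlt : ∀ p ∈ KK σ R t, p ∉ A → ‖p.2‖ < R ∧ p.1 ∈ closedBall c0 r0 ∧ σ p = t := by
    intro p hp hpA
    have h1 : p.1 ∈ closedBall c0 r0 := by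
      by_contra h; exact hpA ⟨hp.1, Or.inr h⟩
    have h2 : σ p = t := le_antisymm (not_lt.1 fun h => hpA ⟨hp.1, Or.inl h⟩) hp.2
    refine ⟨lt_of_le_of_ne hp.1 fun h => ?_, h1, h2⟩
    have := H.t2 p.1 h1 p.2 h
    have h3 : σ (p.1, p.2) = t := h2
    linarith
  have hcl : KK σ R t ⊆ closure A := by
    intro p hp
    by_cases hpA : p ∈ A
    · exact subset_closure hpA
    · obtain ⟨h1, h2, h3⟩ := hRlt p hp hpA
      rw [mem_closure_iff_nhds]
      intro N hN
      have hN2 : {q : ℂ × ℂ | ‖q.2‖ < R} ∈ nhds p :=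
        (isOpen_lt continuous_snd.norm continuous_const).mem_nhds h1
      obtain ⟨η, hη, hlt⟩ := exists_near_gt σ H.hs p.1 p.2 _ (Filter.inter_mem hN hN2)
      refine ⟨(p.1, η), hη.1, le_of_lt hη.2, Or.inl ?_⟩
      have h3 : σ (p.1, p.2) = t := h3
      linarith
  have hlim : ∀ p ∈ KK σ R t, ∃ y, Filter.Tendsto f (nhdsWithin p A) (nhds y) := by
    intro p hp
    by_cases hpA : p ∈ A
    · exact ⟨_, hfc p hpA⟩
    obtain ⟨h1, h2, h3⟩ := hRlt p hp hpA
    have n1 := ne1 H h2 (by linarith)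
    have n2 := ne2 H h2 (by linarith)
    have hLc := H.hL
    have hL2c := H.hL2
    set ρ : ℂ × ℂ → ℂ := fun q => (q.2 - L q.1) / (q.2 - L2 q.1) with hρ
    have hρp : ρ p ≠ 0 := div_ne_zero n1 n2
    have hev : ∀ᶠ q in nhds p, q.2 - L q.1 ≠ 0 ∧ q.2 - L2 q.1 ≠ 0 ∧ ‖q.2‖ < R ∧
        ρ q / ρ p ∈ Complex.slitPlane ∧ (p.1 ∈ ball c0 r0 → q.1 ∈ ball c0 r0) := by
      have c1 : Continuous fun q : ℂ × ℂ => q.2 - L q.1 := by fun_prop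
      have c2 : Continuous fun q : ℂ × ℂ => q.2 - L2 q.1 := by fun_prop
      have c3 : ContinuousAt (fun q => ρ q / ρ p) p :=
        (c1.continuousAt.div c2.continuousAt n2).div_const _
      have c4 : ∀ᶠ q : ℂ × ℂ in nhds p, (p.1 ∈ ball c0 r0 → q.1 ∈ ball c0 r0) := by
        by_cases h : p.1 ∈ ball c0 r0
        · filter_upwards [(isOpen_ball.preimage continuous_fst).mem_nhds h] with q hq _ using hq
        · exact Filter.Eventually.of_forall fun q h' => (h h').elim
      filter_upwards [c1.continuousAt.eventually (isOpen_ne.mem_nhds n1),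
        c2.continuousAt.eventually (isOpen_ne.mem_nhds n2),
        (isOpen_lt continuous_snd.norm continuous_const).mem_nhds h1,
        c3.eventually (Complex.isOpen_slitPlane.mem_nhds (by
          show ρ p / ρ p ∈ _
          rw [div_self hρp]; exact Complex.one_mem_slitPlane)), c4] with q a b c d e
      exact ⟨a, b, c, d, e⟩
    obtain ⟨ε, hε, hball⟩ := Metric.eventually_nhds_iff.1 hev
    obtain ⟨N, hN, Y, hY, hNY, hYb⟩ := conn σ H.hσ H.hs p ε hε
    set lam : ℂ × ℂ → ℂ := fun q => Complex.log (ρ q / ρ p) with hlam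
    have hlamc : ∀ q ∈ ball p ε, ContinuousAt lam q := by
      intro q hq
      have hq' := hball hq
      have c1 : Continuous fun q : ℂ × ℂ => q.2 - L q.1 := by fun_prop
      have c2 : Continuous fun q : ℂ × ℂ => q.2 - L2 q.1 := by fun_prop
      exact ((c1.continuousAt.div c2.continuousAt hq'.2.1).div_const _).clog hq'.2.2.2.1
    have hlamp : lam p = 0 := by simp only [hlam]; rw [div_self hρp, Complex.log_one]
    have hYA : Y ⊆ A := fun q hq => ⟨(hball (hYb q hq).2).2.2.1.le, Or.inl (by
      have := (hYb q hq).1; linarith)⟩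
    have hχexp : ∀ q ∈ Y, Complex.exp (f q - lam q) = ρ p := by
      intro q hq
      have hq' := hball (hYb q hq).2
      have e := hfexp' q (hYA hq)
      have hρq : ρ q ≠ 0 := div_ne_zero hq'.1 hq'.2.1
      rw [Complex.exp_sub, Complex.exp_log (div_ne_zero hρq hρp)]
      have : Complex.exp (f q) = ρ q := by
        simp only [hρ]; rw [eq_div_iff hq'.2.1]; exact e
      rw [this]; field_simp
    have hχc : ContinuousOn (fun q => f q - lam q) Y :=
      (hfc.mono hYA).sub fun q hq => (hlamc q (hYb q hq).2).continuousWithinAt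
    obtain ⟨η, hη, hlt⟩ := exists_near_gt σ H.hs p.1 p.2 N hN
    have hy0 : (p.1, η) ∈ Y := hNY _ hη hlt
    set C := f (p.1, η) - lam (p.1, η) with hC
    refine ⟨C, ?_⟩
    have hform : ∀ᶠ q in nhdsWithin p A, lam q + C = f q := by
      rw [eventually_nhdsWithin_iff]
      filter_upwards [hN, ball_mem_nhds p hε] with q hqN hqb hqA
      rcases hqA.2 with h | h
      · have hqY := hNY q hqN (by linarith)
        have := exp_const hY hχc hχexp hy0 hqY
        rw [hC, this]; ring
      · have hq' := hball hqb
        have hqb' : q.1 ∉ ball c0 r0 := fun h' => h (ball_subset_closedBall h')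
        have hpb : p.1 ∉ ball c0 r0 := fun h' => hqb' (hq'.2.2.2.2 h')
        have r1 : ∀ x : ℂ × ℂ, x.1 ∉ ball c0 r0 → x ∈ ball p ε → ρ x = 1 := by
          intro x hx hxb
          simp only [hρ]
          rw [H.heq _ hx, div_self (hball hxb).2.1]
        have l1 : ∀ x : ℂ × ℂ, x.1 ∉ ball c0 r0 → x ∈ ball p ε → lam x = 0 := by
          intro x hx hxb
          simp only [hlam]
          rw [r1 x hx hxb, r1 p hpb (mem_ball_self hε), div_self one_ne_zero, Complex.log_one]
        rw [hC, l1 q hqb' hqb, l1 (p.1, η) hpb (hYb _ hy0).2, hfout _ hqb', hfout (p.1, η) hpb]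
        simp
    have hl := ((hlamc p (mem_ball_self hε)).tendsto.add_const C).mono_left
      (nhdsWithin_le_nhds (s := A))
    rw [hlamp, zero_add] at hl
    exact hl.congr' hform
  have hgc := continuousOn_extendFrom hcl hlim
  have hgA : ∀ p ∈ A, extendFrom A f p = f p := fun p hp =>
    extendFrom_eq (subset_closure hp) (hfc p hp)
  -- closure principle for identities
  have hne : ∀ p ∈ KK σ R t, (nhdsWithin p (A ∩ KK σ R t)).NeBot := by
    intro p hp
    rw [← mem_closure_iff_nhdsWithin_neBot]
    by_cases hpA : p ∈ A
    · exact subset_closure ⟨hpA, hp⟩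
    · obtain ⟨h1, h2, h3⟩ := hRlt p hp hpA
      rw [mem_closure_iff_nhds]
      intro N hN
      have hN2 : {q : ℂ × ℂ | ‖q.2‖ < R} ∈ nhds p :=
        (isOpen_lt continuous_snd.norm continuous_const).mem_nhds h1
      obtain ⟨η, hη, hlt⟩ := exists_near_gt σ H.hs p.1 p.2 _ (Filter.inter_mem hN hN2)
      have h3 : σ (p.1, p.2) = t := h3
      exact ⟨(p.1, η), hη.1, ⟨le_of_lt hη.2, Or.inl (by linarith)⟩, le_of_lt hη.2, by linarith⟩
  refine ⟨extendFrom A f, hgc, ?_, ?_, ?_⟩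
  · intro p hp
    have hLc := H.hL
    have hL2c := H.hL2
    have := hne p hp
    have c1 : Filter.Tendsto (fun q : ℂ × ℂ => Complex.exp (extendFrom A f q) * (q.2 - L2 q.1))
        (nhdsWithin p (A ∩ KK σ R t)) (nhds (Complex.exp (extendFrom A f p) * (p.2 - L2 p.1))) := by
      refine Filter.Tendsto.mul ?_ ?_
      · exact ((hgc p hp).mono inter_subset_right).cexp
      · exact (Continuous.tendsto (by fun_prop) p).mono_left nhdsWithin_le_nhds
    have c2 : Filter.Tendsto (fun q : ℂ × ℂ => q.2 - L q.1)
        (nhdsWithin p (A ∩ KK σ R t)) (nhds (p.2 - L p.1)) :=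
      (Continuous.tendsto (by fun_prop) p).mono_left nhdsWithin_le_nhds
    refine tendsto_nhds_unique (c1.congr' ?_) c2
    filter_upwards [self_mem_nhdsWithin] with q hq
    rw [hgA q hq.1]
    exact hfexp' q hq.1
  · intro p hp hz
    by_cases hpA : p ∈ A
    · rw [hgA p hpA, hfout p hz]
    · obtain ⟨h1, h2, h3⟩ := hRlt p hp hpA
      -- restrict to the fibre
      have h3' : σ (p.1, p.2) = t := h3
      set S : Set (ℂ × ℂ) := (A ∩ KK σ R t) ∩ {q | q.1 = p.1} with hS
      have hSn : (nhdsWithin p S).NeBot := by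
        rw [← mem_closure_iff_nhdsWithin_neBot, mem_closure_iff_nhds]
        intro N hN
        have hN2 : {q : ℂ × ℂ | ‖q.2‖ < R} ∈ nhds p :=
          (isOpen_lt continuous_snd.norm continuous_const).mem_nhds h1
        obtain ⟨η, hη, hlt⟩ := exists_near_gt σ H.hs p.1 p.2 _ (Filter.inter_mem hN hN2)
        exact ⟨(p.1, η), hη.1, ⟨⟨le_of_lt hη.2, Or.inl (by linarith)⟩, le_of_lt hη.2, by linarith⟩, rfl⟩
      have c1 : Filter.Tendsto (extendFrom A f) (nhdsWithin p S) (nhds (extendFrom A f p)) :=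
        ((hgc p hp).mono fun q hq => hq.1.2)
      have c2 : Filter.Tendsto (fun _ : ℂ × ℂ => (0:ℂ)) (nhdsWithin p S) (nhds 0) :=
        tendsto_const_nhds
      refine tendsto_nhds_unique (c1.congr' ?_) c2
      filter_upwards [self_mem_nhdsWithin] with q hq
      rw [hgA q hq.1.1, hfout q]
      rw [show q.1 = p.1 from hq.2]; exact hz
  · intro p hp hR
    have hpA : p ∈ A := by
      by_contra h
      exact absurd hR (hRlt p hp h).1.ne
    rw [hgA p hpA]
    by_cases hz : p.1 ∈ ball c0 r0
    · have h1 : t < σ p := htm.trans_lt (H.t2 p.1 (ball_subset_closedBall hz) p.2 hR)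
      rw [hfs (σ p) h1 p ⟨hR.le, le_rfl⟩]
      exact (hΨ _ h1).2.2.2 p ⟨hR.le, le_rfl⟩ hR
    · rw [hfout p hz, ell_out H p hz]

lemma PP_zero (H : Cfg σ L L2 c0 r0 R0 R tm) : ∃ ψ, PP σ L L2 c0 r0 R 0 ψ := by
  set S : Set ℝ := {t | 0 ≤ t ∧ t ≤ tm ∧ ∃ ψ, PP σ L L2 c0 r0 R t ψ} with hS
  have hne : S.Nonempty := ⟨tm, H.tm0, le_rfl, PP_start H⟩
  have hbd : BddBelow S := ⟨0, fun t ht => ht.1⟩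
  set ts := sInf S with hts
  have h0 : 0 ≤ ts := le_csInf hne fun t ht => ht.1
  have htm : ts ≤ tm := csInf_le hbd ⟨H.tm0, le_rfl, PP_start H⟩
  have hcl := PP_closed H h0 htm (by
    intro s hs
    obtain ⟨t, ht, hlt⟩ := exists_lt_of_csInf_lt hne hs
    obtain ⟨ψ, hψ⟩ := ht.2.2
    exact ⟨ψ, PP_mono hlt.le hψ⟩)
  rcases h0.eq_or_lt with h | h
  · rw [← h] at hcl; exact hcl
  · obtain ⟨ψ, hψ⟩ := hcl
    obtain ⟨t', a, b, c⟩ := PP_open H h htm hψ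
    exact absurd (csInf_le hbd ⟨a, b.le.trans htm, c⟩) (not_le.2 b)
end
end
end

section
open Metric Set Polynomial
noncomputable section

lemma log_im_bd {w : ℂ} (h : 0 < w.re) : |(Complex.log w).im| < Real.pi / 2 := by
  rw [Complex.log_im]
  exact Complex.abs_arg_lt_pi_div_two_iff.2 (Or.inl h)

lemma vert {σ : ℂ × ℂ → ℝ} {L L2 : ℂ → ℂ} {c0 : ℂ} {r0 R0 R tm : ℝ}
    (H : Cfg σ L L2 c0 r0 R0 R tm) (z : ℂ) (x : ℝ)
    (him : (L z).im = (L2 z).im) (h1 : (L z).re < x) (h2 : x < (L2 z).re) :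
    ∃ ζ : ℂ, ζ.re = x ∧ ‖ζ‖ ≤ R ∧ σ (z, ζ) < 0 := by
  by_contra hcon
  push Not at hcon
  obtain ⟨ψ, hψ⟩ := PP_zero H
  set a := L z with ha
  set b := L2 z with hb
  have hR0 := H.R0p
  have hRR := H.RR
  have hx1 : |x| ≤ R0 := by
    have e1 := abs_le.1 ((Complex.abs_re_le_norm a).trans (H.b1 z))
    have e2 := abs_le.1 ((Complex.abs_re_le_norm b).trans (H.b2 z))
    exact abs_le.2 ⟨by linarith, by linarith⟩
  have ha1 : |a.im| ≤ R0 := (Complex.abs_im_le_norm a).trans (H.b1 z)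
  set Y := Real.sqrt (R ^ 2 - x ^ 2) with hY
  have hx2 : x ^ 2 ≤ R0 ^ 2 := by rw [← sq_abs]; gcongr
  have hYsq : Y ^ 2 = R ^ 2 - x ^ 2 := Real.sq_sqrt (by nlinarith)
  have hY0 : 0 ≤ Y := Real.sqrt_nonneg _
  have hYR : R0 < Y := by
    refine lt_of_pow_lt_pow_left₀ 2 hY0 ?_
    nlinarith
  have hnsq : ∀ y : ℝ, ‖(⟨x, y⟩ : ℂ)‖ ^ 2 = x ^ 2 + y ^ 2 := by
    intro y; rw [← Complex.normSq_eq_norm_sq, Complex.normSq_mk]; ring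
  have hle : ∀ y ∈ Icc (-Y) Y, ‖(⟨x, y⟩ : ℂ)‖ ≤ R := by
    intro y hy
    refine le_of_sq_le_sq ?_ (by linarith)
    rw [hnsq]
    have : y ^ 2 ≤ Y ^ 2 := by rw [← sq_abs]; gcongr; exact abs_le.2 hy
    linarith
  have heqR : ∀ y, y ^ 2 = Y ^ 2 → ‖(⟨x, y⟩ : ℂ)‖ = R := by
    intro y hy
    have : ‖(⟨x, y⟩ : ℂ)‖ ^ 2 = R ^ 2 := by rw [hnsq, hy, hYsq]; ring
    exact (pow_left_inj₀ (norm_nonneg _) (by linarith) two_ne_zero).1 this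
  have hK : ∀ y ∈ Icc (-Y) Y, ((z, ⟨x, y⟩) : ℂ × ℂ) ∈ KK σ R 0 := fun y hy =>
    ⟨hle y hy, hcon _ rfl (hle y hy)⟩
  have hline : Continuous (fun y : ℝ => (⟨x, y⟩ : ℂ)) := by
    have : (fun y : ℝ => (⟨x, y⟩ : ℂ)) = fun y : ℝ => (x : ℂ) + y * Complex.I := by
      funext y; exact mk_eq _ _
    rw [this]; fun_prop
  have s1 : ∀ y : ℝ, 0 < ((⟨x, y⟩ : ℂ) - a).re := fun y => by simp; exact h1
  have s2 : ∀ y : ℝ, 0 < (b - (⟨x, y⟩ : ℂ)).re := fun y => by simp; exact h2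
  set χ : ℝ → ℂ := fun y => ψ (z, ⟨x, y⟩) - Complex.log (⟨x, y⟩ - a) + Complex.log (b - ⟨x, y⟩) with hχ
  have hχc : ContinuousOn χ (Icc (-Y) Y) := by
    refine ContinuousOn.add (ContinuousOn.sub ?_ ?_) ?_
    · exact hψ.1.comp (by fun_prop) hK
    · exact ContinuousOn.clog (by fun_prop) fun y _ => Or.inl (s1 y)
    · exact ContinuousOn.clog (by fun_prop) fun y _ => Or.inl (s2 y)
  have hχe : ∀ y ∈ Icc (-Y) Y, Complex.exp (χ y) = -1 := by
    intro y hy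
    have e := hψ.2.1 _ (hK y hy)
    simp only [← ha, ← hb] at e
    have n1 : (⟨x, y⟩ : ℂ) - a ≠ 0 := fun h => by have := s1 y; rw [h] at this; simp at this
    have n2 : b - (⟨x, y⟩ : ℂ) ≠ 0 := fun h => by have := s2 y; rw [h] at this; simp at this
    simp only [hχ]
    rw [Complex.exp_add, Complex.exp_sub, Complex.exp_log n1, Complex.exp_log n2, ← e]
    have n2' : (⟨x, y⟩ : ℂ) - b ≠ 0 := by rwa [← neg_sub, neg_ne_zero]
    have hexp := Complex.exp_ne_zero (ψ (z, ⟨x, y⟩))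
    rw [← neg_sub (⟨x, y⟩ : ℂ) b]
    field_simp
  have hmT : Y ∈ Icc (-Y) Y := ⟨by linarith, le_rfl⟩
  have hmB : -Y ∈ Icc (-Y) Y := ⟨le_rfl, by linarith⟩
  have hconst := exp_const isPreconnected_Icc hχc hχe hmT hmB
  have hel : ∀ y : ℝ, y ^ 2 = Y ^ 2 → y ∈ Icc (-Y) Y → |(ψ (z, ⟨x, y⟩)).im| < Real.pi := by
    intro y hy hyI
    have hnR := heqR y hy
    rw [hψ.2.2.2 _ (hK y hyI) hnR, ell, Complex.sub_im]
    have hbig : R0 < ‖(⟨x, y⟩ : ℂ)‖ := by rw [hnR]; linarith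
    have hre : ∀ w : ℂ, ‖w‖ ≤ R0 → 0 < (1 - w / (⟨x, y⟩ : ℂ)).re := by
      intro w hw
      have : ‖w / (⟨x, y⟩ : ℂ)‖ < 1 := by rw [norm_div, div_lt_one (by linarith)]; linarith
      have h2 := (Complex.re_le_norm (w / (⟨x, y⟩ : ℂ)))
      rw [Complex.sub_re, Complex.one_re]; linarith
    have i1 := abs_lt.1 (log_im_bd (hre _ (H.b1 z)))
    have i2 := abs_lt.1 (log_im_bd (hre _ (H.b2 z)))
    exact abs_lt.2 ⟨by simp only; linarith, by simp only; linarith⟩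
  have hiy := abs_le.1 ha1
  have sgn : ∀ w : ℂ, 0 < w.im → 0 < (Complex.log w).im := by
    intro w hw; rw [Complex.log_im]
    refine lt_of_le_of_ne (Complex.arg_nonneg_iff.2 hw.le) fun h => ?_
    have := (Complex.arg_eq_zero_iff.1 h.symm).2; linarith
  have sgn' : ∀ w : ℂ, w.im < 0 → (Complex.log w).im < 0 := by
    intro w hw; rw [Complex.log_im]; exact Complex.arg_neg_iff.2 hw
  obtain ⟨n, hn⟩ := Complex.exp_eq_exp_iff_exists_int.1
    ((hχe Y hmT).trans Complex.exp_pi_mul_I.symm)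
  have hnim : (χ Y).im = Real.pi + n * (2 * Real.pi) := by
    rw [hn]; simp
  have pp := Real.pi_pos
  have T1 := abs_lt.1 (hel Y rfl hmT)
  have B1 := abs_lt.1 (hel (-Y) (by ring) hmB)
  have T2 := abs_lt.1 (log_im_bd (s1 Y))
  have T3 := abs_lt.1 (log_im_bd (s2 Y))
  have B2 := abs_lt.1 (log_im_bd (s1 (-Y)))
  have B3 := abs_lt.1 (log_im_bd (s2 (-Y)))
  have T4 := sgn (⟨x, Y⟩ - a) (by simp; linarith)
  have T5 := sgn' (b - ⟨x, Y⟩) (by simp; linarith)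
  have B4 := sgn' (⟨x, -Y⟩ - a) (by simp; linarith)
  have B5 := sgn (b - ⟨x, -Y⟩) (by simp; linarith)
  have e1 : (χ Y).im = (ψ (z, ⟨x, Y⟩)).im - (Complex.log (⟨x, Y⟩ - a)).im +
      (Complex.log (b - ⟨x, Y⟩)).im := by simp only [hχ, Complex.add_im, Complex.sub_im]
  have e2 : (χ Y).im = (ψ (z, ⟨x, -Y⟩)).im - (Complex.log (⟨x, -Y⟩ - a)).im +
      (Complex.log (b - ⟨x, -Y⟩)).im := by rw [hconst]; simp only [hχ, Complex.add_im, Complex.sub_im]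
  have u1 : (χ Y).im < Real.pi := by rw [e1]; linarith
  have u2 : -Real.pi < (χ Y).im := by rw [e2]; linarith
  rw [hnim] at u1 u2
  have v1 : (n : ℝ) < 0 := by
    by_contra h; push Not at h; nlinarith
  have v2 : (-1 : ℝ) < n := by
    by_contra h; push Not at h; nlinarith
  have w1 : n < 0 := by exact_mod_cast v1
  have w2 : -1 < n := by exact_mod_cast v2
  omega
end
end

section
open Metric Set Polynomial
noncomputable section

lemma sum_log_fact (n : ℕ) (hn : 0 < n) :
    ∑ k ∈ Finset.Icc 1 n, Real.log ((n : ℝ) / k) ≤ n := by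
  have h1 : ∏ k ∈ Finset.Icc 1 n, ((n : ℝ) / k) = (n : ℝ) ^ n / (n.factorial : ℝ) := by
    have h0 : ∀ m : ℕ, ∏ k ∈ Finset.Icc 1 m, (k : ℝ) = (m.factorial : ℝ) := by
      intro m
      induction m with
      | zero => simp
      | succ m ih =>
        rw [Finset.prod_Icc_succ_top (by omega), ih, Nat.factorial_succ]
        push_cast; ring
    rw [Finset.prod_div_distrib, Finset.prod_const, Nat.card_Icc, h0]
    simp
  have hn' : (0:ℝ) < n := by exact_mod_cast hn
  rw [← Real.log_prod, h1]
  · rw [Real.log_le_iff_le_exp (by positivity)]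
    exact Real.pow_div_factorial_le_exp _ hn'.le _
  · intro k hk
    have : 0 < k := (Finset.mem_Icc.1 hk).1
    positivity

lemma sum_log_dist (n i : ℕ) (hi : i < n) :
    ∑ j ∈ (Finset.range n).erase i, Real.log ((n : ℝ) / |(i : ℝ) - j|) ≤ 2 * n := by
  have hn : 0 < n := by omega
  set φ : ℕ → ℝ := fun k => Real.log ((n : ℝ) / k) with hφ
  have hφ0 : ∀ k ∈ Finset.Icc 1 n, 0 ≤ φ k := by
    intro k hk
    obtain ⟨h1, h2⟩ := Finset.mem_Icc.1 hk
    refine Real.log_nonneg ?_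
    rw [le_div_iff₀ (by exact_mod_cast h1)]
    rw [one_mul]; exact_mod_cast h2
  have hsplit : (Finset.range n).erase i = Finset.range i ∪ Finset.Ioo i n := by
    ext j; simp only [Finset.mem_erase, Finset.mem_range, Finset.mem_union, Finset.mem_Ioo]; omega
  have hdisj : Disjoint (Finset.range i) (Finset.Ioo i n) := by
    rw [Finset.disjoint_left]; intro j; simp only [Finset.mem_range, Finset.mem_Ioo]; omega
  rw [hsplit, Finset.sum_union hdisj]
  have a1 : ∑ j ∈ Finset.range i, Real.log ((n : ℝ) / |(i : ℝ) - j|) ≤ n := by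
    calc ∑ j ∈ Finset.range i, Real.log ((n : ℝ) / |(i : ℝ) - j|)
        = ∑ j ∈ Finset.range i, φ (i - j) := by
          refine Finset.sum_congr rfl fun j hj => ?_
          have : j < i := Finset.mem_range.1 hj
          simp only [hφ]
          rw [Nat.cast_sub this.le, abs_of_nonneg]
          have : (j:ℝ) < i := by exact_mod_cast this
          linarith
      _ = ∑ k ∈ (Finset.range i).image (fun j => i - j), φ k := by
          rw [Finset.sum_image]
          intro a ha b hb hab
          simp only [Finset.coe_range, mem_Iio] at ha hb
          simp only at hab; omega
      _ ≤ ∑ k ∈ Finset.Icc 1 n, φ k := by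
          refine Finset.sum_le_sum_of_subset_of_nonneg ?_ fun k hk _ => hφ0 k hk
          intro k hk
          obtain ⟨j, hj, rfl⟩ := Finset.mem_image.1 hk
          have := Finset.mem_range.1 hj
          rw [Finset.mem_Icc]; omega
      _ ≤ n := sum_log_fact n hn
  have a2 : ∑ j ∈ Finset.Ioo i n, Real.log ((n : ℝ) / |(i : ℝ) - j|) ≤ n := by
    calc ∑ j ∈ Finset.Ioo i n, Real.log ((n : ℝ) / |(i : ℝ) - j|)
        = ∑ j ∈ Finset.Ioo i n, φ (j - i) := by
          refine Finset.sum_congr rfl fun j hj => ?_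
          have : i < j := (Finset.mem_Ioo.1 hj).1
          simp only [hφ]
          rw [Nat.cast_sub this.le, abs_sub_comm, abs_of_nonneg]
          have : (i:ℝ) < j := by exact_mod_cast this
          linarith
      _ = ∑ k ∈ (Finset.Ioo i n).image (fun j => j - i), φ k := by
          rw [Finset.sum_image]
          intro a ha b hb hab
          simp only [Finset.coe_Ioo, mem_Ioo] at ha hb
          simp only at hab; omega
      _ ≤ ∑ k ∈ Finset.Icc 1 n, φ k := by
          refine Finset.sum_le_sum_of_subset_of_nonneg ?_ fun k hk _ => hφ0 k hk
          intro k hk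
          obtain ⟨j, hj, rfl⟩ := Finset.mem_image.1 hk
          have := Finset.mem_Ioo.1 hj
          rw [Finset.mem_Icc]; omega
      _ ≤ n := sum_log_fact n hn
  linarith

/-- discrete potential -/
def Vn (n : ℕ) (e : ℕ → ℂ) (M : ℝ) (ζ : ℂ) : ℝ :=
  (1 / (n : ℝ)) * ∑ j ∈ Finset.range n, (Real.log M - Real.log ‖ζ - e j‖)

lemma Vn_bound (n : ℕ) (e : ℕ → ℂ) (M d α0 : ℝ) (hM : 0 < M) (hd : 0 < d)
    (he : ∀ j, (e j).re = α0 + d * (j + 1 / 2) / n) (i : ℕ) (hi : i < n) (ζ : ℂ)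
    (hζ : ‖ζ - e i‖ = d / (4 * n)) :
    Vn n e M ζ ≤ |Real.log (4 * M / d)| + 3 := by
  have hn : (0:ℝ) < n := by exact_mod_cast (by omega : 0 < n)
  have hn1 : (1:ℝ) ≤ n := by exact_mod_cast (by omega : 1 ≤ n)
  set Λ := |Real.log (4 * M / d)| with hΛ
  have hterm : ∀ j ∈ (Finset.range n).erase i, Real.log M - Real.log ‖ζ - e j‖ ≤
      Λ + Real.log ((n : ℝ) / |(i : ℝ) - j|) := by
    intro j hj
    have hji : j ≠ i := (Finset.mem_erase.1 hj).1
    have hk : 1 ≤ |(i : ℝ) - j| := by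
      have : (1:ℤ) ≤ |(i : ℤ) - j| := Int.one_le_abs (by omega)
      exact_mod_cast this
    set k := |(i : ℝ) - j| with hkd
    have hlow : k * d / (2 * n) ≤ ‖ζ - e j‖ := by
      have h1 := Complex.abs_re_le_norm (ζ - e j)
      have h2 := Complex.abs_re_le_norm (ζ - e i)
      rw [hζ] at h2
      have h3 : (e i).re - (e j).re = d / n * ((i:ℝ) - j) := by rw [he, he]; ring
      have h4 : |(e i).re - (e j).re| = d / n * k := by
        rw [h3, abs_mul, abs_of_pos (by positivity)]
      have h5 : |(e i).re - (e j).re| ≤ |(ζ - e j).re| + |(ζ - e i).re| := by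
        have : (e i).re - (e j).re = (ζ - e j).re - (ζ - e i).re := by simp
        rw [this]; exact abs_sub _ _
      have h6 : d / (4 * n) ≤ d / n * k / 4 := by
        have : d / (4 * n) = d / n * 1 / 4 := by field_simp
        rw [this]; gcongr
      have h7 : k * d / (2 * n) = d / n * k / 2 := by field_simp
      have h8 : 0 ≤ d / n * k := by positivity
      rw [h7]; linarith
    have hpos : 0 < k * d / (2 * n) := by positivity
    have h1 : Real.log (k * d / (2 * n)) ≤ Real.log ‖ζ - e j‖ := Real.log_le_log hpos hlow
    have h2 : Real.log M - Real.log (k * d / (2 * n)) = Real.log (2 * M / d) + Real.log (n / k) := by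
      rw [← Real.log_div hM.ne' hpos.ne', ← Real.log_mul (by positivity) (by positivity)]
      congr 1; field_simp
    have h3 : Real.log (2 * M / d) ≤ Λ := by
      refine le_trans (Real.log_le_log (by positivity) ?_) (le_abs_self _)
      gcongr; norm_num
    linarith
  have hi' : Real.log M - Real.log ‖ζ - e i‖ ≤ Λ + n := by
    rw [hζ]
    have h2 : Real.log M - Real.log (d / (4 * n)) = Real.log (4 * M / d) + Real.log n := by
      rw [← Real.log_div hM.ne' (by positivity), ← Real.log_mul (by positivity) (by positivity)]
      congr 1; field_simp
    have h3 : Real.log n ≤ n := (Real.log_le_sub_one_of_pos hn).trans (by linarith)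
    have h4 := le_abs_self (Real.log (4 * M / d))
    linarith
  have hsum : ∑ j ∈ Finset.range n, (Real.log M - Real.log ‖ζ - e j‖) ≤ n * (Λ + 3) := by
    rw [← Finset.add_sum_erase _ _ (Finset.mem_range.2 hi)]
    have h1 := Finset.sum_le_sum hterm
    rw [Finset.sum_add_distrib, Finset.sum_const, Finset.card_erase_of_mem (Finset.mem_range.2 hi),
      Finset.card_range, nsmul_eq_mul, Nat.cast_sub (by omega)] at h1
    have h2 := sum_log_dist n i hi
    push_cast at h1
    linarith
  rw [Vn, one_div, inv_mul_le_iff₀ hn]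
  exact hsum

lemma pot (R d α0 : ℝ) (hR : 0 < R) (hd : 0 < d) (ζ0 : ℂ) (g : ℂ → ℝ) (hg : Continuous g)
    (hgL : ∀ ζ, LTay g ζ) (M1 N : ℝ) (hMN : 1 ≤ M1 + N)
    (hM1 : ∀ ζ, ‖ζ‖ ≤ 2 * R + ‖ζ0‖ + 1 → g ζ ≤ M1)
    (hx : ∀ x, α0 < x → x < α0 + d → ∃ e : ℂ, e.re = x ∧ ‖e‖ ≤ R ∧ g e < -N) :
    g ζ0 ≤ -N + 1 ∨ g ζ0 ≤ M1 - (M1 + N - 1) *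
      (Real.log ((R + ‖ζ0‖ + 1) / (R + ‖ζ0‖)) / (|Real.log (4 * (R + ‖ζ0‖ + 1) / d)| + 3)) := by
  set M := R + ‖ζ0‖ + 1 with hM
  have hz0 := norm_nonneg ζ0
  have hMp : 0 < M := by rw [hM]; positivity
  set ϱ := 2 * R + ‖ζ0‖ + 1 with hϱ
  set C := |Real.log (4 * M / d)| + 3 with hC
  have hCp : 0 < C := by positivity
  -- uniform continuity
  have huc := (isCompact_closedBall (0:ℂ) (R + 1)).uniformContinuousOn_of_continuous hg.continuousOn
  obtain ⟨η0, hη0, hu⟩ := Metric.uniformContinuousOn_iff.1 huc 1 one_pos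
  obtain ⟨n, hn⟩ := exists_nat_gt (max (d / (4 * η0)) (d / 4))
  have hnn : (0:ℝ) < n := lt_of_le_of_lt (le_max_of_le_right (by positivity)) hn
  have hn0 : 0 < n := by exact_mod_cast hnn
  set η := d / (4 * n) with hη
  have hηp : 0 < η := by positivity
  have hη1 : η < η0 := by
    have := (le_max_left _ _).trans_lt hn
    rw [div_lt_iff₀ (by positivity)] at this
    rw [hη, div_lt_iff₀ (by positivity)]; linarith
  have hη2 : η < 1 := by
    have := (le_max_right _ _).trans_lt hn
    rw [hη, div_lt_one (by positivity)]; linarith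
  have hex : ∀ j : ℕ, ∃ e : ℂ, e.re = α0 + d * (j + 1 / 2) / n ∧ (j < n → ‖e‖ ≤ R ∧ g e < -N) := by
    intro j
    by_cases hj : j < n
    · have hj' : (j:ℝ) + 1 ≤ n := by exact_mod_cast hj
      have h1 : 0 < d * (j + 1 / 2) / n := by positivity
      have h2 : d * (j + 1 / 2) / n < d := by
        rw [div_lt_iff₀ hnn]; nlinarith
      obtain ⟨e, a, b, c⟩ := hx (α0 + d * (j + 1 / 2) / n) (by linarith) (by linarith)
      exact ⟨e, a, fun _ => ⟨b, c⟩⟩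
    · exact ⟨((α0 + d * (j + 1 / 2) / n : ℝ) : ℂ), by rw [Complex.ofReal_re], fun h => (hj h).elim⟩
  choose e he1 he2 using hex
  have hclose : ∀ j < n, ∀ ζ, ‖ζ - e j‖ ≤ η → g ζ ≤ -N + 1 := by
    intro j hj ζ hζ
    have h1 := he2 j hj
    have h2 : ‖ζ‖ ≤ R + 1 := by
      have := norm_sub_norm_le ζ (e j); linarith [h1.1]
    have := hu ζ (by simpa using h2) (e j) (by simp; linarith [h1.1])
      (by rw [dist_eq_norm]; linarith)
    rw [Real.dist_eq] at this
    have := (abs_lt.1 this).2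
    linarith [h1.2]
  by_cases hin : ∃ j < n, ‖ζ0 - e j‖ ≤ η
  · obtain ⟨j, hj, hj2⟩ := hin
    exact Or.inl (hclose j hj ζ0 hj2)
  right
  push Not at hin
  set κ := (M1 + N - 1) / C with hκ
  have hκ0 : 0 ≤ κ := div_nonneg (by linarith) hCp.le
  set V := Vn n e M with hV
  have hV0 : Real.log (M / (R + ‖ζ0‖)) ≤ V ζ0 := by
    simp only [hV, Vn]
    rw [one_div, le_inv_mul_iff₀ hnn]
    have : ∀ j ∈ Finset.range n, Real.log (M / (R + ‖ζ0‖)) ≤ Real.log M - Real.log ‖ζ0 - e j‖ := by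
      intro j hj
      rw [Real.log_div hMp.ne' (by positivity)]
      have h1 := hin j (Finset.mem_range.1 hj)
      have h2 : ‖ζ0 - e j‖ ≤ R + ‖ζ0‖ := by
        have := norm_sub_le ζ0 (e j)
        linarith [(he2 j (Finset.mem_range.1 hj)).1]
      have := Real.log_le_log (by linarith) h2
      linarith
    have h3 := Finset.sum_le_sum this
    simpa using h3
  set Ω : Set ℂ := closedBall 0 ϱ ∩ ⋂ j ∈ Finset.range n, {ζ | η ≤ ‖ζ - e j‖} with hΩ
  have hΩc : IsCompact Ω := by
    refine (isCompact_closedBall _ _).inter_right ?_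
    refine isClosed_biInter fun j _ => isClosed_le continuous_const (by fun_prop)
  have hmem : ∀ ζ, ζ ∈ Ω ↔ ‖ζ‖ ≤ ϱ ∧ ∀ j < n, η ≤ ‖ζ - e j‖ := by
    intro ζ; simp [hΩ]
  have hVc : ContinuousOn V Ω := by
    simp only [hV]
    unfold Vn
    refine continuousOn_const.mul (continuousOn_finsetSum _ fun j hj => ?_)
    refine continuousOn_const.sub (ContinuousOn.log (by fun_prop) ?_)
    intro ζ hζ
    have := ((hmem ζ).1 hζ).2 j (Finset.mem_range.1 hj)
    linarith
  have key : g ζ0 + κ * V ζ0 ≤ M1 := by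
    by_contra hcon
    push Not at hcon
    set gap := g ζ0 + κ * V ζ0 - M1 with hgap
    have hgp : 0 < gap := by rw [hgap]; linarith
    have hϱp : 0 < ϱ := by rw [hϱ]; positivity
    set δ := gap / (2 * ϱ ^ 2) with hδ
    have hδp : 0 < δ := by positivity
    have hδϱ : δ * ϱ ^ 2 = gap / 2 := by rw [hδ]; field_simp
    have hζ0 : ζ0 ∈ Ω := (hmem ζ0).2 ⟨by rw [hϱ]; linarith, fun j hj => (hin j hj).le⟩
    obtain ⟨m, hm, hmax⟩ := hΩc.exists_isMaxOn ⟨ζ0, hζ0⟩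
      (f := fun ζ => (g ζ + κ * V ζ) + δ * ‖ζ‖ ^ 2)
      ((hg.continuousOn.add (continuousOn_const.mul hVc)).add (by fun_prop))
    have hm' := (hmem m).1 hm
    have hbig : M1 + gap ≤ (g m + κ * V m) + δ * ‖m‖ ^ 2 := by
      have h1 : (g ζ0 + κ * V ζ0) + δ * ‖ζ0‖ ^ 2 ≤ _ := hmax hζ0
      have h2 : 0 ≤ δ * ‖ζ0‖ ^ 2 := by positivity
      linarith
    have hδm : δ * ‖m‖ ^ 2 ≤ gap / 2 := by
      rw [← hδϱ]; gcongr; exact hm'.1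
    have hnb : M1 < g m + κ * V m := by linarith
    have hm1 : ‖m‖ < ϱ := by
      refine lt_of_le_of_ne hm'.1 fun h => ?_
      have h1 := hM1 m h.le
      have h2 : V m ≤ 0 := by
        simp only [hV, Vn]
        refine mul_nonpos_of_nonneg_of_nonpos (by positivity) (Finset.sum_nonpos fun j hj => ?_)
        have h3 : M ≤ ‖m - e j‖ := by
          have := norm_sub_norm_le m (e j)
          have := (he2 j (Finset.mem_range.1 hj)).1
          rw [hM]; rw [h, hϱ] at *; linarith
        have := Real.log_le_log hMp h3
        linarith
      nlinarith
    have hm2 : ∀ j < n, η < ‖m - e j‖ := by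
      intro j hj
      refine lt_of_le_of_ne (hm'.2 j hj) fun h => ?_
      have h1 := hclose j hj m h.symm.le
      have h2 : V m ≤ C := Vn_bound n e M d α0 hMp hd he1 j hj m h.symm
      have h3 : κ * V m ≤ M1 + N - 1 := by
        calc κ * V m ≤ κ * C := by gcongr
          _ = _ := by rw [hκ]; field_simp
      linarith
    have hne : ∀ j < n, m - e j ≠ 0 := fun j hj h => by
      have := hm2 j hj; rw [h, norm_zero] at this; linarith
    set G : ℂ → ℂ := fun ζ => ((κ * (1 / (n:ℝ)) : ℝ) : ℂ) * ∑ j ∈ Finset.range n,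
      (((Real.log M - Real.log ‖m - e j‖ : ℝ) : ℂ) - Complex.log ((ζ - e j) / (m - e j))) with hG
    have hGa : AnalyticAt ℂ G m := by
      refine analyticAt_const.mul ?_
      refine Finset.analyticAt_fun_sum _ fun j hj => analyticAt_const.sub ?_
      have hj' := hne j (Finset.mem_range.1 hj)
      refine AnalyticAt.clog ?_ ?_
      · exact (analyticAt_id.sub analyticAt_const).div analyticAt_const hj'
      · show (m - e j) / (m - e j) ∈ _
        rw [div_self hj']; exact Complex.one_mem_slitPlane
    have hopen : ∀ᶠ ζ : ℂ in nhds m, ‖ζ‖ < ϱ ∧ ∀ j < n, η < ‖ζ - e j‖ := by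
      refine (continuous_norm.continuousAt.eventually (gt_mem_nhds hm1)).and ?_
      have : ∀ᶠ ζ : ℂ in nhds m, ∀ j ∈ Finset.range n, η < ‖ζ - e j‖ := by
        rw [Filter.eventually_all_finset]
        intro j hj
        have hc : Continuous (fun ζ : ℂ => ‖ζ - e j‖) := by fun_prop
        exact hc.continuousAt.eventually (lt_mem_nhds (hm2 j (Finset.mem_range.1 hj)))
      filter_upwards [this] with ζ h j hj using h j (Finset.mem_range.2 hj)
    have hVG : ∀ ζ : ℂ, (∀ j < n, η < ‖ζ - e j‖) → κ * V ζ = (G ζ).re := by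
      intro ζ hζ
      simp only [hG, hV, Vn]
      rw [Complex.re_ofReal_mul, Complex.re_sum, mul_assoc]
      congr 2
      refine Finset.sum_congr rfl fun j hj => ?_
      have h1 := hne j (Finset.mem_range.1 hj)
      have h2 := hζ j (Finset.mem_range.1 hj)
      rw [Complex.sub_re, Complex.log_re, Complex.ofReal_re, norm_div,
        Real.log_div (by linarith) (norm_ne_zero_iff.2 h1)]
      ring
    have hLT : LTay (fun ζ => g ζ + (G ζ).re) m := LTay_add (hgL m) (LTay_re hGa)
    refine LTay_nomax hLT hδp ?_
    filter_upwards [hopen] with ζ hζ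
    have h1 : (g ζ + κ * V ζ) + δ * ‖ζ‖ ^ 2 ≤ (g m + κ * V m) + δ * ‖m‖ ^ 2 :=
      hmax ((hmem ζ).2 ⟨hζ.1.le, fun j hj => (hζ.2 j hj).le⟩)
    rw [hVG ζ hζ.2, hVG m hm2] at h1
    exact h1
  have h5 : κ * Real.log (M / (R + ‖ζ0‖)) ≤ κ * V ζ0 := by gcongr
  have h6 : (M1 + N - 1) * (Real.log (M / (R + ‖ζ0‖)) / C) = κ * Real.log (M / (R + ‖ζ0‖)) := by
    rw [hκ]; ring
  rw [h6]; linarith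
end
end

section
open Metric Set Polynomial
noncomputable section

def Th (m p : ℂ[X]) (x : ℂ × ℂ) : ℂ × ℂ := (x.1, m.eval x.1 * (x.2 + p.eval x.1))

lemma poly_an (m : ℂ[X]) (x : ℂ × ℂ) : AnalyticAt ℂ (fun x : ℂ × ℂ => m.eval x.1) x := by
  have h1 : AnalyticAt ℂ (fun z : ℂ => m.eval z) x.1 :=
    m.differentiable.analyticAt _
  exact h1.comp analyticAt_fst

lemma Th_an (m p : ℂ[X]) (x : ℂ × ℂ) : AnalyticAt ℂ (Th m p) x :=
  analyticAt_fst.prod ((poly_an m x).mul (analyticAt_snd.add (poly_an p x)))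

lemma Th_cd (m p : ℂ[X]) : ContDiff ℝ 2 (Th m p) := by
  have : ContDiff ℂ 2 (Th m p) := contDiff_iff_contDiffAt.2 fun x => (Th_an m p x).contDiffAt
  exact this.restrict_scalars ℝ

/-- retraction onto a closed disc -/
def retr (c : ℂ) (r : ℝ) (z : ℂ) : ℂ := c + ((r / max r ‖z - c‖ : ℝ) : ℂ) * (z - c)

lemma retr_cont (c : ℂ) (r : ℝ) (hr : 0 < r) : Continuous (retr c r) := by
  unfold retr
  have h : ∀ z : ℂ, max r ‖z - c‖ ≠ 0 := fun z => (lt_max_of_lt_left hr).ne'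
  have : Continuous fun z : ℂ => r / max r ‖z - c‖ :=
    continuous_const.div (by fun_prop) h
  fun_prop

lemma retr_mem (c : ℂ) (r : ℝ) (hr : 0 < r) (z : ℂ) : retr c r z ∈ closedBall c r := by
  have h : 0 < max r ‖z - c‖ := lt_max_of_lt_left hr
  rw [mem_closedBall, dist_eq_norm, retr, add_sub_cancel_left, norm_mul, Complex.norm_real,
    Real.norm_of_nonneg (by positivity), div_mul_eq_mul_div, div_le_iff₀ h]
  gcongr
  exact le_max_right _ _

lemma retr_id (c : ℂ) (r : ℝ) (hr : 0 < r) (z : ℂ) (hz : z ∈ closedBall c r) : retr c r z = z := by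
  have : ‖z - c‖ ≤ r := by rwa [← dist_eq_norm]
  rw [retr, max_eq_left this, div_self hr.ne']; simp

lemma retr_out (c : ℂ) (r : ℝ) (hr : 0 < r) (z : ℂ) (hz : z ∉ ball c r) :
    retr c r z ∈ sphere c r := by
  have h : r ≤ ‖z - c‖ := by rw [← dist_eq_norm]; exact not_lt.1 hz
  have h' : 0 < ‖z - c‖ := hr.trans_le h
  rw [mem_sphere, dist_eq_norm, retr, add_sub_cancel_left, norm_mul, Complex.norm_real,
    Real.norm_of_nonneg (by positivity), max_eq_right h]
  field_simp

/-- The family of strictly psh functions. -/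
def sig (v : ℂ × ℂ → ℝ) (A s1 N R0 : ℝ) (k : ℕ) (x : ℂ × ℂ) : ℝ :=
  ((v x + ((A * s1 + N : ℝ) - A * x.2 : ℂ).re) + ‖(x.2 / R0) ^ k‖ ^ 2) + (‖x.1‖ ^ 2 + ‖x.2‖ ^ 2)

lemma sig_strict (v : ℂ × ℂ → ℝ) (hv : ∀ p, LTay v p) (A s1 N R0 : ℝ) (k : ℕ) :
    StrictL (sig v A s1 N R0 k) := by
  refine strict_of_LTay (v := fun x => (v x + ((A * s1 + N : ℝ) - A * x.2 : ℂ).re) + ‖(x.2 / R0) ^ k‖ ^ 2) ?_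
  intro p
  refine LTay_add (LTay_add (hv p) (LTay_re ?_)) (LTay_normSq ?_)
  · exact analyticAt_const.sub (analyticAt_const.mul analyticAt_snd)
  · have : (fun x : ℂ × ℂ => (x.2 / R0) ^ k) = fun x : ℂ × ℂ => (x.2 * (R0:ℂ)⁻¹) ^ k := by
      funext x; rw [div_eq_mul_inv]
    rw [this]
    exact (analyticAt_snd.mul analyticAt_const).pow k

lemma sig_cd (v : ℂ × ℂ → ℝ) (hv : ContDiff ℝ 2 v) (A s1 N R0 : ℝ) (k : ℕ) :
    ContDiff ℝ 2 (sig v A s1 N R0 k) := by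
  unfold sig
  have hre : ContDiff ℝ 2 Complex.re := Complex.reCLM.contDiff
  have h1 : ContDiff ℝ 2 (fun x : ℂ × ℂ => x.1) := contDiff_fst
  have h2 : ContDiff ℝ 2 (fun x : ℂ × ℂ => x.2) := contDiff_snd
  have h3 : ContDiff ℝ 2 (fun x : ℂ × ℂ => (x.2 / R0) ^ k) := by
    have : (fun x : ℂ × ℂ => (x.2 / R0) ^ k) = fun x : ℂ × ℂ => (x.2 * (R0:ℂ)⁻¹) ^ k := by
      funext x; rw [div_eq_mul_inv]
    rw [this]
    exact (h2.mul contDiff_const).pow k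
  refine ((hv.add ?_).add (h3.norm_sq ℝ)).add ((h1.norm_sq ℝ).add (h2.norm_sq ℝ))
  exact hre.comp (contDiff_const.sub (contDiff_const.mul h2))

lemma sig_eq (v : ℂ × ℂ → ℝ) (A s1 N R0 : ℝ) (k : ℕ) (x : ℂ × ℂ) :
    sig v A s1 N R0 k x = v x + A * (s1 - x.2.re) + N + (‖x.2‖ / |R0|) ^ (2 * k) +
      ‖x.1‖ ^ 2 + ‖x.2‖ ^ 2 := by
  unfold sig
  rw [norm_pow, norm_div, Complex.norm_real, Real.norm_eq_abs, ← pow_mul, mul_comm k 2,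
    Complex.sub_re, Complex.ofReal_re, Complex.re_ofReal_mul]
  ring
end
end

section
open Metric Set Polynomial
noncomputable section

lemma keyN {u : (Fin 2 → ℂ) → EReal} (hu : Plurisubharmonic u) {L0 : ℂ → ℂ} {m p : ℂ[X]} {c : ℂ} {r : ℝ}
    (hr : 0 < r) (hc1 : closedBall c r ⊆ ball 0 1) (hL0 : ContinuousOn L0 (closedBall c r))
    (hbot : ∀ z ∈ closedBall c r, u ![(Th m p (z, L0 z)).1, (Th m p (z, L0 z)).2] = ⊥)
    {s : ℝ} (hs : ∀ z ∈ sphere c r, s ≤ (L0 z).re) {z0 : ℂ} (hz0 : z0 ∈ ball c r)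
    (hz0s : (L0 z0).re < s) (ζ0 : ℂ) {B R0 R M0 : ℝ} (hB : ∀ z ∈ closedBall c r, ‖L0 z‖ ≤ B)
    (hB0 : 0 ≤ B) (hR0 : R0 = 2 * B + |s| + 1) (hR : R = 2 * R0) (hM00 : 0 ≤ M0)
    (hM0 : ∀ z ∈ closedBall c r, ∀ ζ, ‖ζ‖ ≤ 2 * R + ‖ζ0‖ + 1 → ∀ q, dist q (Th m p (z, ζ)) < 1 →
      u ![q.1, q.2] ≤ (M0 : EReal)) {d : ℝ} (hd : d = (s - (L0 z0).re) / 2) {N : ℝ} (hN : 1 ≤ N) :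
    u ![(Th m p (z0, ζ0)).1, (Th m p (z0, ζ0)).2] ≤
      ((max (-N + 1) (M0-(M0+N-1)*(Real.log ((R+‖ζ0‖+1)/(R+‖ζ0‖))/(|Real.log (4*(R+‖ζ0‖+1)/d)|+3))) : ℝ) : EReal) := by
  have hR0p : 0 < R0 := by rw [hR0]; positivity
  set s1 : ℝ := ((L0 z0).re + s) / 2 with hs1
  have hss : 0 < s - s1 := by rw [hs1]; linarith
  set A : ℝ := (M0 + N + R0 ^ 2 + 3) / (s - s1) with hA
  have hA0 : 0 ≤ A := by rw [hA]; positivity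
  have hAs : A * (s1 - s) = -(M0 + N + R0 ^ 2 + 3) := by
    rw [hA]; field_simp; ring
  set N0 : ℝ := A * (|s1| + R0) + N + R0 ^ 2 + 4 with hN0
  have hN00 : 0 ≤ N0 := by rw [hN0]; positivity
  have hnt := hu.2.1
  -- neighbourhood
  have hThc : Continuous (Th m p) := (Th_cd m p).continuous
  have hG : IsCompact ((fun z => Th m p (z, L0 z)) '' closedBall c r) :=
    (isCompact_closedBall c r).image_of_continuousOn
      (hThc.comp_continuousOn (continuousOn_id.prodMk hL0))
  have hO : IsOpen {q : ℂ × ℂ | cut u N0 q < -N0 + 1} :=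
    upperSemicontinuous_iff_isOpen_preimage.1 (cut_usc hu N0) (-N0 + 1)
  have hGO : (fun z => Th m p (z, L0 z)) '' closedBall c r ⊆ {q : ℂ × ℂ | cut u N0 q < -N0 + 1} := by
    rintro _ ⟨z, hz, rfl⟩
    have : cut u N0 (Th m p (z, L0 z)) ≤ -N0 :=
      cut_le_of_le hnt le_rfl (by rw [hbot z hz]; exact bot_le)
    show cut u N0 (Th m p (z, L0 z)) < -N0 + 1
    linarith
  obtain ⟨δ, hδ, hδG⟩ := hG.exists_thickening_subset_open hO hGO
  obtain ⟨w, hw2, hwP, hwge, hwle⟩ := smooth_psh (cut_psh hu N0) (min δ 1) (lt_min hδ one_pos)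
  set v : ℂ × ℂ → ℝ := fun x => w (Th m p x) with hv
  have hv2 : ContDiff ℝ 2 v := hw2.comp (Th_cd m p)
  have hvL : ∀ x, LTay v x := fun x => LTay_comp (Th_an m p x) (LTay_of_psh w hw2 hwP _)
  have hvlb : ∀ x, -N0 ≤ v x := fun x => hwP.lb _
  have hvG : ∀ z ∈ closedBall c r, v (z, L0 z) ≤ -N0 + 1 := by
    intro z hz
    refine hwle _ _ fun q hq => ?_
    have : q ∈ thickening δ ((fun z => Th m p (z, L0 z)) '' closedBall c r) :=
      mem_thickening_iff.2 ⟨_, mem_image_of_mem _ hz, hq.trans_le (min_le_left _ _)⟩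
    exact (show cut u N0 q < -N0 + 1 from hδG this).le
  have hvM : ∀ z ∈ closedBall c r, ∀ ζ, ‖ζ‖ ≤ 2 * R + ‖ζ0‖ + 1 → v (z, ζ) ≤ M0 := by
    intro z hz ζ hζ
    refine hwle _ _ fun q hq => ?_
    exact cut_le_of_le hnt (by linarith) (hM0 z hz ζ hζ q (hq.trans_le (min_le_right _ _)))
  have hn1 : ∀ z ∈ closedBall c r, ‖z‖ ^ 2 ≤ 1 := by
    intro z hz
    have : ‖z‖ < 1 := by simpa using hc1 hz
    nlinarith [norm_nonneg z]
  set tm : ℝ := M0 + A * (|s1| + R0) + N + R0 ^ 2 + 3 with htm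
  obtain ⟨k, hk⟩ := pow_unbounded_of_one_lt (tm + N0 + A * (|s1| + R)) (by norm_num : (1:ℝ) < 4)
  set σ := sig v A s1 N R0 k with hσ
  have habs : |R0| = R0 := abs_of_pos hR0p
  have hrat : ∀ ζ : ℂ, ‖ζ‖ ≤ R0 → (‖ζ‖ / |R0|) ^ (2 * k) ≤ 1 := by
    intro ζ hζ
    rw [habs]
    exact pow_le_one₀ (by positivity) ((div_le_one hR0p).2 hζ)
  have hAre : ∀ ζ : ℂ, ‖ζ‖ ≤ R0 → A * (s1 - ζ.re) ≤ A * (|s1| + R0) := by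
    intro ζ hζ
    gcongr
    have := (abs_le.1 (Complex.abs_re_le_norm ζ)).1
    linarith [le_abs_self s1]
  have hsq : ∀ ζ : ℂ, ‖ζ‖ ≤ R0 → ‖ζ‖ ^ 2 ≤ R0 ^ 2 := fun ζ h => by gcongr
  set L : ℂ → ℂ := fun z => L0 (retr c r z) with hL
  set L2 : ℂ → ℂ := fun z => L z + ((max (s - (L z).re) 0 : ℝ) : ℂ) with hL2
  have hLc : Continuous L := hL0.comp_continuous (retr_cont c r hr) (retr_mem c r hr)
  have hLb : ∀ z, ‖L z‖ ≤ B := fun z => hB _ (retr_mem c r hr z)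
  have hBR : B ≤ R0 := by rw [hR0]; linarith [abs_nonneg s]
  have hL2re : ∀ z, (L2 z).re = max s (L z).re := by
    intro z
    simp only [hL2, Complex.add_re, Complex.ofReal_re]
    rcases le_total s (L z).re with h | h
    · rw [max_eq_right (by linarith), max_eq_right h, add_zero]
    · rw [max_eq_left (by linarith), max_eq_left h]; ring
  have hL2b : ∀ z, ‖L2 z‖ ≤ R0 := by
    intro z
    have h1 : |max (s - (L z).re) 0| ≤ |s| + B := by
      rw [abs_of_nonneg (le_max_right _ _)]
      refine max_le ?_ (by positivity)
      have := (abs_le.1 (Complex.abs_re_le_norm (L z))).1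
      linarith [le_abs_self s, hLb z]
    calc ‖L2 z‖ ≤ ‖L z‖ + |max (s - (L z).re) 0| := by
          refine (norm_add_le _ _).trans_eq ?_
          rw [Complex.norm_real, Real.norm_eq_abs]
      _ ≤ R0 := by rw [hR0]; linarith [hLb z]
  have hRle : R0 ≤ 2 * R + ‖ζ0‖ + 1 := by rw [hR]; linarith [norm_nonneg ζ0]
  have hn1' : ∀ z ∈ closedBall c r, σ (z, L z) < 0 := by
    intro z hz
    have e : L z = L0 z := by simp only [hL]; rw [retr_id c r hr z hz]
    have hb := (hLb z).trans hBR
    rw [hσ, sig_eq]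
    have h1 := hvG z hz
    rw [← e] at h1
    have h2 := hrat _ hb
    have h3 := hAre _ hb
    have h4 := hsq _ hb
    have h5 := hn1 z hz
    dsimp only
    linarith
  have H : Cfg σ L L2 c r R0 R tm := by
    refine ⟨sig_cd v hv2 _ _ _ _ _, sig_strict v hvL _ _ _ _ _, hLc, ?_, ?_, hn1', ?_, hR0p, hR.ge,
      fun z => (hLb z).trans hBR, hL2b, by rw [htm]; positivity, ?_, ?_⟩
    · have : Continuous fun z => max (s - (L z).re) 0 :=
        (continuous_const.sub (Complex.continuous_re.comp hLc)).max continuous_const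
      exact hLc.add (Complex.continuous_ofReal.comp this)
    · intro z hz
      have := hs _ (retr_out c r hr z hz)
      simp only [hL2]
      rw [max_eq_right (by simp only [hL]; linarith)]; simp
    · intro z hz
      rcases le_total s (L z).re with h | h
      · have : L2 z = L z := by
          simp only [hL2]
          rw [max_eq_right (by linarith)]; simp
        rw [this]; exact hn1' z hz
      · have hre : (L2 z).re = s := by rw [hL2re, max_eq_left h]
        have hb := hL2b z
        rw [hσ, sig_eq]
        have h1 := hvM z hz (L2 z) (hb.trans hRle)
        have h2 := hrat _ hb
        have h4 := hsq _ hb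
        have h5 := hn1 z hz
        dsimp only
        rw [hre, hAs]
        linarith
    · intro z hz ζ hb
      rw [hσ, sig_eq]
      have h1 := hvM z hz ζ (hb.trans hRle)
      have h2 := hrat _ hb
      have h3 := hAre _ hb
      have h4 := hsq _ hb
      have h5 := hn1 z hz
      dsimp only
      linarith
    · intro z hz ζ hb
      rw [hσ, sig_eq]
      dsimp only
      have h1 := hvlb (z, ζ)
      have h2 : (‖ζ‖ / |R0|) ^ (2 * k) = 4 ^ k := by
        rw [hb, habs, hR, mul_div_assoc, div_self hR0p.ne', pow_mul]; norm_num
      have h3 : -(A * (|s1| + R)) ≤ A * (s1 - ζ.re) := by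
        rw [← mul_neg]
        gcongr
        have := (abs_le.1 (Complex.abs_re_le_norm ζ)).2
        have := (neg_abs_le s1)
        linarith
      rw [h2]
      have := sq_nonneg ‖z‖
      have := sq_nonneg ‖ζ‖
      linarith
  have hz0c := ball_subset_closedBall hz0
  have eL : L z0 = L0 z0 := by simp only [hL]; rw [retr_id c r hr z0 hz0c]
  have hdp : 0 < d := by rw [hd]; linarith
  have hmain : ∀ x, (L0 z0).re < x → x < (L0 z0).re + d → ∃ e : ℂ, e.re = x ∧ ‖e‖ ≤ R ∧ v (z0, e) < -N := by
    intro x hx1 hx2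
    have hxs1 : x < s1 := by rw [hs1]; rw [hd] at hx2; linarith
    obtain ⟨ζ, h1, h2, h3⟩ := vert H z0 x (by simp [hL2]) (by rw [eL]; exact hx1)
      (by rw [hL2re]; exact lt_max_of_lt_left (by linarith))
    refine ⟨ζ, h1, h2, ?_⟩
    rw [hσ, sig_eq] at h3
    dsimp only at h3
    rw [h1] at h3
    have a1 : 0 ≤ A * (s1 - x) := mul_nonneg hA0 (by linarith)
    have a2 : 0 ≤ (‖ζ‖ / |R0|) ^ (2 * k) := by positivity
    have := sq_nonneg ‖z0‖
    have := sq_nonneg ‖ζ‖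
    linarith
  have hP := pot R d (L0 z0).re (by rw [hR]; positivity) hdp ζ0 (fun ζ => v (z0, ζ))
    (hv2.continuous.comp (by fun_prop)) (fun ζ => LTay_comp (Θ := fun ζ => (z0, ζ)) (w := v)
      (analyticAt_const.prod analyticAt_id) (hvL _)) M0 N (by linarith)
      (fun ζ hζ => hvM z0 hz0c ζ hζ) hmain
  have hfin : u ![(Th m p (z0, ζ0)).1, (Th m p (z0, ζ0)).2] ≤ ((v (z0, ζ0) : ℝ) : EReal) :=
    (le_cut hnt N0 _).trans (EReal.coe_le_coe_iff.2 (hwge _))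
  refine hfin.trans (EReal.coe_le_coe_iff.2 ?_)
  rcases hP with h | h
  · exact le_max_of_le_left h
  · exact le_max_of_le_right h

lemma keybot {u : (Fin 2 → ℂ) → EReal} (hu : Plurisubharmonic u) {L0 : ℂ → ℂ} {m p : ℂ[X]} {c : ℂ} {r : ℝ}
    (hr : 0 < r) (hc1 : closedBall c r ⊆ ball 0 1) (hL0 : ContinuousOn L0 (closedBall c r))
    (hbot : ∀ z ∈ closedBall c r, u ![(Th m p (z, L0 z)).1, (Th m p (z, L0 z)).2] = ⊥)
    {s : ℝ} (hs : ∀ z ∈ sphere c r, s ≤ (L0 z).re) {z0 : ℂ} (hz0 : z0 ∈ ball c r)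
    (hz0s : (L0 z0).re < s) (ζ0 : ℂ) :
    u ![(Th m p (z0, ζ0)).1, (Th m p (z0, ζ0)).2] = ⊥ := by
  obtain ⟨B, hB⟩ := (isCompact_closedBall c r).exists_bound_of_continuousOn hL0
  have hB0 : 0 ≤ B := (norm_nonneg _).trans (hB z0 (ball_subset_closedBall hz0))
  set R0 : ℝ := 2 * B + |s| + 1 with hR0
  set R : ℝ := 2 * R0 with hR
  have hRp : 0 < R := by positivity
  have hThc : Continuous (Th m p) := (Th_cd m p).continuous
  have hK : IsCompact (cthickening 1 (Th m p '' (closedBall c r ×ˢ closedBall (0:ℂ) (2 * R + ‖ζ0‖ + 1)))) :=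
    (((isCompact_closedBall c r).prod (isCompact_closedBall 0 _)).image hThc).cthickening
  obtain ⟨M0, hM00, hM0⟩ := usc_bddAbove (cut_usc hu 0) hK
  set d : ℝ := (s - (L0 z0).re) / 2 with hd
  set κ : ℝ := Real.log ((R+‖ζ0‖+1)/(R+‖ζ0‖))/(|Real.log (4*(R+‖ζ0‖+1)/d)|+3) with hκ
  have hκ0 : 0 < κ := by
    refine div_pos (Real.log_pos ?_) (by positivity)
    rw [one_lt_div (by positivity)]; linarith
  have hall : ∀ N : ℝ, 1 ≤ N → u ![(Th m p (z0, ζ0)).1, (Th m p (z0, ζ0)).2] ≤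
      ((max (-N + 1) (M0-(M0+N-1)*κ) : ℝ) : EReal) := by
    intro N hN
    refine keyN hu hr hc1 hL0 hbot hs hz0 hz0s ζ0 hB hB0 hR0 hR hM00 ?_ hd hN
    intro z hz ζ hζ q hq
    refine (le_cut hu.2.1 0 q).trans (EReal.coe_le_coe_iff.2 (hM0 q ?_))
    exact thickening_subset_cthickening _ _ (mem_thickening_iff.2
      ⟨_, mem_image_of_mem _ (show (z, ζ) ∈ _ from ⟨hz, by simpa using hζ⟩), hq⟩)
  rw [EReal.eq_bot_iff_forall_lt]
  intro y
  set N : ℝ := 2 + |y| + (M0 + |y| + 1) / κ with hN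
  have h0 : 0 ≤ (M0 + |y| + 1) / κ := by positivity
  refine (hall N (by rw [hN]; linarith [abs_nonneg y])).trans_lt (EReal.coe_lt_coe_iff.2 ?_)
  refine max_lt ?_ ?_
  · rw [hN]; linarith [neg_abs_le y]
  · have : (M0 + |y| + 1) ≤ (M0 + N - 1) * κ := by
      have : (M0 + |y| + 1) / κ ≤ M0 + N - 1 := by rw [hN]; linarith [abs_nonneg y]
      exact (div_le_iff₀ hκ0).1 this
    linarith [neg_abs_le y]

/-- principle M -/
lemma prinM {u : (Fin 2 → ℂ) → EReal} (hu : Plurisubharmonic u) (hub : ¬ ∀ z, u z = ⊥) {f : ℂ → ℂ}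
    (hf : ContinuousOn f (ball (0:ℂ) 1)) (huf : ∀ z ∈ ball (0:ℂ) 1, u ![z, f z] = ⊥)
    (m p : ℂ[X]) (hm : ∀ z ∈ ball (0:ℂ) 1, m.eval z ≠ 0) {c : ℂ} {r : ℝ}
    (hr : 0 < r) (hc1 : closedBall c r ⊆ ball 0 1)
    {s : ℝ} (hs : ∀ z ∈ sphere c r, s ≤ (f z / m.eval z - p.eval z).re) :
    ∀ z ∈ ball c r, s ≤ (f z / m.eval z - p.eval z).re := by
  intro z1 hz1
  by_contra! hlt
  set L0 : ℂ → ℂ := fun z => f z / m.eval z - p.eval z with hL0d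
  have hL0 : ContinuousOn L0 (closedBall c r) :=
    ((hf.mono hc1).div m.continuous.continuousOn fun z hz => hm z (hc1 hz)).sub p.continuous.continuousOn
  have hTh : ∀ z ∈ closedBall c r, Th m p (z, L0 z) = (z, f z) := by
    intro z hz
    have := hm z (hc1 hz)
    simp only [Th, hL0d, Prod.mk.injEq, true_and]
    field_simp; ring
  have hbot : ∀ z ∈ closedBall c r, u ![(Th m p (z, L0 z)).1, (Th m p (z, L0 z)).2] = ⊥ := by
    intro z hz
    rw [hTh z hz]; exact huf z (hc1 hz)
  have hopen : ∃ ρ > 0, ball z1 ρ ⊆ ball c r ∩ {z | (L0 z).re < s} := by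
    have h1 : ContinuousAt (fun z => (L0 z).re) z1 :=
      Complex.continuous_re.continuousAt.comp
        (hL0.continuousAt (Filter.mem_of_superset (isOpen_ball.mem_nhds hz1) ball_subset_closedBall))
    have h2 := h1.eventually_lt_const hlt
    exact Metric.mem_nhds_iff.1 (Filter.inter_mem (isOpen_ball.mem_nhds hz1) h2)
  obtain ⟨ρ, hρ, hsub⟩ := hopen
  refine hub (bot_of_open hu (z1, 0) ρ hρ ?_)
  intro q hq
  have hq1 : q.1 ∈ ball z1 ρ := by
    rw [mem_ball] at hq ⊢
    exact (le_max_left _ _).trans_lt hq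
  obtain ⟨h1, h2⟩ := hsub hq1
  have hmq := hm q.1 (hc1 (ball_subset_closedBall h1))
  have h3 := keybot hu hr hc1 hL0 hbot hs h1 h2 (q.2 / m.eval q.1 - p.eval q.1)
  have h4 : Th m p (q.1, q.2 / m.eval q.1 - p.eval q.1) = q := by
    apply Prod.ext
    · rfl
    · simp only [Th]; field_simp; ring
  rwa [h4] at h3
end
end

section
open Metric Set Polynomial
noncomputable section

lemma harm_rep {φ : ℂ → ℝ} {R : ℝ} (hR : 0 < R) (hφ : ContinuousOn φ (closedBall 0 R))
    (happ : ∀ (q : ℂ[X]) (η : ℝ), (∀ z ∈ sphere (0:ℂ) R, |(q.eval z).re - φ z| ≤ η) →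
      ∀ z ∈ ball (0:ℂ) R, |(q.eval z).re - φ z| ≤ η) :
    ∃ F : ℂ → ℂ, DifferentiableOn ℂ F (ball 0 R) ∧ ∀ z ∈ ball (0:ℂ) R, (F z).re = φ z := by
  have habs : |R| = R := abs_of_pos hR
  have hφs : ContinuousOn φ (sphere 0 |R|) := by rw [habs]; exact hφ.mono sphere_subset_closedBall
  have hφi : CircleIntegrable φ 0 R := hφs.circleIntegrable'
  have hφi' : CircleIntegrable (fun z => (φ z : ℂ)) 0 R :=
    (Complex.continuous_ofReal.comp_continuousOn hφs).circleIntegrable'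
  refine ⟨_, differentiableOn_circleAverage_herglotzRieszKernel_smul hφi', ?_⟩
  intro w hw
  rw [re_circleAverage_herglotzRieszKernel_smul hφi hw]
  set K : ℂ → ℝ := Complex.re ∘ herglotzRieszKernel 0 w with hK
  have hKc : ContinuousOn K (sphere 0 |R|) :=
    Complex.continuous_re.comp_continuousOn (continuousOn_herglotzRieszKernel_sphere hw)
  obtain ⟨C, hC⟩ := (isCompact_sphere (0:ℂ) |R|).exists_bound_of_continuousOn hKc
  have hC0 : 0 ≤ C := by
    refine (norm_nonneg _).trans (hC (R:ℂ) ?_)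
    simp
  have hmain : ∀ η > 0, |Real.circleAverage (K • φ) 0 R - φ w| ≤ (C + 1) * η := by
    intro η hη
    obtain ⟨q, hq⟩ := trig_approx' 0 R hR φ (hφ.mono sphere_subset_closedBall) η hη
    have h1 := happ q η hq w hw
    have hqc : ContinuousOn (fun z => (q.eval z).re) (sphere 0 |R|) := by fun_prop
    have hqi : CircleIntegrable (K • fun z => (q.eval z).re) 0 R :=
      (hKc.smul hqc).circleIntegrable'
    have hqcc : ContinuousOn (fun z => (q.eval z)) (sphere 0 |R|) := by fun_prop
    have h2 : Real.circleAverage (K • fun z => (q.eval z).re) 0 R = (q.eval w).re := by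
      have h3 : Real.circleAverage (poissonKernel 0 w • fun z => q.eval z) 0 R = q.eval w :=
        DiffContOnCl.circleAverage_poissonKernel_smul q.differentiable.diffContOnCl hw
      rw [poissonKernel_eq_re_herglotzRieszKernel] at h3
      have h4 := congrArg Complex.reCLM h3
      rw [← Complex.reCLM.circleAverage_comp_comm (hKc.smul hqcc).circleIntegrable'] at h4
      rw [Complex.reCLM_apply] at h4
      rw [← h4]
      congr 1
      funext z
      simp [hK]
    have h5 : |Real.circleAverage (K • φ) 0 R - (q.eval w).re| ≤ C * η := by
      rw [← h2, ← Real.circleAverage_sub (hKc.smul hφs).circleIntegrable' hqi]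
      refine Real.abs_circleAverage_le_circleAverage_abs.trans ?_
      refine Real.circleAverage_mono_on_of_le_circle ?_ ?_
      · exact (((hKc.smul hφs).sub (hKc.smul hqc)).abs).circleIntegrable'
      · intro z hz
        have e : (K • φ - K • fun z => (q.eval z).re) z = K z * (φ z - (q.eval z).re) := by
          simp; ring
        rw [Pi.abs_apply, e, abs_mul]
        refine mul_le_mul (hC z hz) ?_ (abs_nonneg _) hC0
        rw [abs_sub_comm]; exact hq z (habs ▸ hz)
    have := abs_sub_le (Real.circleAverage (K • φ) 0 R) (q.eval w).re (φ w)
    linarith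
  by_contra hne
  have hpos : 0 < |Real.circleAverage (K • φ) 0 R - φ w| := abs_pos.2 (sub_ne_zero.2 hne)
  have := hmain (|Real.circleAverage (K • φ) 0 R - φ w| / (2 * (C + 1))) (by positivity)
  have e : (C + 1) * (|Real.circleAverage (K • φ) 0 R - φ w| / (2 * (C + 1))) =
    |Real.circleAverage (K • φ) 0 R - φ w| / 2 := by field_simp
  linarith

lemma harm_m {u : (Fin 2 → ℂ) → EReal} (hu : Plurisubharmonic u) (hub : ¬ ∀ z, u z = ⊥) {f : ℂ → ℂ}
    (hf : ContinuousOn f (ball (0:ℂ) 1)) (huf : ∀ z ∈ ball (0:ℂ) 1, u ![z, f z] = ⊥)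
    (m : ℂ[X]) (hm : ∀ z ∈ ball (0:ℂ) 1, m.eval z ≠ 0) {R : ℝ} (hR : 0 < R) (hR1 : R < 1) :
    ∃ F : ℂ → ℂ, DifferentiableOn ℂ F (ball 0 R) ∧
      ∀ z ∈ ball (0:ℂ) R, (F z).re = (f z / m.eval z).re := by
  have hsub : closedBall (0:ℂ) R ⊆ ball 0 1 := closedBall_subset_ball hR1
  refine harm_rep hR ?_ ?_
  · exact Complex.continuous_re.comp_continuousOn
      ((hf.mono hsub).div m.continuous.continuousOn fun z hz => hm z (hsub hz))
  · intro q η hq z hz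
    have h1 := prinM hu hub hf huf m q hm hR hsub (s := -η) (fun z hz => by
      have := abs_le.1 (hq z hz)
      rw [Complex.sub_re]; linarith) z hz
    have h2 := prinM hu hub hf huf (-m) (-q) (by simpa using hm) hR hsub (s := -η) (fun z hz => by
      have := abs_le.1 (hq z hz)
      rw [Complex.sub_re, eval_neg, eval_neg, div_neg, Complex.neg_re, Complex.neg_re]; linarith) z hz
    rw [Complex.sub_re] at h1
    rw [Complex.sub_re, eval_neg, eval_neg, div_neg, Complex.neg_re, Complex.neg_re] at h2
    exact abs_le.2 ⟨by linarith, by linarith⟩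

lemma rep_pair {g F G : ℂ → ℂ} {z : ℂ} (h1 : (F z).re = (g z).re) (h2 : (G z).re = (g z).im) :
    g z = (F z + Complex.I * G z) / 2 + (starRingEnd ℂ) ((F z - Complex.I * G z) / 2) := by
  have e : (starRingEnd ℂ) ((F z - Complex.I * G z) / 2) =
      ((starRingEnd ℂ) (F z) + Complex.I * (starRingEnd ℂ) (G z)) / 2 := by
    rw [map_div₀, map_sub, map_mul, Complex.conj_I, Complex.conj_ofNat]; ring
  rw [e]
  apply Complex.ext
  · simp [← h1]; ring
  · simp [← h2]; ring

lemma conj_hasFDeriv {Q : ℂ → ℂ} {α z : ℂ} (hQ : HasDerivAt Q α z) :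
    HasFDerivAt (𝕜 := ℝ) (fun x => (starRingEnd ℂ) (Q x))
      (Complex.conjCLE.toContinuousLinearMap.comp
      ((ContinuousLinearMap.toSpanSingleton ℂ α).restrictScalars ℝ)) z := by
  have h := hQ.hasFDerivAt.restrictScalars ℝ
  exact (Complex.conjCLE.toContinuousLinearMap.hasFDerivAt (x := Q z)).comp z h

lemma conj_not_diff (z : ℂ) : ¬ DifferentiableAt ℂ (fun x => (starRingEnd ℂ) x) z := by
  intro h
  have e := (h.hasDerivAt.hasFDerivAt.restrictScalars ℝ).unique (conj_hasFDeriv (hasDerivAt_id z))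
  have e1 := congrArg (fun T => T 1) e
  have e2 := congrArg (fun T => T Complex.I) e
  simp at e1 e2
  rw [e1] at e2
  have := congrArg Complex.im e2
  norm_num at this

open ComplexConjugate in
lemma dbar {P Q P1 Q1 m : ℂ → ℂ} {z α β : ℂ} (hP : DifferentiableAt ℂ P z) (hP1 : DifferentiableAt ℂ P1 z)
    (hm : DifferentiableAt ℂ m z) (hQ : HasDerivAt Q α z) (hQ1 : HasDerivAt Q1 β z)
    (h : ∀ᶠ x in nhds z, P x + conj (Q x) = m x * (P1 x + conj (Q1 x))) :
    conj α = m z * conj β := by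
  have cQ := conj_hasFDeriv hQ
  have cQ1 := conj_hasFDeriv hQ1
  have a1 := (hP.hasDerivAt.hasFDerivAt.restrictScalars ℝ).add cQ
  have a2 := (hm.hasDerivAt.hasFDerivAt.restrictScalars ℝ).mul
    ((hP1.hasDerivAt.hasFDerivAt.restrictScalars ℝ).add cQ1)
  have a3 := a2.congr_of_eventuallyEq h
  have e := a1.unique a3
  have e1 := congrArg (fun T => T 1) e
  have e2 := congrArg (fun T => T Complex.I) e
  simp at e1 e2
  have : Complex.I * Complex.I = -1 := Complex.I_mul_I
  linear_combination (1/2) * e1 + (Complex.I/2) * e2 + (this * (1/2)) * (conj α) +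
    (this * (1/2)) * (m z * deriv P1 z - m z * conj β + (P1 z + conj (Q1 z)) * deriv m z - deriv P z)

open ComplexConjugate in
lemma holo_of_pairs {f P Q P1 Q1 : ℂ → ℂ} {R : ℝ}
    (hP : DifferentiableOn ℂ P (ball 0 R)) (hQ : DifferentiableOn ℂ Q (ball 0 R))
    (hP1 : DifferentiableOn ℂ P1 (ball 0 R)) (hQ1 : DifferentiableOn ℂ Q1 (ball 0 R))
    (h : ∀ z ∈ ball (0:ℂ) R, f z = P z + conj (Q z))
    (h1 : ∀ z ∈ ball (0:ℂ) R, f z = (z - 2) * (P1 z + conj (Q1 z))) :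
    DifferentiableOn ℂ f (ball 0 R) := by
  have key : ∀ z ∈ ball (0:ℂ) R, conj (deriv Q z) = (z - 2) * conj (deriv Q1 z) := by
    intro z hz
    have hn := isOpen_ball.mem_nhds hz
    refine dbar (m := fun z => z - 2) (hP.differentiableAt hn) (hP1.differentiableAt hn) (by fun_prop)
      (hQ.differentiableAt hn).hasDerivAt (hQ1.differentiableAt hn).hasDerivAt ?_
    filter_upwards [hn] with x hx
    rw [← h x hx, h1 x hx]
  have hd : DifferentiableOn ℂ (deriv Q) (ball 0 R) := hQ.deriv isOpen_ball
  have hd1 : DifferentiableOn ℂ (deriv Q1) (ball 0 R) := hQ1.deriv isOpen_ball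
  have hz1 : ∀ z ∈ ball (0:ℂ) R, deriv Q1 z = 0 := by
    intro z hz
    by_contra hne
    have hn := isOpen_ball.mem_nhds hz
    have hq : DifferentiableAt ℂ (fun x => deriv Q x / deriv Q1 x + 2) z :=
      ((hd.differentiableAt hn).div (hd1.differentiableAt hn) hne).add_const 2
    have hev : (fun x => conj x) =ᶠ[nhds z] fun x => deriv Q x / deriv Q1 x + 2 := by
      have hc := (hd1.differentiableAt hn).continuousAt.eventually_ne hne
      filter_upwards [hn, hc] with x hx hx1
      have := congrArg conj (key x hx)
      simp only [map_mul, map_sub, Complex.conj_conj, Complex.conj_ofNat] at this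
      rw [this]; field_simp; ring
    have hcd := hq.congr_of_eventuallyEq hev
    exact conj_not_diff _ hcd
  have hz2 : ∀ z ∈ ball (0:ℂ) R, deriv Q z = 0 := by
    intro z hz
    have := key z hz
    rw [hz1 z hz] at this
    simpa using this
  intro z hz
  have hQc : ∀ x ∈ ball (0:ℂ) R, Q x = Q z := by
    intro x hx
    exact isOpen_ball.is_const_of_deriv_eq_zero (convex_ball _ _).isPreconnected hQ
      (fun y hy => hz2 y hy) hx hz
  refine ((hP z hz).add_const (conj (Q z))).congr (fun x hx => ?_) ?_
  · rw [h x hx, hQc x hx]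
  · rw [h z hz]

lemma main_aux (f : ℂ → ℂ) (hf : ContinuousOn f (ball (0 : ℂ) 1))
    (hE : Pluripolar {p : Fin 2 → ℂ | ∃ z ∈ ball (0 : ℂ) 1, p = ![z, f z]}) :
    DifferentiableOn ℂ f (ball (0 : ℂ) 1) := by
  obtain ⟨u, hu, hub, hE⟩ := hE
  have huf : ∀ z ∈ ball (0:ℂ) 1, u ![z, f z] = ⊥ := fun z hz => hE _ ⟨z, hz, rfl⟩
  intro w hw
  have hw1 : ‖w‖ < 1 := by simpa using hw
  obtain ⟨R, hwR, hR1⟩ := exists_between hw1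
  have hR : 0 < R := (norm_nonneg w).trans_lt hwR
  have hm2 : ∀ z ∈ ball (0:ℂ) 1, z - 2 ≠ 0 := by
    intro z hz h
    have : z = 2 := sub_eq_zero.1 h
    rw [this] at hz
    simp at hz
  obtain ⟨F, hF, eF⟩ := harm_m hu hub hf huf 1 (by simp) hR hR1
  obtain ⟨G, hG, eG⟩ := harm_m hu hub hf huf (C Complex.I) (by simp) hR hR1
  obtain ⟨F1, hF1, eF1⟩ := harm_m hu hub hf huf (X - C 2) (by simpa using hm2) hR hR1
  obtain ⟨G1, hG1, eG1⟩ := harm_m hu hub hf huf (C Complex.I * (X - C 2)) (by simpa using hm2) hR hR1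
  have hdiv : ∀ x : ℂ, (x / Complex.I).re = x.im := by intro x; simp [Complex.div_I]
  have hsub : ball (0:ℂ) R ⊆ ball 0 1 := ball_subset_ball hR1.le
  have := holo_of_pairs (f := f) (P := fun z => (F z + Complex.I * G z) / 2)
    (Q := fun z => (F z - Complex.I * G z) / 2) (P1 := fun z => (F1 z + Complex.I * G1 z) / 2)
    (Q1 := fun z => (F1 z - Complex.I * G1 z) / 2) (R := R)
    (by fun_prop) (by fun_prop) (by fun_prop) (by fun_prop)
    (fun z hz => rep_pair (by simpa using eF z hz) (by rw [eG z hz, eval_C, hdiv]))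
    (fun z hz => by
      have h0 := hm2 z (hsub hz)
      have := rep_pair (g := fun z => f z / (z - 2)) (z := z) (F := F1) (G := G1)
        (by simpa using eF1 z hz) (by
          rw [eG1 z hz, eval_mul, eval_C, eval_sub, eval_X, eval_C, ← hdiv, div_div, mul_comm])
      rw [← this]; field_simp)
  exact (this.differentiableAt (isOpen_ball.mem_nhds (by simpa using hwR))).differentiableWithinAt
end
end

/-- **Nishino's question / Shcherbina's theorem.** If the graph of a continuous function
`f` on the unit disc `𝔻 ⊆ ℂ` is pluripolar in `ℂ²`, then `f` is holomorphic on `𝔻`. -/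
theorem holomorphic_of_graph_pluripolar_disc
    (f : ℂ → ℂ) (hf : ContinuousOn f (ball (0 : ℂ) 1))
    (hE : Pluripolar {p : Fin 2 → ℂ | ∃ z ∈ ball (0 : ℂ) 1, p = ![z, f z]}) :
    DifferentiableOn ℂ f (ball (0 : ℂ) 1) := by
  exact main_aux f hf hE
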